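/- arXiv:1904.09642 — 8 statements merged into one kernel-verified Lean document; each statement's English description precedes it below -/
import Mathlib

section
/- Let $r$ be a positive integer and let $a_1,a_2,a_3,a_4,e$ be integers such that $q:=\gcd(e,r)=\gcd(a_4,r)>1$ and such that $a_1,a_2,a_3$ are each coprime to $r$. Assume that for every $k=1,\ldots,r-1$ one has $\overline{a_1k}+\overline{a_2k}+\overline{a_3k}+\overline{a_4k}=\overline{ek}+k+r$. Then $a_4\equiv e \pmod r$, and after a permutation of $a_1,a_2,a_3$ one has $a_1\equiv 1 \pmod r$ and $a_2+a_3\equiv 0 \pmod r$. -/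
/-- Least non-negative residue of `n` modulo `r` (for `r > 0`). -/
def res (r n : ℤ) : ℤ := n % r

lemma ed_eq {s x m : ℤ} (h1 : s * m ≤ x) (h2 : x < s * m + s) : x / s = m := by
  have hs : 0 < s := by linarith
  apply le_antisymm
  · have : x / s < m + 1 := by
      rw [Int.ediv_lt_iff_lt_mul hs]; nlinarith
    linarith
  · rw [Int.le_ediv_iff_mul_le hs]; nlinarith

lemma ed_le {s : ℤ} (hs : 0 < s) (x : ℤ) : s * (x / s) ≤ x := Int.mul_ediv_self_le hs.ne'

lemma ed_lt {s : ℤ} (hs : 0 < s) (x : ℤ) : x < s * (x / s) + s := by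
  have := Int.emod_lt_of_pos x hs
  have := Int.emod_add_mul_ediv x s
  linarith

lemma em_eq {m x y : ℤ} (d : ℤ) (h0 : 0 ≤ x) (h1 : x < m) (h : y = x + m * d) : y % m = x := by
  rw [h, Int.add_mul_emod_self_left, Int.emod_eq_of_lt h0 h1]

lemma cross {s X Y n m : ℤ} (hs : 0 < s) (hX : 0 < X) (hm : 1 ≤ m)
    (hag : ∀ k, 0 ≤ k → k ≤ n → X * k / s = Y * k / s) (hn : s * m ≤ X * n) :
    ∃ P, 0 ≤ P ∧ X * P < s * m ∧ s * m ≤ Y * (P + 1) := by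
  refine ⟨(s * m - 1) / X, ?_, ?_, ?_⟩
  · apply Int.ediv_nonneg _ hX.le
    nlinarith
  · have := ed_le hX (s * m - 1)
    linarith
  · set P := (s * m - 1) / X with hP
    have h0 : 0 ≤ P := by
      apply Int.ediv_nonneg _ hX.le
      nlinarith
    have h1 := ed_le hX (s * m - 1)
    have h2 := ed_lt hX (s * m - 1)
    rw [← hP] at h1 h2
    have h3 : P < n := by
      by_contra! h
      nlinarith
    have h4 : m ≤ X * (P + 1) / s := by
      rw [Int.le_ediv_iff_mul_le hs]; nlinarith
    rw [hag _ (by omega) (by omega)] at h4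
    have := ed_le hs (Y * (P + 1))
    nlinarith

lemma beatty {s X Y n p : ℤ} (hs : 0 < s) (hX : 0 < X) (hY : 0 < Y) (hp : 1 ≤ p)
    (hag : ∀ k, 0 ≤ k → k ≤ n → X * k / s = Y * k / s) (hpn : s * p ≤ X * n)
    (h : s * (p + 1) ≤ X * (n + 1)) : s * (p + 1) ≤ Y * (n + 2) := by
  obtain ⟨N, hN0, hN1, hN2⟩ := cross hs hX le_rfl hag (by nlinarith)
  obtain ⟨P, hP0, hP1, hP2⟩ := cross hs hX hp hag hpn
  have h1 : P + N < n + 1 := by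
    by_contra! hc
    nlinarith
  nlinarith

lemma white_core {q a b c : ℤ} (hc : 2 ≤ c) (hcb : c ≤ b) (hba : b ≤ a) (haq : a < q)
    (H : ∀ k, 1 ≤ k → k ≤ q - 1 → (q - a) * k / q = b * k / q + c * k / q) : False := by
  have hq : 0 < q := by linarith
  obtain ⟨a', ha'⟩ : ∃ a', a' = q - a := ⟨_, rfl⟩
  rw [← ha'] at H
  have h2 : 2 * a' ≤ q := by
    by_contra! h
    have e := H 2 (by norm_num) (by omega)
    have e1 : a' * 2 / q = 1 := ed_eq (by linarith) (by linarith)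
    have e2 : b * 2 / q = 0 := ed_eq (by linarith) (by linarith)
    have e3 : c * 2 / q = 0 := ed_eq (by linarith) (by linarith)
    omega
  obtain ⟨n, hn⟩ : ∃ n, n = (q - 1) / c := ⟨_, rfl⟩
  have n1 := ed_le (by linarith : 0 < c) (q - 1)
  have n2 := ed_lt (by linarith : 0 < c) (q - 1)
  rw [← hn] at n1 n2
  have n0 : 1 ≤ n := by
    by_contra! h
    nlinarith
  have hag : ∀ k, 0 ≤ k → k ≤ n → a' * k / q = b * k / q := by
    intro k hk hkn
    rcases hk.eq_or_lt with rfl | hk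
    · simp
    have e3 : c * k / q = 0 := ed_eq (by nlinarith) (by nlinarith)
    rw [H k hk (by nlinarith), e3, add_zero]
  obtain ⟨p, hp⟩ : ∃ p, p = b * n / q := ⟨_, rfl⟩
  have hpa := hag n (by omega) le_rfl
  rw [← hp] at hpa
  have p1 := ed_le hq (b * n)
  have p2 := ed_lt hq (b * n)
  rw [← hp] at p1 p2
  have p3 := ed_le hq (a' * n)
  have p4 := ed_lt hq (a' * n)
  rw [hpa] at p3 p4
  have e1 := H (n + 1) (by omega) (by nlinarith)
  have e2 : c * (n + 1) / q = 1 := ed_eq (by nlinarith) (by nlinarith)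
  have e3 : a' * (n + 1) / q < p + 2 := by
    rw [Int.ediv_lt_iff_lt_mul hq]; nlinarith
  have e4 : p ≤ b * (n + 1) / q := by
    rw [Int.le_ediv_iff_mul_le hq]; nlinarith
  have e5 : b * (n + 1) / q = p := by omega
  have e6 : a' * (n + 1) / q = p + 1 := by omega
  have f1 := ed_lt hq (b * (n + 1))
  have f2 := ed_le hq (a' * (n + 1))
  rw [e5] at f1
  rw [e6] at f2
  have hp1 : 1 ≤ p := by
    by_contra! h
    nlinarith
  have g := beatty hq (by linarith) (by linarith) hp1 hag p3 f2
  have hn2 : 2 ≤ n := by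
    by_contra! h
    nlinarith
  have e7 := H (n + 2) (by omega) (by nlinarith)
  have e8 : p + 1 ≤ b * (n + 2) / q := by
    rw [Int.le_ediv_iff_mul_le hq]; nlinarith
  have e9 : 1 ≤ c * (n + 2) / q := by
    rw [Int.le_ediv_iff_mul_le hq]; nlinarith
  have f3 := ed_le hq (a' * (n + 2))
  nlinarith

lemma ndvd {q a k : ℤ} (hg : Int.gcd a q = 1) (h1 : 1 ≤ k) (h2 : k ≤ q - 1) : (a * k) % q ≠ 0 := by
  intro h
  have h3 : q ∣ a * k := Int.dvd_of_emod_eq_zero h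
  have h4 : q ∣ k := by
    apply Int.dvd_of_dvd_mul_right_of_gcd_one h3
    rwa [Int.gcd_comm]
  have := Int.le_of_dvd (by omega) h4
  omega

/-- White's lemma for residues in sorted order. -/
lemma white_sorted {q a b c : ℤ} (hq : 2 ≤ q) (hc0 : 0 ≤ c) (hcb : c ≤ b) (hba : b ≤ a) (haq : a < q)
    (ha : Int.gcd a q = 1)
    (hc : Int.gcd c q = 1)
    (H : ∀ k, 1 ≤ k → k ≤ q - 1 → (a * k) % q + (b * k) % q + (c * k) % q = k + q) :
    c = 1 ∧ a + b = q := by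
  have hc1 : c ≠ 0 := by
    rintro rfl
    simp at hc
    omega
  have hs := H 1 le_rfl (by omega)
  rw [mul_one, mul_one, mul_one, Int.emod_eq_of_lt (by omega) haq,
    Int.emod_eq_of_lt (by omega) (by omega), Int.emod_eq_of_lt (by omega) (by omega)] at hs
  by_cases h : c = 1
  · omega
  exfalso
  apply white_core (c := c) (by omega) hcb hba haq
  intro k h1 h2
  have e := H k h1 h2
  have ne := ndvd ha h1 h2
  have l0 := Int.emod_nonneg (a * k) (by omega : q ≠ 0)
  have l1 := Int.emod_lt_of_pos (a * k) (by omega : 0 < q)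
  have m1 := Int.emod_add_mul_ediv (a * k) q
  have m2 := Int.emod_add_mul_ediv (b * k) q
  have m3 := Int.emod_add_mul_ediv (c * k) q
  have hpos : 0 < (a * k) % q := by omega
  have e1 : (q - a) * k / q = k - 1 - a * k / q := by
    apply ed_eq
    · nlinarith
    · nlinarith
  rw [e1]
  have : q * (k - 1 - a * k / q) = q * (b * k / q + c * k / q) := by
    have : (a + b + c) * k = (1 + q) * k := by rw [hs]
    nlinarith
  exact mul_left_cancel₀ (by omega) this

lemma em_mul (a k q : ℤ) : (a % q * k) % q = (a * k) % q := by
  rw [Int.mul_emod, Int.emod_emod, ← Int.mul_emod]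

lemma white_s {q a b c : ℤ} (hq : 2 ≤ q) (hcb : c % q ≤ b % q) (hba : b % q ≤ a % q)
    (ha : Int.gcd a q = 1) (hc : Int.gcd c q = 1)
    (H : ∀ k, 1 ≤ k → k ≤ q - 1 → (a * k) % q + (b * k) % q + (c * k) % q = k + q) :
    c ≡ 1 [ZMOD q] ∧ a + b ≡ 0 [ZMOD q] := by
  have h := white_sorted (q := q) (a := a % q) (b := b % q) (c := c % q) hq
    (Int.emod_nonneg _ (by omega)) hcb hba (Int.emod_lt_of_pos _ (by omega))
    (by rw [Int.gcd_emod]; exact ha)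
    (by rw [Int.gcd_emod]; exact hc)
    (by
      intro k h1 h2
      simpa only [em_mul] using H k h1 h2)
  constructor
  · rw [Int.ModEq, h.1, Int.emod_eq_of_lt (by omega) (by omega)]
  · rw [Int.ModEq, Int.add_emod, h.2]
    simp

lemma white {q a b c : ℤ} (hq : 2 ≤ q)
    (ha : Int.gcd a q = 1) (hb : Int.gcd b q = 1) (hc : Int.gcd c q = 1)
    (H : ∀ k, 1 ≤ k → k ≤ q - 1 → (a * k) % q + (b * k) % q + (c * k) % q = k + q) :
    (a ≡ 1 [ZMOD q] ∧ b + c ≡ 0 [ZMOD q]) ∨ (b ≡ 1 [ZMOD q] ∧ a + c ≡ 0 [ZMOD q]) ∨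
    (c ≡ 1 [ZMOD q] ∧ a + b ≡ 0 [ZMOD q]) := by
  have H1 : ∀ k, 1 ≤ k → k ≤ q - 1 → (b * k) % q + (a * k) % q + (c * k) % q = k + q := by
    intro k h1 h2; linarith [H k h1 h2]
  have H2 : ∀ k, 1 ≤ k → k ≤ q - 1 → (a * k) % q + (c * k) % q + (b * k) % q = k + q := by
    intro k h1 h2; linarith [H k h1 h2]
  have H3 : ∀ k, 1 ≤ k → k ≤ q - 1 → (c * k) % q + (a * k) % q + (b * k) % q = k + q := by
    intro k h1 h2; linarith [H k h1 h2]
  have H4 : ∀ k, 1 ≤ k → k ≤ q - 1 → (b * k) % q + (c * k) % q + (a * k) % q = k + q := by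
    intro k h1 h2; linarith [H k h1 h2]
  have H5 : ∀ k, 1 ≤ k → k ≤ q - 1 → (c * k) % q + (b * k) % q + (a * k) % q = k + q := by
    intro k h1 h2; linarith [H k h1 h2]
  rcases le_total (a % q) (b % q) with h1 | h1 <;> rcases le_total (a % q) (c % q) with h2 | h2 <;>
    rcases le_total (b % q) (c % q) with h3 | h3
  · exact Or.inl (by simpa only [add_comm] using white_s hq h1 h3 hc ha H5)
  · exact Or.inl (white_s hq h2 h3 hb ha H4)
  · exact Or.inr (Or.inr (by simpa only [add_comm] using white_s hq h2 h1 hb hc H1))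
  · exact Or.inr (Or.inr (by simpa only [add_comm] using white_s hq h2 h1 hb hc H1))
  · exact Or.inr (Or.inl (by simpa only [add_comm] using white_s hq h1 h2 hc hb H3))
  · exact Or.inl (white_s hq (by omega) h3 hb ha H4)
  · exact Or.inr (Or.inl (white_s hq h3 h2 ha hb H2))
  · exact Or.inr (Or.inr (white_s hq h3 h1 ha hc H))

/-- Parity core for `q = 2`. -/
lemma two_core {s b x y : ℤ} (hb : 0 < b) (hbs : b < s) (hx : 2 ≤ x) (hxy : x ≤ y) (hys : y < s)
    (H : ∀ k, 1 ≤ k → k ≤ s - 1 → (b * k / s) % 2 = (x * k / s) % 2 + (y * k / s) % 2) : False := by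
  have hs : 0 < s := by omega
  obtain ⟨n, hn⟩ : ∃ n, n = (s - 1) / x := ⟨_, rfl⟩
  have n1 := ed_le (by linarith : 0 < x) (s - 1)
  have n2 := ed_lt (by linarith : 0 < x) (s - 1)
  rw [← hn] at n1 n2
  have n0 : 1 ≤ n := by
    by_contra! h
    nlinarith
  have step : ∀ z k : ℤ, 0 < z → z < s → z * (k + 1) / s = z * k / s ∨
      z * (k + 1) / s = z * k / s + 1 := by
    intro z k h0 h1
    have g1 := ed_le hs (z * k)
    have g2 := ed_lt hs (z * k)
    have e3 : z * (k + 1) / s < z * k / s + 2 := by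
      rw [Int.ediv_lt_iff_lt_mul hs]; nlinarith
    have e4 : z * k / s ≤ z * (k + 1) / s := by
      rw [Int.le_ediv_iff_mul_le hs]; nlinarith
    omega
  have hagN : ∀ k : ℕ, (k : ℤ) ≤ n → b * k / s = y * k / s := by
    intro k
    induction k with
    | zero => intro _; simp
    | succ k ih =>
      intro hk
      push_cast at hk ⊢
      have e3 : x * ((k : ℤ) + 1) / s = 0 := ed_eq (by nlinarith) (by nlinarith)
      have e := H (k + 1) (by omega) (by nlinarith)
      have i := ih (by omega)
      have s1 := step b k hb hbs
      have s2 := step y k (by omega) hys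
      omega
  have hag : ∀ k, 0 ≤ k → k ≤ n → b * k / s = y * k / s := by
    intro k h0 h1
    obtain ⟨m, rfl⟩ := Int.eq_ofNat_of_zero_le h0
    exact hagN m h1
  have hag' : ∀ k, 0 ≤ k → k ≤ n → y * k / s = b * k / s := fun k h0 h1 => (hag k h0 h1).symm
  obtain ⟨p, hp⟩ : ∃ p, p = y * n / s := ⟨_, rfl⟩
  have hpb := hag n (by omega) le_rfl
  rw [← hp] at hpb
  have p1 := ed_le hs (y * n)
  have p2 := ed_lt hs (y * n)
  rw [← hp] at p1 p2
  have p3 := ed_le hs (b * n)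
  have p4 := ed_lt hs (b * n)
  rw [hpb] at p3 p4
  have s1 := step b n hb hbs
  have s2 := step y n (by omega) hys
  have s3 := step b (n + 1) hb hbs
  have s4 := step y (n + 1) (by omega) hys
  have e1 := H (n + 1) (by omega) (by nlinarith)
  have e2 : x * (n + 1) / s = 1 := ed_eq (by nlinarith) (by nlinarith)
  have p0 : 0 ≤ p := by
    rw [hp]; apply Int.ediv_nonneg _ hs.le; nlinarith
  have hp1 : 1 ≤ p := by
    by_contra! h
    have : p = 0 := by omega
    have : y * (n + 1) / s = 1 := ed_eq (by nlinarith) (by nlinarith)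
    omega
  have hn2 : 2 ≤ n := by
    by_contra! h
    nlinarith
  have hxn : x * 2 ≤ x * n := by nlinarith
  have e7 := H (n + 2) (by omega) (by nlinarith)
  have e8 : x * (n + 2) / s = 1 := ed_eq (by nlinarith) (by nlinarith)
  have r2 : n + 1 + 1 = n + 2 := by ring
  rw [r2] at s3 s4
  have f1 := ed_le hs (y * (n + 1))
  have f2 := ed_le hs (b * (n + 1))
  rcases Int.emod_two_eq_zero_or_one p with hpar | hpar
  · have g1 : b * (n + 1) / s = p + 1 := by omega
    have g2 : y * (n + 1) / s = p := by omega
    have g3 : y * (n + 2) / s = p := by omega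
    rw [g1] at f2
    have g := beatty hs hb (by linarith) hp1 hag p3 f2
    have := ed_lt hs (y * (n + 2))
    rw [g3] at this
    linarith
  · have g1 : y * (n + 1) / s = p + 1 := by omega
    have g2 : b * (n + 1) / s = p := by omega
    have g3 : b * (n + 2) / s = p := by omega
    rw [g1] at f1
    have g := beatty hs (by linarith) hb hp1 hag' p1 f1
    have := ed_lt hs (b * (n + 2))
    rw [g3] at this
    linarith

/-- Classification of the shifts in the generic case. -/
lemma cls {q a t1 t2 t3 : ℤ} (ha2 : 2 ≤ a) (haq : a ≤ q - 2) (hg : Int.gcd a q = 1)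
    (h10 : 0 ≤ t1) (h1q : t1 < q) (h20 : 0 ≤ t2) (h2q : t2 < q) (h30 : 0 ≤ t3) (h3q : t3 < q)
    (E : ∀ j, 0 ≤ j → j < q → (t1 + j) % q + (t2 + a * j) % q + (t3 - a * j) % q
      = j + t1 + t2 + t3) : t1 = 0 ∨ t1 = 1 ∨ t1 = q - 1 := by
  by_contra! hne
  obtain ⟨y, hy⟩ : ∃ y : ℤ → ℤ, y = fun j => (t2 + a * j) % q := ⟨_, rfl⟩
  have hyb : ∀ j, 0 ≤ y j ∧ y j < q := by
    intro j
    rw [hy]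
    exact ⟨Int.emod_nonneg _ (by omega), Int.emod_lt_of_pos _ (by omega)⟩
  have hys : ∀ j, y (j + 1) = (y j + a) % q := by
    intro j
    rw [hy]
    simp only [Int.emod_add_emod]
    congr 1; ring
  have hys' : ∀ j, y (j + 1) = y j + a ∨ y (j + 1) = y j + a - q := by
    intro j
    rw [hys]
    have := hyb j
    by_cases h : y j + a < q
    · left; exact Int.emod_eq_of_lt (by omega) h
    · right; exact em_eq 1 (by omega) (by omega) (by ring)
  have key : ∀ j, 0 ≤ j → j < q → (t2 + t3 ≤ q - 2 ∨ j < q - t1) ∧ (t2 + t3 < y j ↔ q - t1 ≤ j) := by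
    intro j hj0 hjq
    have e := E j hj0 hjq
    have b := hyb j
    have z0 := Int.emod_nonneg (t3 - a * j) (by omega : q ≠ 0)
    have z1 := Int.emod_lt_of_pos (t3 - a * j) (by omega : 0 < q)
    change _ + (fun j => (t2 + a * j) % q) j + _ = _ at e
    rw [← hy] at e
    by_cases h : t1 + j < q
    · rw [Int.emod_eq_of_lt (by omega) h] at e
      omega
    · rw [em_eq (x := t1 + j - q) 1 (by omega) (by omega) (by ring)] at e
      omega
  have hsig := (key (q - 1) (by omega) (by omega)).1
  have k0 := key 0 (by omega) (by omega)
  have k1 := key 1 (by omega) (by omega)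
  have k2 := key (q - 1) (by omega) (by omega)
  have k3 := key (q - 2) (by omega) (by omega)
  have b0 := hyb 0
  have b1 := hyb 1
  have b2 := hyb (q - 1)
  have b3 := hyb (q - 2)
  have s0 := hys' 0
  have s1 := hys' (q - 2)
  rw [zero_add] at s0
  rw [show q - 2 + 1 = q - 1 by ring] at s1
  have sig1 : 1 ≤ t2 + t3 := by omega
  have sig2 : t2 + t3 ≤ q - 3 := by omega
  have surj : ∀ y0, 0 ≤ y0 → y0 < q → ∃ j, 0 ≤ j ∧ j < q ∧ y j = y0 := by
    intro y0 h0 h1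
    have hb := Int.gcd_eq_gcd_ab a q
    rw [hg] at hb
    refine ⟨((y0 - t2) * Int.gcdA a q) % q, Int.emod_nonneg _ (by omega),
      Int.emod_lt_of_pos _ (by omega), ?_⟩
    rw [hy]
    have m := Int.emod_add_mul_ediv ((y0 - t2) * Int.gcdA a q) q
    refine em_eq (-(a * (((y0 - t2) * Int.gcdA a q) / q)) - (y0 - t2) * Int.gcdB a q) h0 h1 ?_
    push_cast at hb
    have : ((y0 - t2) * Int.gcdA a q) % q = (y0 - t2) * Int.gcdA a q - q * (((y0 - t2) * Int.gcdA a q) / q) := by linarith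
    rw [this]
    linear_combination (y0 - t2) * (-hb)
  have uniq : ∀ y0, t2 + t3 < y0 → y0 < q → y0 + a - q ≤ t2 + t3 → q ≤ y0 + a → y0 = y (q - 1) := by
    intro y0 h0 h1 h2 h3
    obtain ⟨j, hj0, hjq, hj⟩ := surj y0 (by omega) h1
    by_cases hjl : j = q - 1
    · rw [← hj, hjl]
    exfalso
    have g1 := key j hj0 hjq
    have g2 := key (j + 1) (by omega) (by omega)
    have g3 := hys' j
    have g4 := hyb (j + 1)
    omega
  by_cases hA : a - 1 ≤ t2 + t3
  · have u1 := uniq (q - 1) (by omega) (by omega) (by omega) (by omega)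
    have u2 := uniq (q - 2) (by omega) (by omega) (by omega) (by omega)
    omega
  · have u1 := uniq (q + (t2 + t3) - a) (by omega) (by omega) (by omega) (by omega)
    have u2 := uniq (q + (t2 + t3) - 1 - a) (by omega) (by omega) (by omega) (by omega)
    omega

/-- the block index of `a k` modulo `q s`. -/
def tt (q s a k : ℤ) : ℤ := (a * k) % (q * s) / s

lemma tt_nonneg {q s : ℤ} (hq : 2 ≤ q) (hs : 1 ≤ s) (a k : ℤ) : 0 ≤ tt q s a k :=
  Int.ediv_nonneg (Int.emod_nonneg _ (by positivity)) (by omega)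

lemma tt_lt {q s : ℤ} (hq : 2 ≤ q) (hs : 1 ≤ s) (a k : ℤ) : tt q s a k < q := by
  unfold tt
  rw [Int.ediv_lt_iff_lt_mul (by omega)]
  exact Int.emod_lt_of_pos _ (by positivity)

lemma mul_small {r m : ℤ} (hr : 0 < r) (h1 : -r < r * m) (h2 : r * m < r) : m = 0 := by
  have : m < 1 := by by_contra! h; nlinarith
  have : -1 < m := by by_contra! h; nlinarith
  omega

lemma c1_core {q s A B : ℤ} (hq : 3 ≤ q) (hA : 4 ≤ A) (hAs : A < s) (hAB : A ≤ B)
    (hB : B < q * s)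
    (H : ∀ k, 1 ≤ k → k ≤ s - 1 → (A * k) % (q * s) < s ∨ (B * k) % (q * s) < s) : False := by
  obtain ⟨r, hr⟩ : ∃ r, r = q * s := ⟨_, rfl⟩
  rw [← hr] at H hB
  have hr3 : 3 * s ≤ r := by nlinarith
  obtain ⟨n, hn⟩ : ∃ n, n = (s - 1) / A := ⟨_, rfl⟩
  have n1 := ed_le (by linarith : 0 < A) (s - 1)
  have n2 := ed_lt (by linarith : 0 < A) (s - 1)
  rw [← hn] at n1 n2
  have n0 : 1 ≤ n := by
    by_contra! h
    nlinarith
  obtain ⟨x, hx⟩ : ∃ x : ℤ → ℤ, x = fun k => (B * k) % r := ⟨_, rfl⟩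
  have xb : ∀ k, 0 ≤ x k := by
    intro k; rw [hx]; exact Int.emod_nonneg _ (by omega)
  have xm : ∀ k, ∃ m, B * k = x k + r * m := by
    intro k; rw [hx]; exact ⟨_, (Int.emod_add_mul_ediv _ _).symm⟩
  have xs : ∀ k, n + 1 ≤ k → k ≤ 2 * n + 1 → x k < s := by
    intro k h1 h2
    have := H k (by omega) (by nlinarith)
    rw [Int.emod_eq_of_lt (by nlinarith) (by nlinarith)] at this
    rw [hx]
    rcases this with h | h
    · nlinarith
    · exact h
  obtain ⟨β, hβ⟩ : ∃ β, β = x (n + 2) - x (n + 1) := ⟨_, rfl⟩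
  obtain ⟨d, hd⟩ : ∃ d, B = β + r * d := by
    obtain ⟨m1, e1⟩ := xm (n + 1)
    obtain ⟨m2, e2⟩ := xm (n + 2)
    exact ⟨m2 - m1, by linear_combination e2 - e1 - hβ⟩
  have b1 := xb (n + 1)
  have b2 := xb (n + 2)
  have b3 := xs (n + 1) (by omega) (by omega)
  have b4 := xs (n + 2) (by omega) (by omega)
  have lin : ∀ i : ℕ, (i : ℤ) ≤ n → x (n + 1 + i) = x (n + 1) + β * i := by
    intro i
    induction i with
    | zero => intro _; simp
    | succ i ih =>
      intro hi
      push_cast at hi ⊢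
      have e := ih (by omega)
      obtain ⟨m1, e1⟩ := xm (n + 1 + i)
      obtain ⟨m2, e2⟩ := xm (n + 1 + (i + 1))
      have c1 := xb (n + 1 + i)
      have c2 := xb (n + 1 + (i + 1))
      have c3 := xs (n + 1 + i) (by omega) (by omega)
      have c4 := xs (n + 1 + (i + 1)) (by omega) (by omega)
      have f : x (n + 1 + (i + 1)) - x (n + 1 + i) - β = r * (d + m1 - m2) := by
        linear_combination e1 - e2 + hd
      have := mul_small (r := r) (by omega) (by rw [← f]; omega) (by rw [← f]; omega)
      rw [this] at f
      linear_combination f + e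
  obtain ⟨N, hN⟩ := Int.eq_ofNat_of_zero_le (by omega : 0 ≤ n)
  have l := lin N (by omega)
  have hN' : (N : ℤ) = n := by omega
  rw [hN'] at l
  have b5 := xb (n + 1 + n)
  have b6 := xs (n + 1 + n) (by omega) (by omega)
  obtain ⟨m1, e1⟩ := xm (n + 1)
  have f : β * (n + 1) - x (n + 1) = r * (m1 - d * (n + 1)) := by
    linear_combination e1 - (n + 1) * hd
  have := mul_small (r := r) (by omega) (by rw [← f]; nlinarith) (by rw [← f]; nlinarith)
  rw [this] at f
  have hβ0 : 0 ≤ β := by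
    by_contra! h
    nlinarith
  have hd0 : d = 0 := mul_small (r := r) (by omega) (by nlinarith) (by nlinarith)
  rw [hd0] at hd
  nlinarith

def HE (q s a1 a2 a3 : ℤ) : Prop := ∀ k, 1 ≤ k → k ≤ s - 1 → ∀ j, 0 ≤ j → j < q →
  (tt q s a1 k + a1 * j) % q + (tt q s a2 k + a2 * j) % q + (tt q s a3 k + a3 * j) % q
    = j + tt q s a1 k + tt q s a2 k + tt q s a3 k

lemma em_lin {q a b : ℤ} (h : a ≡ b [ZMOD q]) (t j : ℤ) : (t + a * j) % q = (t + b * j) % q :=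
  (h.mul_right j).add_left t

lemma tt_lt_s {q s a k : ℤ} (hs : 1 ≤ s) (h : tt q s a k = 0) : (a * k) % (q * s) < s := by
  unfold tt at h
  have := ed_lt (by omega : 0 < s) ((a * k) % (q * s))
  rw [h] at this
  linarith

lemma c1 {q s a1 a2 a3 : ℤ} (hq : 3 ≤ q) (hs : 2 ≤ s) (h1 : a1 ≡ 1 [ZMOD q])
    (h2 : a2 ≡ 1 [ZMOD q]) (h3 : a3 ≡ -1 [ZMOD q]) (E : HE q s a1 a2 a3) :
    a1 ≡ 1 [ZMOD q * s] ∨ a2 ≡ 1 [ZMOD q * s] := by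
  have hr0 : 3 * s ≤ q * s := by nlinarith
  have H : ∀ k, 1 ≤ k → k ≤ s - 1 →
      (a1 % (q * s) * k) % (q * s) < s ∨ (a2 % (q * s) * k) % (q * s) < s := by
    intro k hk1 hk2
    rw [em_mul, em_mul]
    have e := E k hk1 hk2 (q - 1) (by omega) (by omega)
    have z1 := tt_nonneg (by omega : 2 ≤ q) (by omega : 1 ≤ s) a1 k
    have z2 := tt_nonneg (by omega : 2 ≤ q) (by omega : 1 ≤ s) a2 k
    have z3 := tt_nonneg (by omega : 2 ≤ q) (by omega : 1 ≤ s) a3 k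
    have y1 := tt_lt (by omega : 2 ≤ q) (by omega : 1 ≤ s) a1 k
    have y2 := tt_lt (by omega : 2 ≤ q) (by omega : 1 ≤ s) a2 k
    have y3 := tt_lt (by omega : 2 ≤ q) (by omega : 1 ≤ s) a3 k
    by_contra! hc
    have w1 : tt q s a1 k ≠ 0 := fun h => by have := tt_lt_s (by omega) h; omega
    have w2 : tt q s a2 k ≠ 0 := fun h => by have := tt_lt_s (by omega) h; omega
    rw [em_lin h1, em_lin h2, em_lin h3,
      em_eq (x := tt q s a1 k - 1) 1 (by omega) (by omega) (by ring),
      em_eq (x := tt q s a2 k - 1) 1 (by omega) (by omega) (by ring)] at e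
    by_cases hh : tt q s a3 k + 1 < q
    · rw [em_eq (x := tt q s a3 k + 1) (-1) (by omega) (by omega) (by ring)] at e
      omega
    · rw [em_eq (x := tt q s a3 k + 1 - q) 0 (by omega) (by omega) (by ring)] at e
      omega
  have H' : ∀ k, 1 ≤ k → k ≤ s - 1 →
      (a2 % (q * s) * k) % (q * s) < s ∨ (a1 % (q * s) * k) % (q * s) < s :=
    fun k u v => (H k u v).symm
  have big : ∀ a, a ≡ 1 [ZMOD q] → ¬ a ≡ 1 [ZMOD q * s] → 4 ≤ a % (q * s) := by
    intro a ha hn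
    have g0 := Int.emod_nonneg a (by omega : q * s ≠ 0)
    have g1 : a % (q * s) % q = 1 := by
      rw [Int.emod_emod_of_dvd a (Dvd.intro s rfl), ha, Int.emod_eq_of_lt (by omega) (by omega)]
    have g2 : a % (q * s) ≠ 1 := by
      intro h
      apply hn
      rw [Int.ModEq, h, Int.emod_eq_of_lt (by omega) (by omega)]
    have g3 := Int.emod_add_mul_ediv (a % (q * s)) q
    have g4 : 1 ≤ a % (q * s) / q := by
      by_contra! h
      rcases lt_or_eq_of_le (by omega : a % (q * s) / q ≤ 0) with h | h
      · nlinarith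
      · rw [h] at g3; omega
    nlinarith
  by_contra! hc
  have A1 := big a1 h1 hc.1
  have A2 := big a2 h2 hc.2
  have l1 := Int.emod_lt_of_pos a1 (by omega : 0 < q * s)
  have l2 := Int.emod_lt_of_pos a2 (by omega : 0 < q * s)
  have H1 := H 1 le_rfl (by omega)
  simp only [mul_one, Int.emod_emod] at H1
  rcases le_total (a1 % (q * s)) (a2 % (q * s)) with h | h
  · exact c1_core hq A1 (by omega) h l2 H
  · exact c1_core hq A2 (by omega) h l1 H'

lemma cg {q s a1 a2 a3 : ℤ} (hq : 3 ≤ q) (hs : 2 ≤ s) (hg2 : Int.gcd a2 q = 1)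
    (h1 : a1 ≡ 1 [ZMOD q])
    (h23 : a2 + a3 ≡ 0 [ZMOD q]) (h2 : ¬ a2 ≡ 1 [ZMOD q]) (h3 : ¬ a3 ≡ 1 [ZMOD q])
    (E : HE q s a1 a2 a3) : a1 ≡ 1 [ZMOD q * s] := by
  have hr0 : 3 * s ≤ q * s := by nlinarith
  obtain ⟨a, ha⟩ : ∃ a, a = a2 % q := ⟨_, rfl⟩
  have e2 : a2 ≡ a [ZMOD q] := by rw [ha]; exact (Int.mod_modEq _ _).symm
  have e3 : a3 ≡ -a [ZMOD q] := by
    have := h23.sub e2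
    simpa using this
  have a0 := Int.emod_nonneg a2 (by omega : q ≠ 0)
  have aq := Int.emod_lt_of_pos a2 (by omega : 0 < q)
  rw [← ha] at a0 aq
  have hga : Int.gcd a q = 1 := by rw [ha, Int.gcd_emod]; exact hg2
  have an0 : a ≠ 0 := by
    intro h; rw [h] at hga; simp at hga; omega
  have an1 : a ≠ 1 := by intro h; rw [h] at e2; exact h2 e2
  have anq : a ≠ q - 1 := by
    intro h; rw [h] at e3
    apply h3
    refine e3.trans ?_
    rw [Int.modEq_iff_dvd]
    exact ⟨1, by ring⟩
  have hq5 : 5 ≤ q := by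
    by_contra! h
    have : q = 4 := by omega
    have : a = 2 := by omega
    subst this; subst q
    revert hga; decide
  have hr5 : 5 * s ≤ q * s := by nlinarith
  have C : ∀ k, 1 ≤ k → k ≤ s - 1 → ∃ m, -s ≤ a1 * k + q * s * m ∧ a1 * k + q * s * m < 2 * s := by
    intro k hk1 hk2
    have := cls (q := q) (a := a) (by omega) (by omega) hga
      (tt_nonneg (by omega : 2 ≤ q) (by omega : 1 ≤ s) a1 k)
      (tt_lt (by omega : 2 ≤ q) (by omega : 1 ≤ s) a1 k)
      (tt_nonneg (by omega : 2 ≤ q) (by omega : 1 ≤ s) a2 k)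
      (tt_lt (by omega : 2 ≤ q) (by omega : 1 ≤ s) a2 k)
      (tt_nonneg (by omega : 2 ≤ q) (by omega : 1 ≤ s) a3 k)
      (tt_lt (by omega : 2 ≤ q) (by omega : 1 ≤ s) a3 k)
      (by
        intro j hj0 hjq
        have e := E k hk1 hk2 j hj0 hjq
        rw [em_lin h1, em_lin e2, em_lin e3] at e
        rw [one_mul, neg_mul, ← sub_eq_add_neg] at e
        exact e)
    unfold tt at this
    have g1 := ed_le (by omega : 0 < s) ((a1 * k) % (q * s))
    have g2 := ed_lt (by omega : 0 < s) ((a1 * k) % (q * s))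
    have g3 := Int.emod_add_mul_ediv (a1 * k) (q * s)
    rcases this with h | h | h
    · rw [h] at g1 g2
      exact ⟨-(a1 * k / (q * s)), by linarith, by linarith⟩
    · rw [h] at g1 g2
      exact ⟨-(a1 * k / (q * s)), by linarith, by linarith⟩
    · rw [h] at g1 g2
      exact ⟨-(a1 * k / (q * s)) - 1, by linarith, by linarith⟩
  obtain ⟨m, hm1, hm2⟩ := C 1 le_rfl (by omega)
  obtain ⟨α, hα⟩ : ∃ α, α = a1 * 1 + q * s * m := ⟨_, rfl⟩
  rw [← hα] at hm1 hm2
  have lin : ∀ i : ℕ, (i : ℤ) + 1 ≤ s - 1 → -s ≤ α * (i + 1) ∧ α * (i + 1) < 2 * s := by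
    intro i
    induction i with
    | zero => intro _; simp; exact ⟨hm1, hm2⟩
    | succ i ih =>
      intro hi
      push_cast at hi ⊢
      obtain ⟨i1, i2⟩ := ih (by omega)
      obtain ⟨m', h1', h2'⟩ := C (i + 1 + 1) (by omega) hi
      have f : a1 * (i + 1 + 1) + q * s * m' - α * (i + 1 + 1) = q * s * (m' - m * (i + 1 + 1)) := by
        linear_combination (-((i : ℤ) + 1 + 1)) * hα
      have := mul_small (r := q * s) (by omega) (by rw [← f]; linarith) (by rw [← f]; linarith)
      rw [this] at f
      constructor <;> linarith
  obtain ⟨N, hN⟩ := Int.eq_ofNat_of_zero_le (by omega : 0 ≤ s - 2)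
  have l := lin N (by omega)
  have hN' : (N : ℤ) = s - 2 := by omega
  rw [hN'] at l
  obtain ⟨l1, l2⟩ := l
  obtain ⟨c, hc⟩ := Int.modEq_iff_dvd.1 h1.symm
  have hα2 : α = 1 + q * (c + s * m) := by linear_combination hα + hc
  have hz : c + s * m = 0 := by
    by_contra hne
    rcases lt_or_gt_of_ne hne with h | h
    · have : α ≤ -4 := by nlinarith
      nlinarith
    · have : 6 ≤ α := by nlinarith
      nlinarith
  rw [hz] at hα2
  rw [Int.modEq_iff_dvd]
  exact ⟨m, by linear_combination hα - hα2⟩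

lemma tt2 {s : ℤ} (hs : 2 ≤ s) (a k : ℤ) : tt 2 s a k = (a % (2 * s) * k / s) % 2 := by
  have z1 := tt_nonneg le_rfl (by omega : 1 ≤ s) a k
  have z2 := tt_lt le_rfl (by omega : 1 ≤ s) a k
  unfold tt at *
  rw [← em_mul] at z1 z2 ⊢
  generalize a % (2 * s) * k = x at z1 z2 ⊢
  have g := Int.emod_add_mul_ediv x (2 * s)
  have : x / s = x % (2 * s) / s + 2 * (x / (2 * s)) := by
    conv_lhs => rw [← g]
    rw [show x % (2 * s) + 2 * s * (x / (2 * s)) = x % (2 * s) + s * (2 * (x / (2 * s))) by ring]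
    rw [Int.add_mul_ediv_left _ _ (by omega)]
  omega

lemma c2a {s a1 a2 a3 : ℤ} (hs : 2 ≤ s) (g1 : Int.gcd a1 s = 1)
    (hA1 : s ≤ a1 % (2 * s)) (h23 : a2 % (2 * s) ≤ a3 % (2 * s)) (hA3 : a3 % (2 * s) < s)
    (h2 : a2 ≡ 1 [ZMOD 2])
    (H : ∀ k, 1 ≤ k → k ≤ s - 1 → tt 2 s a1 k + tt 2 s a2 k + tt 2 s a3 k = 1) :
    a2 ≡ 1 [ZMOD 2 * s] := by
  have l1 := Int.emod_lt_of_pos a1 (by omega : 0 < 2 * s)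
  have l2 := Int.emod_nonneg a2 (by omega : 2 * s ≠ 0)
  have g1' : Int.gcd (a1 % (2 * s)) s = 1 := by
    rw [← Int.gcd_emod, Int.emod_emod_of_dvd a1 (Dvd.intro_left 2 rfl), Int.gcd_emod]
    exact g1
  have hne := ndvd g1' le_rfl (by omega)
  have hne' : a1 % (2 * s) ≠ s := by
    intro h; rw [h] at hne; simp at hne
  have lt2 : a2 % (2 * s) < 2 := by
    by_contra! hc
    apply two_core (s := s) (b := 2 * s - a1 % (2 * s)) (x := a2 % (2 * s)) (y := a3 % (2 * s))
      (by omega) (by omega) hc h23 hA3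
    intro k h1 h2
    have e := H k h1 h2
    rw [tt2 hs, tt2 hs, tt2 hs] at e
    have n := ndvd g1' h1 h2
    generalize a1 % (2 * s) = A at n e ⊢
    have g0 := Int.emod_nonneg (A * k) (by omega : s ≠ 0)
    have g2 := Int.emod_lt_of_pos (A * k) (by omega : 0 < s)
    have g3 := Int.emod_add_mul_ediv (A * k) s
    have hpos : 0 < A * k % s := by omega
    have : (2 * s - A) * k / s = 2 * k - 1 - A * k / s := ed_eq (by nlinarith) (by nlinarith)
    omega
  have odd : a2 % (2 * s) % 2 = 1 := by
    rw [Int.emod_emod_of_dvd a2 (Dvd.intro s rfl)]; exact h2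
  rw [Int.ModEq, Int.emod_eq_of_lt (by omega : (0 : ℤ) ≤ 1) (by omega)]
  omega

lemma c2b {s a1 a2 a3 : ℤ} (hs : 2 ≤ s) (g1 : Int.gcd a1 s = 1)
    (hA1 : s ≤ a1 % (2 * s)) (hA2 : a2 % (2 * s) < s) (hA3 : a3 % (2 * s) < s)
    (h2 : a2 ≡ 1 [ZMOD 2]) (h3 : a3 ≡ 1 [ZMOD 2])
    (H : ∀ k, 1 ≤ k → k ≤ s - 1 → tt 2 s a1 k + tt 2 s a2 k + tt 2 s a3 k = 1) :
    a2 ≡ 1 [ZMOD 2 * s] ∨ a3 ≡ 1 [ZMOD 2 * s] := by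
  rcases le_total (a2 % (2 * s)) (a3 % (2 * s)) with h | h
  · exact Or.inl (c2a hs g1 hA1 h hA3 h2 H)
  · exact Or.inr (c2a hs g1 hA1 h hA2 h3 (fun k u v => by linarith [H k u v]))

lemma c2 {s a1 a2 a3 : ℤ} (hs : 2 ≤ s) (g1 : Int.gcd a1 s = 1) (g2 : Int.gcd a2 s = 1)
    (g3 : Int.gcd a3 s = 1)
    (h1 : a1 ≡ 1 [ZMOD 2]) (h2 : a2 ≡ 1 [ZMOD 2]) (h3 : a3 ≡ 1 [ZMOD 2])
    (E : HE 2 s a1 a2 a3) :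
    a1 ≡ 1 [ZMOD 2 * s] ∨ a2 ≡ 1 [ZMOD 2 * s] ∨ a3 ≡ 1 [ZMOD 2 * s] := by
  have H : ∀ k, 1 ≤ k → k ≤ s - 1 → tt 2 s a1 k + tt 2 s a2 k + tt 2 s a3 k = 1 := by
    intro k u v
    have e := E k u v 1 (by norm_num) (by norm_num)
    rw [em_lin h1, em_lin h2, em_lin h3] at e
    have z1 := tt_nonneg le_rfl (by omega : 1 ≤ s) a1 k
    have z2 := tt_nonneg le_rfl (by omega : 1 ≤ s) a2 k
    have z3 := tt_nonneg le_rfl (by omega : 1 ≤ s) a3 k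
    have y1 := tt_lt le_rfl (by omega : 1 ≤ s) a1 k
    have y2 := tt_lt le_rfl (by omega : 1 ≤ s) a2 k
    have y3 := tt_lt le_rfl (by omega : 1 ≤ s) a3 k
    omega
  have H1 := H 1 le_rfl (by omega)
  have dich : ∀ a, (tt 2 s a 1 = 0 ∧ a % (2 * s) < s) ∨ (tt 2 s a 1 = 1 ∧ s ≤ a % (2 * s)) := by
    intro a
    have z1 := tt_nonneg le_rfl (by omega : 1 ≤ s) a 1
    have z2 := tt_lt le_rfl (by omega : 1 ≤ s) a 1
    unfold tt at *
    rw [mul_one] at *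
    have u1 := ed_le (by omega : 0 < s) (a % (2 * s))
    have u2 := ed_lt (by omega : 0 < s) (a % (2 * s))
    rcases (by omega : a % (2 * s) / s = 0 ∨ a % (2 * s) / s = 1) with h | h <;> rw [h] at u1 u2
    · left; exact ⟨h, by linarith⟩
    · right; exact ⟨h, by linarith⟩
  rcases dich a1 with ⟨t1, d1⟩ | ⟨t1, d1⟩
  · rcases dich a2 with ⟨t2, d2⟩ | ⟨t2, d2⟩
    · rcases dich a3 with ⟨t3, d3⟩ | ⟨t3, d3⟩
      · omega
      · rcases c2b hs g3 d3 d1 d2 h1 h2 (fun k u v => by linarith [H k u v]) with h | h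
        · exact Or.inl h
        · exact Or.inr (Or.inl h)
    · rcases dich a3 with ⟨t3, d3⟩ | ⟨t3, d3⟩
      · rcases c2b hs g2 d2 d1 d3 h1 h3 (fun k u v => by linarith [H k u v]) with h | h
        · exact Or.inl h
        · exact Or.inr (Or.inr h)
      · omega
  · rcases dich a2 with ⟨t2, d2⟩ | ⟨t2, d2⟩
    · rcases dich a3 with ⟨t3, d3⟩ | ⟨t3, d3⟩
      · exact Or.inr (c2b hs g1 d1 d2 d3 h2 h3 H)
      · omega
    · rcases dich a3 with ⟨t3, d3⟩ | ⟨t3, d3⟩ <;> omega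

lemma HE_swap23 {q s a1 a2 a3 : ℤ} (E : HE q s a1 a2 a3) : HE q s a1 a3 a2 :=
  fun k u v j x y => by linarith [E k u v j x y]

lemma HE_swap12 {q s a1 a2 a3 : ℤ} (E : HE q s a1 a2 a3) : HE q s a2 a1 a3 :=
  fun k u v j x y => by linarith [E k u v j x y]

lemma keyC {q s a1 a2 a3 : ℤ} (hq : 2 ≤ q) (hs : 2 ≤ s)
    (g1 : Int.gcd a1 s = 1) (g2 : Int.gcd a2 s = 1) (g3 : Int.gcd a3 s = 1)
    (k2 : Int.gcd a2 q = 1)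
    (h1 : a1 ≡ 1 [ZMOD q]) (h23 : a2 + a3 ≡ 0 [ZMOD q]) (E : HE q s a1 a2 a3) :
    a1 ≡ 1 [ZMOD q * s] ∨ a2 ≡ 1 [ZMOD q * s] ∨ a3 ≡ 1 [ZMOD q * s] := by
  rcases hq.eq_or_lt with rfl | hq3
  · have o2 : a2 ≡ 1 [ZMOD 2] := by
      rcases Int.emod_two_eq_zero_or_one a2 with h | h
      · have := Int.dvd_gcd (Int.dvd_of_emod_eq_zero h) (dvd_refl 2)
        rw [k2] at this
        norm_num at this
      · exact h
    have o3 : a3 ≡ 1 [ZMOD 2] := by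
      unfold Int.ModEq at *; omega
    exact c2 hs g1 g2 g3 h1 o2 o3 E
  · by_cases c : a2 ≡ 1 [ZMOD q]
    · have c3 : a3 ≡ -1 [ZMOD q] := by simpa using h23.sub c
      rcases c1 hq3 hs h1 c c3 E with h | h
      · exact Or.inl h
      · exact Or.inr (Or.inl h)
    · by_cases c' : a3 ≡ 1 [ZMOD q]
      · have c3 : a2 ≡ -1 [ZMOD q] := by simpa using h23.sub c'
        rcases c1 hq3 hs h1 c' c3 (HE_swap23 E) with h | h
        · exact Or.inl h
        · exact Or.inr (Or.inr h)
      · exact Or.inl (cg hq3 hs k2 h1 h23 c c' E)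

lemma fin_core {s c : ℤ} (hc0 : 1 ≤ c) (hcs : c < s) (hg : Int.gcd c s = 1)
    (H : ∀ x, 1 ≤ x → x ≤ s - 1 → 2 * (x - (c * x) % s) ≤ s - 2 ∧ 2 * ((c * x) % s - x) ≤ s - 2) :
    c = 1 := by
  by_contra hne
  have hc2 : 2 ≤ c := by omega
  obtain ⟨n, hn⟩ : ∃ n, n = (s - 1) / c := ⟨_, rfl⟩
  have n1 := ed_le (by linarith : 0 < c) (s - 1)
  have n2 := ed_lt (by linarith : 0 < c) (s - 1)
  rw [← hn] at n1 n2
  have n0 : 1 ≤ n := by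
    by_contra! h
    nlinarith
  have x1 := (H 1 le_rfl (by omega)).2
  rw [mul_one, Int.emod_eq_of_lt (by omega) hcs] at x1
  have hn2 : 2 ≤ n := by
    by_contra! h
    have : n = 1 := by omega
    subst this
    have : s = 2 * c := by omega
    have h' := ndvd hg (by norm_num : (1 : ℤ) ≤ 2) (by omega)
    rw [this] at h'
    apply h'
    rw [mul_comm]
    exact Int.emod_self
  have xn := (H n n0 (by nlinarith)).2
  rw [Int.emod_eq_of_lt (by nlinarith) (by nlinarith)] at xn
  have xn1 := (H (n + 1) (by omega) (by nlinarith)).1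
  rw [em_eq (x := c * (n + 1) - s) 1 (by linarith) (by linarith) (by ring)] at xn1
  have hc3 : 3 ≤ c := by nlinarith
  by_cases hh : n = 2
  · subst hh
    omega
  · by_cases h33 : c = 3
    · subst h33
      omega
    · have : 2 ≤ (c - 2) * (n - 2) := by nlinarith
      nlinarith

lemma fin_eq {s u v : ℤ} (hs : 2 ≤ s) (hu : Int.gcd u s = 1) (hv : Int.gcd v s = 1)
    (H : ∀ k, 1 ≤ k → k ≤ s - 1 → 2 * ((u * k) % s - (v * k) % s) ≤ s - 2 ∧
      2 * ((v * k) % s - (u * k) % s) ≤ s - 2) : v ≡ u [ZMOD s] := by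
  have hb := Int.gcd_eq_gcd_ab u s
  rw [hu] at hb
  push_cast at hb
  obtain ⟨w, hw⟩ : ∃ w, w = Int.gcdA u s := ⟨_, rfl⟩
  rw [← hw] at hb
  have huw : u * w ≡ 1 [ZMOD s] := by
    rw [Int.modEq_iff_dvd]; exact ⟨Int.gcdB u s, by linarith⟩
  have hgw : Int.gcd w s = 1 := by
    rw [← Int.isCoprime_iff_gcd_eq_one]
    exact ⟨u, Int.gcdB u s, by linarith⟩
  have hgc : Int.gcd ((v * w) % s) s = 1 := by
    rw [Int.gcd_emod]
    rw [← Int.isCoprime_iff_gcd_eq_one] at *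
    exact hv.mul_left hgw
  have l0 := Int.emod_nonneg (v * w) (by omega : s ≠ 0)
  have l1 := Int.emod_lt_of_pos (v * w) (by omega : 0 < s)
  have hc : (v * w) % s = 1 := by
    apply fin_core _ l1 hgc
    · intro x h1 h2
      have k0 := Int.emod_nonneg (w * x) (by omega : s ≠ 0)
      have k1 := Int.emod_lt_of_pos (w * x) (by omega : 0 < s)
      have k2 := ndvd hgw h1 h2
      have h := H ((w * x) % s) (by omega) (by omega)
      have e1 : (u * ((w * x) % s)) % s = x := by
        rw [mul_comm, em_mul]
        have : w * x * u ≡ x [ZMOD s] := by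
          have := huw.mul_right x
          rw [one_mul] at this
          rwa [show w * x * u = u * w * x by ring]
        rw [this, Int.emod_eq_of_lt (by omega) (by omega)]
      have e2 : (v * ((w * x) % s)) % s = ((v * w) % s * x) % s := by
        rw [mul_comm, em_mul, em_mul]
        congr 1; ring
      rw [e1, e2] at h
      exact h
    · have : (v * w) % s ≠ 0 := by
        intro h
        rw [h] at hgc
        simp at hgc
        omega
      omega
  have hc' : v * w ≡ 1 [ZMOD s] := by
    rw [Int.ModEq, hc, Int.emod_eq_of_lt (by omega) (by omega)]
  have p1 := hc'.mul_right u
  have p2 := huw.mul_left v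
  rw [one_mul] at p1
  rw [mul_one] at p2
  rw [show v * w * u = v * (u * w) by ring] at p1
  exact p2.symm.trans p1

lemma surj_mod {q a : ℤ} (hq : 0 < q) (hg : Int.gcd a q = 1) (t y : ℤ) (h0 : 0 ≤ y) (h1 : y < q) :
    ∃ j, 0 ≤ j ∧ j < q ∧ (t + a * j) % q = y := by
  have hb := Int.gcd_eq_gcd_ab a q
  rw [hg] at hb
  push_cast at hb
  refine ⟨((y - t) * Int.gcdA a q) % q, Int.emod_nonneg _ (by omega),
    Int.emod_lt_of_pos _ (by omega), ?_⟩
  have m := Int.emod_add_mul_ediv ((y - t) * Int.gcdA a q) q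
  refine em_eq (-(a * (((y - t) * Int.gcdA a q) / q)) - (y - t) * Int.gcdB a q) h0 h1 ?_
  have : ((y - t) * Int.gcdA a q) % q
      = (y - t) * Int.gcdA a q - q * (((y - t) * Int.gcdA a q) / q) := by linarith
  rw [this]
  linear_combination (y - t) * (-hb)

lemma final {q s a1 a2 a3 u v : ℤ} (hq : 2 ≤ q) (hs : 2 ≤ s)
    (k2 : Int.gcd a2 q = 1) (g2 : Int.gcd a2 s = 1) (g3 : Int.gcd a3 s = 1)
    (hu : Int.gcd u s = 1) (hv : Int.gcd v s = 1) (h1 : a1 ≡ 1 [ZMOD q * s])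
    (E : HE q s a1 a2 a3)
    (H : ∀ k, 1 ≤ k → k ≤ q * s - 1 →
      (a1 * k) % (q * s) + (a2 * k) % (q * s) + (a3 * k) % (q * s) + (q * v * k) % (q * s)
        = (q * u * k) % (q * s) + k + q * s) :
    q * v ≡ q * u [ZMOD q * s] ∧ a2 + a3 ≡ 0 [ZMOD q * s] := by
  have hr : 2 * s ≤ q * s := by nlinarith
  have key : ∀ k, 1 ≤ k → k ≤ s - 1 →
      (a2 * k) % (q * s) % s + (a3 * k) % (q * s) % s - s = q * ((u * k) % s - (v * k) % s) ∧
      (a2 * k) % (q * s) + (a3 * k) % (q * s)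
        = (a2 * k) % (q * s) % s + (a3 * k) % (q * s) % s + s * (q - 1) := by
    intro k hk1 hk2
    have z2 := tt_nonneg hq (by omega : 1 ≤ s) a2 k
    have z3 := tt_nonneg hq (by omega : 1 ≤ s) a3 k
    have y2 := tt_lt hq (by omega : 1 ≤ s) a2 k
    have y3 := tt_lt hq (by omega : 1 ≤ s) a3 k
    have b1 : (a1 * k) % (q * s) = k := by
      have := h1.mul_right k
      rw [this, one_mul, Int.emod_eq_of_lt (by omega) (by omega)]
    have t1 : tt q s a1 k = 0 := by
      unfold tt; rw [b1]; exact Int.ediv_eq_zero_of_lt (by omega) (by omega)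
    have h1q : a1 ≡ 1 [ZMOD q] := h1.of_mul_right s
    have E' : ∀ j, 0 ≤ j → j < q → (tt q s a2 k + a2 * j) % q + (tt q s a3 k + a3 * j) % q
        = tt q s a2 k + tt q s a3 k := by
      intro j j0 j1
      have e := E k hk1 hk2 j j0 j1
      rw [em_lin h1q, t1, em_eq (x := j) 0 j0 j1 (by ring)] at e
      linarith
    have T : tt q s a2 k + tt q s a3 k = q - 1 := by
      obtain ⟨j, j0, j1, e⟩ := surj_mod (by omega : 0 < q) k2 (tt q s a2 k) 0 le_rfl (by omega)
      obtain ⟨i, i0, i1, f⟩ := surj_mod (by omega : 0 < q) k2 (tt q s a2 k) (q - 1) (by omega)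
        (by omega)
      have e' := E' j j0 j1
      have f' := E' i i0 i1
      have p := Int.emod_lt_of_pos (tt q s a3 k + a3 * j) (by omega : 0 < q)
      have p' := Int.emod_nonneg (tt q s a3 k + a3 * i) (by omega : q ≠ 0)
      omega
    have m2 := Int.emod_add_mul_ediv ((a2 * k) % (q * s)) s
    have m3 := Int.emod_add_mul_ediv ((a3 * k) % (q * s)) s
    unfold tt at T
    have c2 : (a2 * k) % (q * s) + (a3 * k) % (q * s)
        = (a2 * k) % (q * s) % s + (a3 * k) % (q * s) % s + s * (q - 1) := by
      rw [← T]; linarith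
    refine ⟨?_, c2⟩
    have h := H k hk1 (by omega)
    rw [b1, show q * v * k = q * (v * k) by ring, show q * u * k = q * (u * k) by ring,
      Int.mul_emod_mul_of_pos _ _ (by omega), Int.mul_emod_mul_of_pos _ _ (by omega)] at h
    linarith
  have hvu : v ≡ u [ZMOD s] := by
    apply fin_eq hs hu hv
    intro k hk1 hk2
    obtain ⟨e, -⟩ := key k hk1 hk2
    rw [Int.emod_emod_of_dvd _ (Dvd.intro_left q rfl),
      Int.emod_emod_of_dvd _ (Dvd.intro_left q rfl)] at e
    have n2 := ndvd g2 hk1 hk2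
    have n3 := ndvd g3 hk1 hk2
    have p2 := Int.emod_nonneg (a2 * k) (by omega : s ≠ 0)
    have p3 := Int.emod_nonneg (a3 * k) (by omega : s ≠ 0)
    have r2 := Int.emod_lt_of_pos (a2 * k) (by omega : 0 < s)
    have r3 := Int.emod_lt_of_pos (a3 * k) (by omega : 0 < s)
    have s2 : 1 ≤ (a2 * k) % s := by omega
    have s3 : 1 ≤ (a3 * k) % s := by omega
    obtain ⟨w, hw⟩ : ∃ w, w = (u * k) % s - (v * k) % s := ⟨_, rfl⟩
    rw [← hw] at e
    rw [show (v * k) % s - (u * k) % s = -w by rw [hw]; ring, ← hw]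
    constructor
    · by_contra! hc
      have : 0 ≤ w := by omega
      nlinarith
    · by_contra! hc
      have : w ≤ 0 := by omega
      nlinarith
  constructor
  · exact hvu.mul_left'
  · obtain ⟨e, f⟩ := key 1 le_rfl (by omega)
    have := hvu.mul_right 1
    rw [this, sub_self, mul_zero] at e
    rw [mul_one, mul_one] at *
    rw [Int.ModEq, Int.add_emod, f]
    have : a2 % (q * s) % s + a3 % (q * s) % s + s * (q - 1) = q * s := by linarith
    rw [this]
    simp

lemma shift {q s : ℤ} (hq : 2 ≤ q) (hs : 1 ≤ s) (a k j : ℤ) :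
    (a * (k + s * j)) % (q * s) = (a * k) % (q * s) % s + s * ((tt q s a k + a * j) % q) := by
  have m1 := Int.emod_add_mul_ediv (a * k) (q * s)
  have m2 := Int.emod_add_mul_ediv ((a * k) % (q * s)) s
  have m3 := Int.emod_add_mul_ediv (tt q s a k + a * j) q
  have b1 := Int.emod_nonneg ((a * k) % (q * s)) (by omega : s ≠ 0)
  have b2 := Int.emod_lt_of_pos ((a * k) % (q * s)) (by omega : 0 < s)
  have b3 := Int.emod_nonneg (tt q s a k + a * j) (by omega : q ≠ 0)
  have b4 := Int.emod_lt_of_pos (tt q s a k + a * j) (by omega : 0 < q)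
  refine em_eq (a * k / (q * s) + (tt q s a k + a * j) / q) (by positivity) (by nlinarith) ?_
  have m2' : (a * k) % (q * s) % s + s * tt q s a k = (a * k) % (q * s) := m2
  linear_combination -m1 - m2' - s * m3

lemma shift0 {q s : ℤ} (hq : 2 ≤ q) (hs : 1 ≤ s) (v k j : ℤ) :
    (q * v * (k + s * j)) % (q * s) = (q * v * k) % (q * s) := by
  rw [show q * v * (k + s * j) = q * v * k + q * s * (v * j) by ring, Int.add_mul_emod_self_left]

lemma mk_HE {q s a1 a2 a3 u v : ℤ} (hq : 2 ≤ q) (hs : 1 ≤ s)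
    (H : ∀ k, 1 ≤ k → k ≤ q * s - 1 →
      (a1 * k) % (q * s) + (a2 * k) % (q * s) + (a3 * k) % (q * s) + (q * v * k) % (q * s)
        = (q * u * k) % (q * s) + k + q * s) : HE q s a1 a2 a3 := by
  intro k hk1 hk2 j j0 j1
  have e1 := H (k + s * j) (by nlinarith) (by nlinarith)
  have e0 := H k hk1 (by nlinarith)
  rw [shift hq hs, shift hq hs, shift hq hs, shift0 hq hs, shift0 hq hs] at e1
  have m1 := Int.emod_add_mul_ediv ((a1 * k) % (q * s)) s
  have m2 := Int.emod_add_mul_ediv ((a2 * k) % (q * s)) s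
  have m3 := Int.emod_add_mul_ediv ((a3 * k) % (q * s)) s
  change _ + s * tt q s a1 k = _ at m1
  change _ + s * tt q s a2 k = _ at m2
  change _ + s * tt q s a3 k = _ at m3
  apply mul_left_cancel₀ (by omega : s ≠ 0)
  linear_combination e1 - e0 - m1 - m2 - m3

lemma mk_white {q s a1 a2 a3 u v : ℤ} (hq : 2 ≤ q) (hs : 1 ≤ s)
    (H : ∀ k, 1 ≤ k → k ≤ q * s - 1 →
      (a1 * k) % (q * s) + (a2 * k) % (q * s) + (a3 * k) % (q * s) + (q * v * k) % (q * s)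
        = (q * u * k) % (q * s) + k + q * s) :
    ∀ j, 1 ≤ j → j ≤ q - 1 → (a1 * j) % q + (a2 * j) % q + (a3 * j) % q = j + q := by
  intro j h1 h2
  have e := H (s * j) (by nlinarith) (by nlinarith)
  have g : ∀ a, (a * (s * j)) % (q * s) = s * ((a * j) % q) := by
    intro a
    rw [show a * (s * j) = s * (a * j) by ring, mul_comm q s, Int.mul_emod_mul_of_pos _ _ (by omega)]
  have z : ∀ w, (q * w * (s * j)) % (q * s) = 0 := by
    intro w
    rw [show q * w * (s * j) = q * s * (w * j) by ring]
    simp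
  rw [g, g, g, z, z] at e
  apply mul_left_cancel₀ (by omega : s ≠ 0)
  linear_combination e

lemma main1 {q s a1 a2 a3 u v : ℤ} (hq : 2 ≤ q) (hs : 2 ≤ s)
    (g1 : Int.gcd a1 s = 1) (g2 : Int.gcd a2 s = 1) (g3 : Int.gcd a3 s = 1)
    (k1 : Int.gcd a1 q = 1) (k2 : Int.gcd a2 q = 1) (k3 : Int.gcd a3 q = 1)
    (hu : Int.gcd u s = 1) (hv : Int.gcd v s = 1)
    (H : ∀ k, 1 ≤ k → k ≤ q * s - 1 →
      (a1 * k) % (q * s) + (a2 * k) % (q * s) + (a3 * k) % (q * s) + (q * v * k) % (q * s)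
        = (q * u * k) % (q * s) + k + q * s) :
    q * v ≡ q * u [ZMOD q * s] ∧
      ((a1 ≡ 1 [ZMOD q * s] ∧ a2 + a3 ≡ 0 [ZMOD q * s]) ∨
       (a2 ≡ 1 [ZMOD q * s] ∧ a1 + a3 ≡ 0 [ZMOD q * s]) ∨
       (a3 ≡ 1 [ZMOD q * s] ∧ a1 + a2 ≡ 0 [ZMOD q * s])) := by
  have E := mk_HE hq (by omega) H
  have W := white hq k1 k2 k3 (mk_white hq (by omega) H)
  have D : a1 ≡ 1 [ZMOD q * s] ∨ a2 ≡ 1 [ZMOD q * s] ∨ a3 ≡ 1 [ZMOD q * s] := by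
    rcases W with ⟨w, w'⟩ | ⟨w, w'⟩ | ⟨w, w'⟩
    · exact keyC hq hs g1 g2 g3 k2 w w' E
    · have := keyC hq hs g2 g1 g3 k1 w w' (HE_swap12 E)
      tauto
    · have := keyC hq hs g3 g1 g2 k1 w w' (HE_swap12 (HE_swap23 E))
      tauto
  rcases D with d | d | d
  · obtain ⟨f1, f2⟩ := final hq hs k2 g2 g3 hu hv d E H
    exact ⟨f1, Or.inl ⟨d, f2⟩⟩
  · obtain ⟨f1, f2⟩ := final hq hs k1 g1 g3 hu hv d (HE_swap12 E)
      (fun k x y => by linarith [H k x y])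
    exact ⟨f1, Or.inr (Or.inl ⟨d, f2⟩)⟩
  · obtain ⟨f1, f2⟩ := final hq hs k1 g1 g2 hu hv d (HE_swap12 (HE_swap23 E))
      (fun k x y => by linarith [H k x y])
    exact ⟨f1, Or.inr (Or.inr ⟨d, f2⟩)⟩

/-- Terminal lemma of Morrison–Stevens, case `q > 1`. -/
theorem terminal_lemma_q_gt_one
    (r : ℤ) (hr : 0 < r) (a1 a2 a3 a4 e : ℤ)
    (hq : Int.gcd e r = Int.gcd a4 r) (hq1 : 1 < Int.gcd e r)
    (h1 : Int.gcd a1 r = 1) (h2 : Int.gcd a2 r = 1) (h3 : Int.gcd a3 r = 1)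
    (hsum : ∀ k : ℤ, 1 ≤ k → k ≤ r - 1 →
      res r (a1 * k) + res r (a2 * k) + res r (a3 * k) + res r (a4 * k)
        = res r (e * k) + k + r) :
    Int.ModEq r a4 e ∧
      ((Int.ModEq r a1 1 ∧ Int.ModEq r (a2 + a3) 0) ∨
       (Int.ModEq r a2 1 ∧ Int.ModEq r (a1 + a3) 0) ∨
       (Int.ModEq r a3 1 ∧ Int.ModEq r (a1 + a2) 0)) := by
  unfold res at hsum
  obtain ⟨q, hqd⟩ : ∃ q : ℤ, q = (Int.gcd e r : ℤ) := ⟨_, rfl⟩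
  have hq2 : 2 ≤ q := by omega
  obtain ⟨u, hu⟩ : q ∣ e := hqd ▸ Int.gcd_dvd_left _ _
  obtain ⟨s, hs⟩ : q ∣ r := hqd ▸ Int.gcd_dvd_right _ _
  obtain ⟨v, hv⟩ : q ∣ a4 := by rw [hqd, hq]; exact Int.gcd_dvd_left _ _
  have hs1 : 1 ≤ s := by
    by_contra! h
    nlinarith
  have cop : ∀ x, (Int.gcd (q * x) r : ℤ) = q → Int.gcd x s = 1 := by
    intro x hx
    rw [hs, Int.gcd_mul_left] at hx
    push_cast at hx
    rw [abs_of_nonneg (by omega)] at hx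
    have : q * (Int.gcd x s : ℤ) = q * 1 := by linarith
    have := mul_left_cancel₀ (by omega : q ≠ 0) this
    exact_mod_cast this
  have hu1 : Int.gcd u s = 1 := cop u (by rw [← hu, ← hqd])
  have hv1 : Int.gcd v s = 1 := cop v (by rw [← hv, ← hq, ← hqd])
  have copq : ∀ a, Int.gcd a r = 1 → Int.gcd a q = 1 ∧ Int.gcd a s = 1 := by
    intro a ha
    rw [← Int.isCoprime_iff_gcd_eq_one] at ha
    rw [← Int.isCoprime_iff_gcd_eq_one, ← Int.isCoprime_iff_gcd_eq_one]
    rw [hs] at ha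
    exact ⟨ha.of_mul_right_left, ha.of_mul_right_right⟩
  obtain ⟨k1, g1⟩ := copq a1 h1
  obtain ⟨k2, g2⟩ := copq a2 h2
  obtain ⟨k3, g3⟩ := copq a3 h3
  subst hs hu hv
  rcases hs1.eq_or_lt with rfl | hs2
  · have W := white hq2 k1 k2 k3 (mk_white hq2 le_rfl hsum)
    rw [mul_one]
    refine ⟨?_, W⟩
    rw [Int.modEq_iff_dvd]
    exact ⟨u - v, by ring⟩
  · exact main1 hq2 hs2 g1 g2 g3 k1 k2 k3 hu1 hv1 hsum
end

section
/- Let $r$ be a positive integer and let $a_1,a_2,a_3,a_4,e$ be integers such that $\gcd(e,r)=\gcd(a_4,r)=1$ and such that $a_1,a_2,a_3$ are each coprime to $r$. Assume that for every $k=1,\ldots,r-1$ one has $\overline{a_1k}+\overline{a_2k}+\overline{a_3k}+\overline{a_4k}=\overline{ek}+k+r$. Then the six integers $a_1,a_2,a_3,a_4,-e,-1$ can be partitioned into three disjoint pairs, each of which sums to $0$ modulo $r$ (for example, one possibility is $a_1+a_2\equiv a_3+a_4\equiv -e-1\equiv 0 \pmod r$). -/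
section helpers
open Filter Topology Finset MeasureTheory

theorem chi_zero {N : ℕ} [NeZero N] (χ : DirichletCharacter ℂ N) (hχ : χ ≠ 1) : χ 0 = 0 := by
  apply χ.map_nonunit
  intro h
  apply hχ
  ext u
  have : Subsingleton (ZMod N) := isUnit_zero_iff.mp h |> fun h => subsingleton_of_zero_eq_one h
  rw [Subsingleton.elim u 1]; simp

theorem chi_bdd {N : ℕ} [NeZero N] (χ : DirichletCharacter ℂ N) (hχ : χ ≠ 1) (n : ℕ) :
    ‖∑ k ∈ Icc 0 n, χ (k : ZMod N)‖ ≤ N := by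
  have hz : ∑ k ∈ range N, χ (k : ZMod N) = 0 := by
    rw [← MulChar.sum_eq_zero_of_ne_one hχ]
    rw [Finset.sum_bij (fun (k : ℕ) _ => (k : ZMod N))]
    · simp
    · intro a ha b hb h
      rw [ZMod.natCast_eq_natCast_iff'] at h
      rwa [Nat.mod_eq_of_lt (mem_range.mp ha), Nat.mod_eq_of_lt (mem_range.mp hb)] at h
    · intro b _
      exact ⟨b.val, mem_range.mpr (ZMod.val_lt b), ZMod.natCast_zmod_val b⟩
    · simp
  have hper : Function.Periodic (fun n : ℕ => ∑ k ∈ range n, χ (k : ZMod N)) N := by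
    intro m
    simp only
    rw [add_comm m N, Finset.sum_range_add, hz]
    simp
  have e : Icc 0 n = range (n+1) := by ext; simp
  rw [e]
  have := hper.map_mod_nat (n+1)
  rw [← this]
  refine (norm_sum_le _ _).trans ?_
  refine (sum_le_card_nsmul _ _ 1 (fun x _ => χ.norm_le_one _)).trans ?_
  simp
  exact (Nat.mod_lt _ (NeZero.pos N)).le

theorem chi_partial {N : ℕ} [NeZero N] (χ : DirichletCharacter ℂ N) (hχ : χ ≠ 1) :
    Tendsto (fun n : ℕ ↦ ∑ k ∈ Icc 0 n, (1 / (k : ℂ)) * χ (k : ZMod N)) atTop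
      (𝓝 (χ.LFunction 1)) := by
  set c : ℕ → ℂ := fun k => χ (k : ZMod N) with hc
  have hc0 : c 0 = 0 := by simp [hc, chi_zero χ hχ]
  have hd : ∀ t : ℝ, t ≠ 0 → HasDerivAt (fun t : ℝ => 1 / (t : ℂ)) (-((t : ℂ)^2)⁻¹) t := by
    intro t ht
    have := (hasDerivAt_inv (x := (t : ℂ)) (by exact_mod_cast ht)).comp_ofReal
    simpa [one_div] using this
  have hS : ∀ n, ‖∑ k ∈ Icc 0 n, c k‖ ≤ N := chi_bdd χ hχ
  have hS1 : ∀ n, ∑ k ∈ Icc 1 n, c k = ∑ k ∈ Icc 0 n, c k := by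
    intro n
    rw [Icc_eq_cons_Ioc (Nat.zero_le n), sum_cons, hc0, zero_add]; rfl
  have hint2 : IntegrableOn (fun t : ℝ => (N : ℝ) * t ^ (-2 : ℝ)) (Set.Ioi 1) :=
    (integrableOn_Ioi_rpow_of_lt (by norm_num) one_pos).const_mul _
  have key := tendsto_sum_mul_atTop_nhds_one_sub_integral₀ (𝕜 := ℂ) c
    (f := fun t : ℝ => 1 / (t : ℂ)) hc0 (l := 0)
    (g := fun t => t ^ (-2 : ℝ))
    (fun t ht => (hd t (by have : (1:ℝ) ≤ t := ht
                           positivity)).differentiableAt)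
    (by
      refine ContinuousOn.locallyIntegrableOn ?_ measurableSet_Ici
      refine ContinuousOn.congr (f := fun t : ℝ => -((t : ℂ)^2)⁻¹) ?_ ?_
      · refine ContinuousOn.neg (ContinuousOn.inv₀ (by fun_prop) ?_)
        intro t ht
        have : (1:ℝ) ≤ t := ht
        have : t ≠ 0 := by positivity
        exact_mod_cast pow_ne_zero 2 this
      · intro t ht
        have : (1:ℝ) ≤ t := ht
        exact (hd t (by positivity)).deriv)
    (by
      refine squeeze_zero_norm (a := fun n : ℕ => (N : ℝ) / n) ?_ (tendsto_const_div_atTop_nhds_zero_nat _)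
      intro n
      rw [norm_mul]
      simp only [Complex.ofReal_natCast, norm_div, norm_one, Complex.norm_natCast]
      rw [div_mul_eq_mul_div, one_mul]
      gcongr
      exact hS n)
    (by
      rw [Asymptotics.isBigO_iff]
      refine ⟨N, ?_⟩
      filter_upwards [eventually_ge_atTop 1] with t ht
      have t0 : 0 < t := by linarith
      rw [(hd t t0.ne').deriv, norm_mul, mul_comm]
      have : ‖-((t:ℂ)^2)⁻¹‖ = ‖t ^ (-2 : ℝ)‖ := by
        rw [Real.rpow_neg t0.le]
        simp
      rw [this]
      gcongr
      exact hS _)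
    ⟨Set.Ioi 1, Ioi_mem_atTop 1, integrableOn_Ioi_rpow_of_lt (by norm_num) one_pos⟩
  have hL : Tendsto (fun s : ℝ => χ.LFunction s) (𝓝[>] 1) (𝓝 (χ.LFunction 1)) := by
    have := ((DirichletCharacter.differentiable_LFunction hχ).continuous.comp
      Complex.continuous_ofReal).tendsto 1
    simp only [Function.comp_apply, Complex.ofReal_one] at this
    exact this.mono_left nhdsWithin_le_nhds
  have hI : Tendsto (fun s : ℝ => (s : ℂ) * ∫ t in Set.Ioi (1 : ℝ), (∑ k ∈ Icc 1 ⌊t⌋₊, c k) * (t : ℂ) ^ (-((s : ℂ) + 1)))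
      (𝓝[>] 1) (𝓝 (((1 : ℝ) : ℂ) * ∫ t in Set.Ioi (1 : ℝ), (∑ k ∈ Icc 1 ⌊t⌋₊, c k) * (t : ℂ) ^ (-(((1 : ℝ) : ℂ) + 1)))) := by
    refine Tendsto.mul ?_ ?_
    · exact (Complex.continuous_ofReal.tendsto 1).mono_left nhdsWithin_le_nhds
    · refine tendsto_integral_filter_of_dominated_convergence (fun t => (N : ℝ) * t ^ (-2 : ℝ)) ?_ ?_ hint2 ?_
      · refine Eventually.of_forall fun s => ?_
        refine AEStronglyMeasurable.mul ?_ ?_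
        · exact ((measurable_from_nat (f := fun n => ∑ k ∈ Icc 1 n, c k)).comp Nat.measurable_floor).aestronglyMeasurable
        · refine ContinuousOn.aestronglyMeasurable ?_ measurableSet_Ioi
          intro t ht
          have : (1:ℝ) < t := ht
          exact (Complex.continuousAt_ofReal_cpow_const _ _ (Or.inr (by positivity))).continuousWithinAt
      · filter_upwards [self_mem_nhdsWithin] with s hs
        have hs : 1 < s := hs
        filter_upwards [ae_restrict_mem measurableSet_Ioi] with t ht
        have ht : 1 < t := ht
        rw [norm_mul, Complex.norm_cpow_eq_rpow_re_of_pos (by linarith), hS1]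
        gcongr
        · exact hS _
        · exact ht.le
        · simp; linarith
      · filter_upwards [ae_restrict_mem measurableSet_Ioi] with t ht
        have ht : 1 < t := ht
        refine Tendsto.const_mul _ ?_
        refine Tendsto.mono_left ?_ (nhdsWithin_le_nhds)
        have : Continuous (fun s : ℝ => (t : ℂ) ^ (-((s : ℂ) + 1))) := by
          refine Continuous.const_cpow (by fun_prop) (Or.inl ?_)
          exact_mod_cast (by linarith : t ≠ 0)
        exact this.tendsto 1
  have hEq : (fun s : ℝ => χ.LFunction s) =ᶠ[𝓝[>] 1] (fun s : ℝ => (s : ℂ) * ∫ t in Set.Ioi (1 : ℝ), (∑ k ∈ Icc 1 ⌊t⌋₊, c k) * (t : ℂ) ^ (-((s : ℂ) + 1))) := by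
    filter_upwards [self_mem_nhdsWithin] with s hs
    have hs : 1 < s := hs
    rw [DirichletCharacter.LFunction_eq_LSeries χ (by simpa using hs)]
    refine LSeries_eq_mul_integral c le_rfl (by simp; linarith) ?_ ?_
    · exact ZMod.LSeriesSummable_of_one_lt_re χ (by simpa using hs)
    · simp only [Real.rpow_zero]
      rw [Asymptotics.isBigO_iff]
      refine ⟨N, Eventually.of_forall fun n => ?_⟩
      rw [hS1]; simpa using hS n
  have hfin := tendsto_nhds_unique (hL.congr' hEq) hI
  rw [hfin]
  convert key using 2
  · simp [hc]
  · rw [zero_sub, ← integral_neg, Complex.ofReal_one, one_mul]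
    refine setIntegral_congr_fun measurableSet_Ioi ?_
    intro t ht
    have ht : 1 < t := ht
    simp only
    rw [(hd t (by linarith)).deriv, hS1, mul_comm, neg_mul, neg_neg]
    congr 1
    rw [show (-((1:ℂ)+1)) = -((2 : ℕ) : ℂ) by norm_num, Complex.cpow_neg, Complex.cpow_natCast]

open ZMod in
theorem arg_aux (θ : ℝ) (h0 : 0 < θ) (h1 : θ < 1) :
    (1 - Complex.exp (2 * Real.pi * Complex.I * θ)).arg = Real.pi * (θ - 1 / 2) := by
  have hs : 0 < Real.sin (Real.pi * θ) :=
    Real.sin_pos_of_pos_of_lt_pi (by positivity) (by nlinarith [Real.pi_pos])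
  have e : 1 - Complex.exp (2 * Real.pi * Complex.I * θ) =
      ((2 * Real.sin (Real.pi * θ) : ℝ) : ℂ) * (Complex.cos ((Real.pi * (θ - 1 / 2) : ℝ) : ℂ) +
        Complex.sin ((Real.pi * (θ - 1 / 2) : ℝ) : ℂ) * Complex.I) := by
    rw [← Complex.ofReal_cos, ← Complex.ofReal_sin]
    rw [show Real.pi * (θ - 1 / 2) = Real.pi * θ - Real.pi / 2 by ring,
      Real.cos_sub_pi_div_two, Real.sin_sub_pi_div_two]
    rw [show (2 * Real.pi * Complex.I * θ : ℂ) = ((2 * (Real.pi * θ) : ℝ) : ℂ) * Complex.I by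
      push_cast; ring, Complex.exp_mul_I, ← Complex.ofReal_cos, ← Complex.ofReal_sin,
      Real.cos_two_mul, Real.sin_two_mul]
    have h := Real.sin_sq_add_cos_sq (Real.pi * θ)
    have h' : (Real.sin (Real.pi * θ) : ℂ) ^ 2 + (Real.cos (Real.pi * θ) : ℂ) ^ 2 = 1 := by
      exact_mod_cast h
    simp only [Complex.ofReal_sub, Complex.ofReal_mul, Complex.ofReal_pow, Complex.ofReal_neg,
      Complex.ofReal_one, Complex.ofReal_ofNat]
    linear_combination (-2) * h'
  rw [e, Complex.arg_mul_cos_add_sin_mul_I (by positivity)]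
  constructor <;> nlinarith [Real.pi_pos]

open ZMod in
theorem std_eq {N : ℕ} [NeZero N] (j : ZMod N) :
    (stdAddChar j : ℂ) = Complex.exp (2 * Real.pi * Complex.I * ((j.val / N : ℝ) : ℂ)) := by
  have := stdAddChar_coe (N := N) (j.val : ℤ)
  simp only [Int.cast_natCast, natCast_zmod_val] at this
  rw [this]
  push_cast
  ring_nf

open ZMod in
theorem arg_std {N : ℕ} [NeZero N] (j : ZMod N) (hj : j ≠ 0) :
    (1 - (stdAddChar j : ℂ)).arg = Real.pi * (j.val / N - 1 / 2) := by
  have hN : (0 : ℝ) < N := by exact_mod_cast NeZero.pos N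
  rw [std_eq]
  apply arg_aux
  · have : 0 < j.val := Nat.pos_of_ne_zero (by simpa using hj)
    positivity
  · rw [div_lt_one hN]; exact_mod_cast ZMod.val_lt j

open ZMod in
theorem one_sub_std_mem {N : ℕ} [NeZero N] (j : ZMod N) (hj : j ≠ 0) :
    (1 - (stdAddChar j : ℂ)) ∈ Complex.slitPlane := by
  rw [Complex.mem_slitPlane_iff_arg, arg_std j hj]
  have hN : (0 : ℝ) < N := by exact_mod_cast NeZero.pos N
  have h2 : (j.val / N : ℝ) < 1 := by rw [div_lt_one hN]; exact_mod_cast ZMod.val_lt j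
  constructor
  · nlinarith [Real.pi_pos]
  · rw [sub_ne_zero]
    intro h
    exact hj (injective_stdAddChar (by simpa using h.symm))

open ZMod in
theorem L_one_log {N : ℕ} [NeZero N] (χ : DirichletCharacter ℂ N) (hχ : χ ≠ 1) :
    χ.LFunction 1 = (N : ℂ)⁻¹ * ∑ j : ZMod N, 𝓕 χ j * (- Complex.log (1 - stdAddChar j)) := by
  have h1 := (chi_partial χ hχ)
  have h2 : Tendsto (fun n : ℕ ↦ ∑ k ∈ range n, (1 / (k : ℂ)) * χ (k : ZMod N)) atTop
      (𝓝 (χ.LFunction 1)) := by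
    rw [← tendsto_add_atTop_iff_nat 1]
    convert h1 using 2 with n
    congr 1
    ext; simp
  have h3 := Complex.tendsto_tsum_powerSeries_nhdsWithin_lt h2
  rw [tendsto_map'_iff] at h3
  have hF0 : 𝓕 (χ : ZMod N → ℂ) 0 = 0 := by
    rw [dft_apply_zero]; exact MulChar.sum_eq_zero_of_ne_one hχ
  have hinv : ∀ k : ZMod N, χ k = (N : ℂ)⁻¹ * ∑ j : ZMod N, stdAddChar (j * k) * 𝓕 χ j := by
    intro k
    have := invDFT_apply (𝓕 (χ : ZMod N → ℂ)) k
    rw [LinearEquiv.symm_apply_apply] at this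
    simpa using this
  have hnorm : ∀ j : ZMod N, ‖(stdAddChar j : ℂ)‖ = 1 := fun j => Circle.norm_coe (toCircle j)
  have h4 : ∀ x : ℝ, 0 < x → x < 1 → HasSum (fun n : ℕ => (1 / (n : ℂ)) * χ (n : ZMod N) * (x : ℂ) ^ n)
      ((N : ℂ)⁻¹ * ∑ j : ZMod N, 𝓕 χ j * (- Complex.log (1 - x * stdAddChar j))) := by
    intro x hx0 hx1
    have : ∀ j : ZMod N, HasSum (fun n : ℕ => 𝓕 χ j * ((x * stdAddChar j : ℂ) ^ n / n))
        (𝓕 χ j * (- Complex.log (1 - x * stdAddChar j))) := by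
      intro j
      refine (Complex.hasSum_taylorSeries_neg_log ?_).mul_left _
      rw [norm_mul, hnorm]
      simp [abs_of_pos hx0, hx1]
    have := (hasSum_sum (s := univ) fun j _ => this j).mul_left (N : ℂ)⁻¹
    refine (congrArg (fun g => HasSum g _) (funext fun n => ?_)).mpr this
    rw [hinv, mul_assoc, mul_sum, mul_sum, sum_mul, mul_sum]
    refine sum_congr rfl fun j _ => ?_
    rw [mul_comm j (n : ZMod N), ← nsmul_eq_mul, AddChar.map_nsmul_eq_pow, mul_pow]
    ring
  have h5 : Tendsto (fun x : ℝ => (N : ℂ)⁻¹ * ∑ j : ZMod N, 𝓕 χ j * (- Complex.log (1 - x * stdAddChar j)))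
      (𝓝[<] 1) (𝓝 ((N : ℂ)⁻¹ * ∑ j : ZMod N, 𝓕 χ j * (- Complex.log (1 - stdAddChar j)))) := by
    refine Tendsto.const_mul _ (tendsto_finsetSum _ fun j _ => ?_)
    by_cases hj : j = 0
    · subst hj; simp [hF0]
    · refine Tendsto.const_mul _ (Tendsto.neg ?_)
      refine Tendsto.clog ?_ (one_sub_std_mem j hj)
      refine Tendsto.mono_left ?_ nhdsWithin_le_nhds
      have : Continuous (fun x : ℝ => (1 : ℂ) - x * stdAddChar j) := by fun_prop
      simpa using this.tendsto 1
  refine tendsto_nhds_unique h3 (h5.congr' ?_)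
  filter_upwards [self_mem_nhdsWithin, mem_nhdsWithin_of_mem_nhds (lt_mem_nhds one_pos)] with x hx hx0
  exact (h4 x hx0 hx).tsum_eq.symm

/-- Sawtooth. -/
noncomputable def saw {N : ℕ} (j : ZMod N) : ℂ := if j = 0 then 0 else (j.val / N - 1 / 2 : ℝ)

open ZMod in
theorem saw_sum_ne_zero {N : ℕ} [NeZero N] (χ : DirichletCharacter ℂ N) (hχ : χ.Odd) :
    ∑ j : ZMod N, 𝓕 χ j * saw j ≠ 0 := by
  have hχ1 : χ ≠ 1 := by
    rintro rfl
    have : (1 : DirichletCharacter ℂ N) (-1) = -1 := hχ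
    rw [MulChar.one_apply (by simp)] at this
    norm_num at this
  have hL := DirichletCharacter.LFunction_apply_one_ne_zero hχ1
  rw [L_one_log χ hχ1] at hL
  intro h0
  apply hL
  have hodd : (𝓕 (χ : ZMod N → ℂ)).Odd := dft_odd_iff.mpr hχ.to_fun
  have e : ∑ j : ZMod N, 𝓕 χ j * (- Complex.log (1 - stdAddChar j)) =
      ∑ j : ZMod N, 𝓕 χ j * (Complex.log (1 - stdAddChar (-j))) := by
    rw [← Equiv.sum_comp (Equiv.neg _)]
    refine sum_congr rfl fun j _ => ?_
    simp [hodd j]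
  have e2 : 2 * ∑ j : ZMod N, 𝓕 χ j * (- Complex.log (1 - stdAddChar j)) =
      - (2 * Real.pi * Complex.I) * ∑ j : ZMod N, 𝓕 χ j * saw j := by
    rw [two_mul]
    nth_rw 2 [e]
    rw [← sum_add_distrib, mul_sum]
    refine sum_congr rfl fun j _ => ?_
    by_cases hj : j = 0
    · subst hj; simp [hodd.map_zero]
    · have hc : (1 - stdAddChar (-j) : ℂ) = (starRingEnd ℂ) (1 - stdAddChar j) := by
        rw [stdAddChar_apply, stdAddChar_apply, AddChar.map_neg_eq_inv, Circle.coe_inv_eq_conj]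
        simp
      rw [hc, Complex.log_conj _ (Complex.mem_slitPlane_iff_arg.mp (one_sub_std_mem j hj)).1]
      have h2 := Complex.sub_conj (Complex.log (1 - stdAddChar j))
      rw [Complex.log_im, arg_std j hj] at h2
      rw [saw, if_neg hj]
      push_cast at h2 ⊢
      linear_combination (- 𝓕 χ j) * h2
  rw [h0, mul_zero] at e2
  have := (mul_eq_zero.mp e2).resolve_left two_ne_zero
  rw [this, mul_zero]

open ZMod in
theorem char_sum_zero {N : ℕ} [NeZero N] {ι : Type*} [Fintype ι] (x : ι → (ZMod N)ˣ)
    (h : ∀ j : ZMod N, ∑ i, saw ((x i : ZMod N) * j) = 0)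
    (χ : DirichletCharacter ℂ N) (hχ : χ.Odd) : ∑ i, χ (x i) = 0 := by
  have hu : ∀ u : (ZMod N)ˣ, ∑ j : ZMod N, 𝓕 χ j * saw ((u : ZMod N) * j) =
      χ u * ∑ j : ZMod N, 𝓕 χ j * saw j := by
    intro u
    rw [← Equiv.sum_comp (u⁻¹).mulLeft, mul_sum]
    refine sum_congr rfl fun j _ => ?_
    have := dft_comp_unitMul (χ : ZMod N → ℂ) u j
    simp only [Units.mulLeft_apply]
    rw [← this, Units.mul_inv_cancel_left]
    simp only [map_mul]
    rw [dft_const_mul]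
    ring
  have : (∑ i, χ (x i)) * ∑ j : ZMod N, 𝓕 χ j * saw j = 0 := by
    rw [sum_mul]
    simp_rw [← hu]
    rw [sum_comm]
    refine sum_eq_zero fun j _ => ?_
    rw [← mul_sum, h, mul_zero]
  exact (mul_eq_zero.mp this).resolve_right (saw_sum_ne_zero χ hχ)

theorem count_eq {N : ℕ} [NeZero N] {ι : Type*} [Fintype ι] (x : ι → (ZMod N)ˣ)
    (h : ∀ j : ZMod N, ∑ i, saw ((x i : ZMod N) * j) = 0) (a : (ZMod N)ˣ) :
    #{i | (x i : ZMod N) = a} = #{i | (x i : ZMod N) = -a} := by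
  have h1 : ∀ χ : DirichletCharacter ℂ N, ∑ i, (χ (x i) - χ (-(x i))) = 0 := by
    intro χ
    rcases χ.even_or_odd with hχ | hχ
    · simp [hχ.eval_neg]
    · simp [hχ.eval_neg, ← two_mul, ← mul_sum, char_sum_zero x h χ hχ]
  have h2 : ∑ χ : DirichletCharacter ℂ N, χ (a : ZMod N)⁻¹ * ∑ i, (χ (x i) - χ (-(x i))) = 0 :=
    sum_eq_zero fun χ _ => by rw [h1, mul_zero]
  simp_rw [mul_sum] at h2
  rw [sum_comm] at h2
  simp_rw [mul_sub, sum_sub_distrib, DirichletCharacter.sum_char_inv_mul_char_eq ℂ a.isUnit] at h2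
  rw [sub_eq_zero, ← sum_filter, ← sum_filter, sum_const, sum_const] at h2
  have ht : (N.totient : ℂ) ≠ 0 := by
    exact_mod_cast (Nat.totient_pos.mpr (NeZero.pos N)).ne'
  simp only [nsmul_eq_mul] at h2
  have h3 := mul_right_cancel₀ ht h2
  have h4 : #{i | (a : ZMod N) = x i} = #{i | (a : ZMod N) = -x i} := by exact_mod_cast h3
  convert h4 using 3
  · rw [eq_comm]
  · rw [eq_neg_iff_add_eq_zero, eq_neg_iff_add_eq_zero, add_comm]

theorem pairing {ι G : Type*} [DecidableEq ι] [AddCommGroup G] [DecidableEq G] (v : ι → G)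
    (hv : ∀ i, v i ≠ - v i) (n : ℕ) : ∀ s : Finset ι, #s = n →
    (∀ i, #{k ∈ s | v k = v i} = #{k ∈ s | v k = - v i}) →
    ∃ f : ι → ι, ∀ i ∈ s, f i ∈ s ∧ f (f i) = i ∧ f i ≠ i ∧ v i + v (f i) = 0 := by
  induction n using Nat.strong_induction_on with
  | _ n ih =>
  intro s hs hc
  rcases s.eq_empty_or_nonempty with rfl | ⟨i, hi⟩
  · exact ⟨id, by simp⟩
  have : 0 < #{k ∈ s | v k = - v i} := by
    rw [← hc i]
    exact card_pos.mpr ⟨i, by simp [hi]⟩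
  obtain ⟨j, hj⟩ := card_pos.mp this
  rw [mem_filter] at hj
  obtain ⟨hjs, hj⟩ := hj
  have hij : j ≠ i := by rintro rfl; exact hv _ hj
  obtain ⟨f, hf⟩ := ih #((s.erase i).erase j) (by
      rw [← hs]
      exact card_lt_card ((erase_subset _ _).trans_ssubset (erase_ssubset hi))) _ rfl (by
    intro k
    have key : ∀ a, #{k ∈ s | v k = a} = #{k ∈ (s.erase i).erase j | v k = a} + (if v j = a then 1 else 0) + (if v i = a then 1 else 0) := by
      intro a
      rw [card_filter, card_filter, ← add_sum_erase s _ hi,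
        ← add_sum_erase (s.erase i) _ (mem_erase.mpr ⟨hij, hjs⟩)]
      ring
    have h := hc k
    rw [key, key] at h
    have e1 : (v j = v k) ↔ (v i = - v k) := by rw [hj, neg_eq_iff_eq_neg]
    have e2 : (v j = -v k) ↔ (v i = v k) := by rw [hj, neg_inj]
    simp only [e1, e2] at h
    omega)
  refine ⟨fun k => if k = i then j else if k = j then i else f k, ?_⟩
  intro k hk
  by_cases h1 : k = i
  · subst h1; simp [hij, hjs, hj]
  by_cases h2 : k = j
  · subst h2; simp [hij, hi, hj, Ne.symm hij]
  have := hf k (by simp [h1, h2, hk])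
  simp only [mem_erase] at this
  obtain ⟨⟨a, b, c⟩, d, e, g⟩ := this
  simp [h1, h2, a, b, c, d, e, g]

theorem saw_int {N : ℕ} [NeZero N] (n : ℤ) (h : (n : ZMod N) ≠ 0) :
    saw (n : ZMod N) = ((n % (N : ℤ) : ℤ) : ℂ) / N - 1 / 2 := by
  rw [saw, if_neg h]
  have := ZMod.val_intCast (n := N) n
  have h2 : (((n : ZMod N).val : ℤ) : ℂ) = ((n % (N : ℤ) : ℤ) : ℂ) := by rw [this]
  push_cast at h2 ⊢
  rw [h2]

theorem core {N : ℕ} [NeZero N] (x : Fin 6 → ℤ) (hx : ∀ i, IsUnit (x i : ZMod N))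
    (h : ∀ k : ℤ, 1 ≤ k → k ≤ N - 1 → ∑ i, (x i * k) % (N : ℤ) = 3 * N) :
    ∃ σ : Equiv.Perm (Fin 6), (∀ i, σ (σ i) = i) ∧ (∀ i, σ i ≠ i) ∧
      ∀ i, ((x i + x (σ i) : ℤ) : ZMod N) = 0 := by
  classical
  have hN : (N : ℂ) ≠ 0 := by exact_mod_cast NeZero.ne N
  choose u hu using hx
  have hsaw : ∀ j : ZMod N, ∑ i, saw ((u i : ZMod N) * j) = 0 := by
    intro j
    by_cases hj : j = 0
    · subst hj; simp [saw]
    · have hjv : 0 < j.val := Nat.pos_of_ne_zero (by simpa using hj)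
      have hlt := ZMod.val_lt j
      have hk := h j.val (by omega) (by omega)
      have e : ∀ i, saw ((u i : ZMod N) * j) = (((x i * j.val) % (N : ℤ) : ℤ) : ℂ) / N - 1 / 2 := by
        intro i
        have e1 : (u i : ZMod N) * j = ((x i * (j.val : ℤ) : ℤ) : ZMod N) := by
          rw [hu]; push_cast; simp
        have hne : (u i : ZMod N) * j ≠ 0 := by simpa using hj
        rw [e1] at hne ⊢
        exact saw_int _ hne
      simp_rw [e]
      rw [sum_sub_distrib, ← sum_div, ← Int.cast_sum, hk]
      simp only [sum_const, card_univ, Fintype.card_fin]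
      push_cast
      field_simp
      norm_num
  have hcount := count_eq u hsaw
  by_cases h2 : (2 : ZMod N) = 0
  · refine ⟨Fin.revPerm, by simp, by decide, ?_⟩
    have hN2 : N ∣ 2 := by
      rw [← ZMod.natCast_eq_zero_iff]; exact_mod_cast h2
    have hall : ∀ a b : (ZMod N)ˣ, a = b := by
      have : N ≤ 2 := Nat.le_of_dvd (by norm_num) hN2
      have h0 := NeZero.pos N
      interval_cases N <;> decide
    intro i
    push_cast
    rw [← hu, ← hu, hall (u (Fin.revPerm i)) (u i), ← two_mul, h2, zero_mul]
  · have hv : ∀ i, (x i : ZMod N) ≠ - (x i : ZMod N) := by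
      intro i hi
      rw [eq_neg_iff_add_eq_zero, ← two_mul, ← hu, Units.mul_left_eq_zero] at hi
      exact h2 hi
    obtain ⟨f, hf⟩ := pairing (fun i => (x i : ZMod N)) hv _ univ rfl (by
      intro i
      have := hcount (u i)
      simpa only [hu] using this)
    have hinv : Function.Involutive f := fun i => (hf i (mem_univ _)).2.1
    refine ⟨hinv.toPerm, fun i => hinv i, fun i => (hf i (mem_univ _)).2.2.1, fun i => ?_⟩
    push_cast
    exact (hf i (mem_univ _)).2.2.2

theorem res_neg_aux (r n : ℤ) (hr : 0 < r) (h : ¬ r ∣ n) : (-n) % r = r - n % r := by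
  have h1 : n % r ≠ 0 := fun h' => h (Int.dvd_of_emod_eq_zero h')
  have h2 := Int.emod_nonneg n hr.ne'
  have h3 := Int.emod_lt_of_pos n hr
  have e : -n = (r - n % r) + r * (-(n / r) - 1) := by
    have := Int.emod_add_mul_ediv n r
    linear_combination this
  rw [e, Int.add_mul_emod_self_left]
  exact Int.emod_eq_of_lt (by omega) (by omega)

end helpers

/-- Terminal lemma of Morrison–Stevens, case `q = 1`: the six integers
`a1, a2, a3, a4, -e, -1` can be split into three disjoint pairs, each summing
to `0` modulo `r`. -/
theorem terminal_lemma_q_eq_one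
    (r : ℤ) (hr : 0 < r) (a1 a2 a3 a4 e : ℤ)
    (he : Int.gcd e r = 1) (ha4 : Int.gcd a4 r = 1)
    (h1 : Int.gcd a1 r = 1) (h2 : Int.gcd a2 r = 1) (h3 : Int.gcd a3 r = 1)
    (hsum : ∀ k : ℤ, 1 ≤ k → k ≤ r - 1 →
      res r (a1 * k) + res r (a2 * k) + res r (a3 * k) + res r (a4 * k)
        = res r (e * k) + k + r) :
    ∃ σ : Equiv.Perm (Fin 6),
      (∀ i, σ (σ i) = i) ∧ (∀ i, σ i ≠ i) ∧
      ∀ i, Int.ModEq r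
        (![a1, a2, a3, a4, -e, -1] i + ![a1, a2, a3, a4, -e, -1] (σ i)) 0 := by
  obtain ⟨N, rfl⟩ := Int.eq_ofNat_of_zero_le hr.le
  have hN0 : N ≠ 0 := by rintro rfl; simp at hr
  have : NeZero N := ⟨hN0⟩
  have unit : ∀ a : ℤ, Int.gcd a N = 1 → IsUnit (a : ZMod N) := by
    intro a ha
    obtain ⟨p, q, hpq⟩ := Int.isCoprime_iff_gcd_eq_one.mpr ha
    refine IsUnit.of_mul_eq_one (p : ZMod N) ?_
    have := congrArg (Int.cast : ℤ → ZMod N) hpq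
    push_cast at this
    simpa [mul_comm] using this
  obtain ⟨σ, s1, s2, s3⟩ := core (N := N) ![a1, a2, a3, a4, -e, -1] (by
      intro i
      fin_cases i
      · exact unit _ h1
      · exact unit _ h2
      · exact unit _ h3
      · exact unit _ ha4
      · exact unit _ (by simpa using he)
      · exact unit _ (by simp)) (by
      intro k hk1 hk2
      have hk := hsum k hk1 hk2
      simp only [res] at hk
      have hnd : ¬ (N : ℤ) ∣ k := fun hd => by
        have := Int.le_of_dvd (by omega) hd
        omega
      have hne : ¬ (N : ℤ) ∣ e * k := fun hd =>
        hnd (Int.dvd_of_dvd_mul_right_of_gcd_one hd (by rwa [Int.gcd_comm]))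
      have e1 := res_neg_aux N (e * k) hr hne
      have e2 := res_neg_aux N k hr hnd
      have e3 : k % (N : ℤ) = k := Int.emod_eq_of_lt (by omega) (by omega)
      simp only [Fin.sum_univ_six]
      simp
      rw [e1, e2, e3]
      linarith)
  refine ⟨σ, s1, s2, fun i => ?_⟩
  rw [← ZMod.intCast_eq_intCast_iff]
  simpa using s3 i
end

section
/- There exists a real constant $\delta_3>0$ with the following property: for every integer $r\geq 2$ and all integers $a_1,a_2,a_3$ each coprime to $r$, if $M:=\min_{1\leq j\leq r-1}\frac{1}{r}\big(\overline{a_1j}+\overline{a_2j}+\overline{a_3j}\big)<1$, then $M\leq 1-\delta_3$. -/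
theorem box_bound (r x : ℤ) (hr : 0 < r) :
    0 ≤ 21 * (x % r) / r ∧ 21 * (x % r) / r < 21 := by
  have h1 := Int.emod_nonneg x hr.ne'
  have h2 := Int.emod_lt_of_pos x hr
  exact ⟨Int.ediv_nonneg (by omega) hr.le, Int.ediv_lt_of_lt_mul hr (by linarith)⟩

theorem box_diff (r x y : ℤ) (hr : 0 < r)
    (h : 21 * (x % r) / r = 21 * (y % r) / r) :
    ∃ c t : ℤ, y - x = c * r + t ∧ 21 * t < r ∧ -r < 21 * t := by
  refine ⟨y / r - x / r, y % r - x % r, ?_, ?_, ?_⟩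
  · have h1 := Int.emod_add_mul_ediv x r
    have h2 := Int.emod_add_mul_ediv y r
    linarith
  all_goals
    have h1 := Int.emod_add_mul_ediv (21 * (x % r)) r
    have h2 := Int.emod_add_mul_ediv (21 * (y % r)) r
    have h3 := Int.emod_nonneg (21 * (x % r)) hr.ne'
    have h4 := Int.emod_lt_of_pos (21 * (x % r)) hr
    have h5 := Int.emod_nonneg (21 * (y % r)) hr.ne'
    have h6 := Int.emod_lt_of_pos (21 * (y % r)) hr
    rw [h] at h1
    linarith

theorem dirichlet3 (r b1 b2 b3 : ℤ) (hr : 0 < r) :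
    ∃ k : ℤ, 1 ≤ k ∧ k ≤ 9261 ∧
      (∃ c t : ℤ, k * b1 = c * r + t ∧ 21 * t < r ∧ -r < 21 * t) ∧
      (∃ c t : ℤ, k * b2 = c * r + t ∧ 21 * t < r ∧ -r < 21 * t) ∧
      (∃ c t : ℤ, k * b3 = c * r + t ∧ 21 * t < r ∧ -r < 21 * t) := by
  let f : ℤ → ℤ × ℤ × ℤ := fun k =>
    (21 * ((k * b1) % r) / r, 21 * ((k * b2) % r) / r, 21 * ((k * b3) % r) / r)
  have key : ∃ x ∈ Finset.Icc (0 : ℤ) 9261, ∃ y ∈ Finset.Icc (0 : ℤ) 9261, x ≠ y ∧ f x = f y := by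
    apply Finset.exists_ne_map_eq_of_card_lt_of_maps_to
      (t := Finset.Ico (0 : ℤ) 21 ×ˢ (Finset.Ico (0 : ℤ) 21 ×ˢ Finset.Ico (0 : ℤ) 21))
    · simp only [Finset.card_product, Int.card_Ico, Int.card_Icc]
      norm_num
    · intro k _
      simp only [f, Finset.coe_product, Set.mem_prod, Finset.coe_Ico, Set.mem_Ico]
      exact ⟨box_bound _ _ hr, box_bound _ _ hr, box_bound _ _ hr⟩
  have main : ∀ x y : ℤ, 0 ≤ x → x < y → y ≤ 9261 → f x = f y →
      ∃ k : ℤ, 1 ≤ k ∧ k ≤ 9261 ∧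
      (∃ c t : ℤ, k * b1 = c * r + t ∧ 21 * t < r ∧ -r < 21 * t) ∧
      (∃ c t : ℤ, k * b2 = c * r + t ∧ 21 * t < r ∧ -r < 21 * t) ∧
      (∃ c t : ℤ, k * b3 = c * r + t ∧ 21 * t < r ∧ -r < 21 * t) := by
    intro x y hx hxy hy hf
    simp only [f, Prod.mk.injEq] at hf
    refine ⟨y - x, by omega, by omega, ?_, ?_, ?_⟩
    · rw [sub_mul]; exact box_diff _ _ _ hr hf.1
    · rw [sub_mul]; exact box_diff _ _ _ hr hf.2.1
    · rw [sub_mul]; exact box_diff _ _ _ hr hf.2.2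
  obtain ⟨x, hx, y, hy, hne, hf⟩ := key
  rw [Finset.mem_Icc] at hx hy
  rcases lt_or_gt_of_ne hne with h | h
  · exact main x y hx.1 h hy.2 hf
  · exact main y x hy.1 h hx.2 hf.symm

theorem core_s2 (r b1 b2 b3 e : ℤ) (h1 : 0 < b1) (h2 : 0 < b2) (h3 : 0 < b3)
    (hs : b1 + b2 + b3 = r - e) (he : 1 ≤ e) (hN : 20000 * e < r)
    (H : ∀ k c1 c2 c3 t1 t2 t3 : ℤ, k * b1 = c1 * r + t1 → k * b2 = c2 * r + t2 →
      k * b3 = c3 * r + t3 → 0 ≤ t1 → t1 < r → 0 ≤ t2 → t2 < r → 0 ≤ t3 → t3 < r →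
      0 < t1 + t2 + t3 → r - e ≤ t1 + t2 + t3) : False := by
  have hb1 : 2 * b1 < r := by
    by_contra hc
    have := H 2 1 0 0 (2 * b1 - r) (2 * b2) (2 * b3) (by ring) (by ring) (by ring)
    omega
  have hb2 : 2 * b2 < r := by
    by_contra hc
    have := H 2 0 1 0 (2 * b1) (2 * b2 - r) (2 * b3) (by ring) (by ring) (by ring)
    omega
  have hb3 : 2 * b3 < r := by
    by_contra hc
    have := H 2 0 0 1 (2 * b1) (2 * b2) (2 * b3 - r) (by ring) (by ring) (by ring)
    omega
  have hc1 : r ≤ 10 * b1 := by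
    by_contra hc
    have := H 3 0 1 1 (3 * b1) (3 * b2 - r) (3 * b3 - r) (by ring) (by ring) (by ring)
    omega
  have hc2 : r ≤ 10 * b2 := by
    by_contra hc
    have := H 3 1 0 1 (3 * b1 - r) (3 * b2) (3 * b3 - r) (by ring) (by ring) (by ring)
    omega
  have hc3 : r ≤ 10 * b3 := by
    by_contra hc
    have := H 3 1 1 0 (3 * b1 - r) (3 * b2 - r) (3 * b3) (by ring) (by ring) (by ring)
    omega
  obtain ⟨k, hk1, hk2, ⟨c1, t1, e1, u1, l1⟩, ⟨c2, t2, e2, u2, l2⟩, ⟨c3, t3, e3, u3, l3⟩⟩ :=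
    dirichlet3 r b1 b2 b3 (by omega)
  have hH := H (k + 1) c1 c2 c3 (b1 + t1) (b2 + t2) (b3 + t3) (by linarith) (by linarith)
    (by linarith) (by omega) (by omega) (by omega) (by omega) (by omega) (by omega) (by omega)
  have hsum : t1 + t2 + t3 + k * e = (k - c1 - c2 - c3) * r := by
    have : k * (b1 + b2 + b3) = k * (r - e) := by rw [hs]
    linarith
  have hke1 : 0 < k * e := by positivity
  have hke2 : k * e ≤ 9261 * e := by nlinarith
  have hp : 0 < (k - c1 - c2 - c3) * r := by omega
  have hq : (k - c1 - c2 - c3) * r < 1 * r := by omega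
  have hr : 0 < r := by omega
  have := pos_of_mul_pos_left hp hr.le
  have := lt_of_mul_lt_mul_right hq hr.le
  omega

theorem res_pos (r a j : ℤ) (hr : 2 ≤ r) (ha : Int.gcd a r = 1) (hj1 : 1 ≤ j) (hj2 : j ≤ r - 1) :
    0 < (a * j) % r := by
  have h0 := Int.emod_nonneg (a * j) (by omega : r ≠ 0)
  rcases h0.lt_or_eq with h | h
  · exact h
  · exfalso
    have hd : r ∣ a * j := Int.dvd_of_emod_eq_zero h.symm
    have hd' : r ∣ j := Int.dvd_of_dvd_mul_right_of_gcd_one hd (by rw [Int.gcd_comm]; exact ha)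
    have := Int.le_of_dvd (by omega) hd'
    omega

theorem res_mul (r a j k c t : ℤ) (h : k * ((a * j) % r) = c * r + t) (h0 : 0 ≤ t) (h1 : t < r) :
    (a * ((j * k) % r)) % r = t := by
  have e1 : (a * ((j * k) % r)) % r = (k * ((a * j) % r)) % r := by
    rw [Int.mul_emod, Int.emod_emod_of_dvd _ dvd_rfl, ← Int.mul_emod,
      Int.mul_emod k, Int.emod_emod_of_dvd _ dvd_rfl, ← Int.mul_emod]
    congr 1; ring
  rw [e1, h, add_comm, Int.add_mul_emod_self_right, Int.emod_eq_of_lt h0 h1]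

/-- Gap below `1` for minimal log discrepancies of isolated three-dimensional
cyclic quotient singularities of type `(1/r)(a1, a2, a3)`. -/
theorem gap_dim3_cyclic_quotient :
    ∃ δ3 : ℝ, 0 < δ3 ∧
      ∀ r a1 a2 a3 : ℤ, 2 ≤ r →
        Int.gcd a1 r = 1 → Int.gcd a2 r = 1 → Int.gcd a3 r = 1 →
        ∀ M : ℝ,
          IsLeast {x : ℝ | ∃ j : ℤ, 1 ≤ j ∧ j ≤ r - 1 ∧
            x = ((res r (a1 * j) + res r (a2 * j) + res r (a3 * j) : ℤ) : ℝ) / (r : ℝ)} M →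
          M < 1 → M ≤ 1 - δ3 := by
  refine ⟨1 / 20000, by norm_num, ?_⟩
  intro r a1 a2 a3 hr g1 g2 g3 M hM hM1
  obtain ⟨⟨j, hj1, hj2, hMj⟩, hmin⟩ := hM
  by_contra hcon
  push Not at hcon
  have hrR : (0 : ℝ) < (r : ℝ) := by exact_mod_cast (by omega : 0 < r)
  simp only [res] at hMj hmin
  have p1 := res_pos r a1 j hr g1 hj1 hj2
  have p2 := res_pos r a2 j hr g2 hj1 hj2
  have p3 := res_pos r a3 j hr g3 hj1 hj2
  refine core_s2 r (a1 * j % r) (a2 * j % r) (a3 * j % r)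
    (r - (a1 * j % r + a2 * j % r + a3 * j % r)) p1 p2 p3 (by ring) ?_ ?_ ?_
  · rw [hMj, div_lt_one hrR] at hM1
    have : a1 * j % r + a2 * j % r + a3 * j % r < r := by exact_mod_cast hM1
    omega
  · rw [hMj, lt_div_iff₀ hrR] at hcon
    have : (20000 * (r - (a1 * j % r + a2 * j % r + a3 * j % r) : ℤ) : ℝ) < (r : ℝ) := by
      push_cast at hcon ⊢
      linarith
    exact_mod_cast this
  · intro k c1 c2 c3 t1 t2 t3 e1 e2 e3 l1 u1 l2 u2 l3 u3 hpos
    have q1 := res_mul r a1 j k c1 t1 e1 l1 u1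
    have q2 := res_mul r a2 j k c2 t2 e2 l2 u2
    have q3 := res_mul r a3 j k c3 t3 e3 l3 u3
    have n0 := Int.emod_nonneg (j * k) (by omega : r ≠ 0)
    have n1 := Int.emod_lt_of_pos (j * k) (by omega : 0 < r)
    have n2 : j * k % r ≠ 0 := by
      intro h0
      rw [h0, mul_zero, Int.zero_emod] at q1 q2 q3
      omega
    have hle := hmin ⟨j * k % r, by omega, by omega, rfl⟩
    rw [q1, q2, q3, hMj, div_le_div_iff_of_pos_right hrR] at hle
    have : a1 * j % r + a2 * j % r + a3 * j % r ≤ t1 + t2 + t3 := by exact_mod_cast hle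
    omega
end

section
/- There exists a real constant $\delta_5>0$ with the following property: for every positive integer $r$ and all integers $b_1,\ldots,b_5$ with $\gcd(b_1,b_2,b_3,b_4,b_5,r)=1$ and such that for every $j\in\{1,\ldots,r-1\}$ at least two indices $i\in\{1,\ldots,5\}$ satisfy $\overline{b_ij}\neq 0$, the following holds: define for each $j\in\{0,\ldots,r-1\}$ the sum $S(j)=\sum_{i=1}^{5}c_i(j)$, where $c_i(j)=\overline{b_ij}/r$ if $\overline{b_ij}\neq 0$ and $c_i(j)=1$ otherwise; if $M:=\min_{0\leq j\leq r-1}S(j)<2$, then $M\leq 2-\delta_5$. -/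
open scoped BigOperators

open scoped Real

noncomputable def ee (t : ℝ) : ℂ := Complex.exp (2 * π * Complex.I * t)

lemma ee_add (s t : ℝ) : ee (s + t) = ee s * ee t := by
  unfold ee; rw [← Complex.exp_add]; push_cast; ring_nf

lemma ee_int (n : ℤ) : ee n = 1 := by
  unfold ee; rw [Complex.exp_eq_one_iff]; exact ⟨n, by push_cast; ring⟩

lemma ee_eq_one {t : ℝ} (h : ee t = 1) : ∃ n : ℤ, t = n := by
  unfold ee at h
  rw [Complex.exp_eq_one_iff] at h
  obtain ⟨n, hn⟩ := h
  refine ⟨n, ?_⟩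
  have h2 : (2 * π * Complex.I : ℂ) ≠ 0 := Complex.two_pi_I_ne_zero
  have h3 : (2 * π * Complex.I : ℂ) * t = (2 * π * Complex.I) * n := by rw [hn]; ring
  have := mul_left_cancel₀ h2 h3
  exact_mod_cast this

lemma ee_nat_mul (k : ℕ) (t : ℝ) : ee (k * t) = ee t ^ k := by
  unfold ee; rw [← Complex.exp_nat_mul]; push_cast; ring_nf

lemma ee_sum {ι : Type*} (s : Finset ι) (f : ι → ℝ) : ee (∑ i ∈ s, f i) = ∏ i ∈ s, ee (f i) := by
  unfold ee; rw [← Complex.exp_sum, Complex.ofReal_sum, Finset.mul_sum]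

lemma h_expand (N : ℕ) (t : ℝ) :
    (((Real.cos (π * t) ^ 2) ^ N : ℝ) : ℂ) =
      ∑ j ∈ Finset.range (2 * N + 1), ((((2 * N).choose j : ℝ) / 4 ^ N : ℝ) : ℂ) *
        ee (((j : ℤ) - (N : ℤ) : ℤ) * t) := by
  have h1 : ((Real.cos (π * t) ^ 2 : ℝ) : ℂ) = ee (-t) * (ee t + 1) ^ 2 / 4 := by
    push_cast
    unfold ee
    rw [Complex.cos]
    have e1 : Complex.exp (2 * π * Complex.I * t) = Complex.exp (π * t * Complex.I) ^ 2 := by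
      rw [← Complex.exp_nat_mul]; push_cast; ring_nf
    have e2 : Complex.exp (2 * π * Complex.I * ((-t : ℝ) : ℂ))
        = Complex.exp (-(π * t) * Complex.I) ^ 2 := by
      rw [← Complex.exp_nat_mul]; push_cast; ring_nf
    have e3 : Complex.exp (-(π * t) * Complex.I) * Complex.exp (π * t * Complex.I) = 1 := by
      rw [← Complex.exp_add]; ring_nf; simp
    rw [e1, e2]
    generalize Complex.exp (π * t * Complex.I) = A at *
    generalize Complex.exp (-(π * t) * Complex.I) = B at *
    have : B ^ 2 * (A ^ 2 + 1) ^ 2 = (B * A * A + B) ^ 2 := by ring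
    rw [this, e3]; ring
  rw [Complex.ofReal_pow, h1, div_pow, mul_pow, ← pow_mul, add_pow]
  rw [Finset.mul_sum, Finset.sum_div]
  refine Finset.sum_congr rfl fun j _ => ?_
  rw [← ee_nat_mul, ← ee_nat_mul]
  have : ((((j : ℤ) - (N : ℤ) : ℤ) : ℝ) * t) = N * (-t) + j * t := by push_cast; ring
  rw [this, ee_add]
  push_cast
  simp only [one_pow]
  ring

lemma in_geom_sum (r : ℕ) (hr : 0 < r) (a : ℤ) (Y : ℝ)
    (hY : (r : ℤ) ∣ a → ∃ q : ℤ, Y = q) :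
    ∑ k ∈ Finset.range r, ee (Y - k * (a / r)) = (((if (r : ℤ) ∣ a then (r : ℝ) else 0) : ℝ) : ℂ) := by
  have hr' : (r : ℝ) ≠ 0 := by positivity
  have h1 : ∀ k : ℕ, ee (Y - k * (a / r)) = ee Y * ee (-(a / r)) ^ k := by
    intro k
    rw [← ee_nat_mul, ← ee_add]; ring_nf
  simp only [h1]
  rw [← Finset.mul_sum]
  split_ifs with h
  · obtain ⟨q, hq⟩ := hY h
    obtain ⟨c, rfl⟩ := h
    have : (-((((r : ℤ) * c : ℤ) : ℝ) / r)) = ((-c : ℤ) : ℝ) := by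
      push_cast; field_simp
    rw [this, ee_int, hq, ee_int]; simp
  · have hne : ee (-((a : ℝ) / r)) ≠ 1 := by
      intro h2
      obtain ⟨n, hn⟩ := ee_eq_one h2
      apply h
      refine ⟨-n, ?_⟩
      have : (a : ℝ) = r * (-n) := by rw [← hn]; field_simp
      exact_mod_cast this
    rw [geom_sum_eq hne, ← ee_nat_mul]
    have : (r : ℝ) * (-((a : ℝ) / r)) = ((-a : ℤ) : ℝ) := by push_cast; field_simp
    rw [this, ee_int]; simp

lemma lower (N : ℕ) (r : ℕ) (hr : 0 < r) (b : Fin 5 → ℤ) (y : Fin 5 → ℝ)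
    (H : ∀ m : Fin 5 → ℤ, (∀ i, |m i| ≤ N) → (r : ℤ) ∣ ∑ i, m i * b i →
      ∃ q : ℤ, ∑ i, (m i : ℝ) * y i = q) :
    (r : ℝ) * (((2 * N).choose N : ℝ) / 4 ^ N) ^ 5 ≤
      ∑ k ∈ Finset.range r, ∏ i, (Real.cos (π * (y i - k * (b i / r))) ^ 2) ^ N := by
  set P := Fintype.piFinset (fun _ : Fin 5 => Finset.range (2 * N + 1)) with hP
  set co : (Fin 5 → ℕ) → ℝ := fun p => ∏ i, (((2 * N).choose (p i) : ℝ) / 4 ^ N) with hco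
  set va : (Fin 5 → ℕ) → ℝ := fun p =>
    if (r : ℤ) ∣ ∑ i, ((p i : ℤ) - (N : ℤ)) * b i then (r : ℝ) else 0 with hva
  have key : ∑ k ∈ Finset.range r, ∏ i, (Real.cos (π * (y i - k * (b i / r))) ^ 2) ^ N
      = ∑ p ∈ P, co p * va p := by
    apply Complex.ofReal_injective
    rw [Complex.ofReal_sum, Complex.ofReal_sum]
    simp only [Complex.ofReal_prod, h_expand, Finset.prod_univ_sum]
    rw [Finset.sum_comm]
    refine Finset.sum_congr rfl fun p hp => ?_
    have h2 := in_geom_sum r hr (∑ i, ((p i : ℤ) - (N : ℤ)) * b i)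
      (∑ i, (((p i : ℤ) - (N : ℤ) : ℤ) : ℝ) * y i) (H (fun i => (p i : ℤ) - N) (by
        intro i
        have := Fintype.mem_piFinset.1 hp i
        rw [Finset.mem_range] at this
        rw [abs_le]; constructor <;> omega))
    rw [Complex.ofReal_mul, hva, ← h2, hco, Finset.mul_sum]
    refine Finset.sum_congr rfl fun k _ => ?_
    rw [Finset.prod_mul_distrib, ← ee_sum, Complex.ofReal_prod]
    congr 2
    push_cast
    rw [Finset.sum_div, Finset.mul_sum, ← Finset.sum_sub_distrib]
    refine Finset.sum_congr rfl fun i _ => ?_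
    ring
  rw [key]
  have h0 : (fun _ => N : Fin 5 → ℕ) ∈ P := by
    rw [hP, Fintype.mem_piFinset]; intro i; rw [Finset.mem_range]; omega
  refine le_trans (le_of_eq ?_) (Finset.single_le_sum (f := fun p => co p * va p) ?_ h0)
  · simp only [hco, hva]; simp only [sub_self, zero_mul, Finset.sum_const_zero, dvd_zero, if_true, Finset.prod_const, Finset.card_univ, Fintype.card_fin]; ring
  · intro p _
    apply mul_nonneg
    · exact Finset.prod_nonneg fun i _ => by positivity
    · simp only [hva]; split_ifs <;> positivity

lemma exists_N (δ : ℝ) (hδ : 0 < δ) (hδ1 : δ ≤ 1) :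
    ∃ N : ℕ, 0 < N ∧ (1 - δ) ^ N < (((2 * N).choose N : ℝ) / 4 ^ N) ^ 5 := by
  have h := tendsto_pow_const_mul_const_pow_of_abs_lt_one 5
    (r := 1 - δ) (by rw [abs_lt]; constructor <;> linarith)
  have h2 := (h.eventually (gt_mem_nhds (show (0 : ℝ) < 1 / 32 by norm_num))).and
    (Filter.eventually_gt_atTop 0)
  obtain ⟨N, hN, hpos⟩ := h2.exists
  refine ⟨N, hpos, ?_⟩
  have hb : (4 : ℝ) ^ N ≤ 2 * N * ((2 * N).choose N) := by
    have := Nat.four_pow_le_two_mul_self_mul_centralBinom N hpos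
    rw [Nat.centralBinom] at this
    exact_mod_cast this
  have hNp : (0 : ℝ) < N := by exact_mod_cast hpos
  have h3 : 1 / (2 * (N : ℝ)) ≤ ((2 * N).choose N : ℝ) / 4 ^ N := by
    rw [div_le_div_iff₀ (by positivity) (by positivity)]; linarith
  have h4 := pow_le_pow_left₀ (by positivity) h3 5
  refine lt_of_lt_of_le ?_ h4
  rw [div_pow, lt_div_iff₀ (by positivity)]
  rw [mul_pow]; linarith

lemma kron (δ : ℝ) (hδ : 0 < δ) (hδ1 : δ ≤ 1) : ∃ N : ℕ, ∀ (r : ℕ), 0 < r → ∀ (b : Fin 5 → ℤ)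
    (y : Fin 5 → ℝ),
    (∀ m : Fin 5 → ℤ, (∀ i, |m i| ≤ N) → (r : ℤ) ∣ ∑ i, m i * b i →
      ∃ q : ℤ, ∑ i, (m i : ℝ) * y i = q) →
    ∃ k < r, ∀ i, 1 - δ < Real.cos (π * (y i - k * (b i / r))) ^ 2 := by
  obtain ⟨N, hN0, hN⟩ := exists_N δ hδ hδ1
  refine ⟨N, fun r hr b y H => ?_⟩
  by_contra hcon
  push Not at hcon
  have hl := lower N r hr b y H
  have hu : ∑ k ∈ Finset.range r, ∏ i, (Real.cos (π * (y i - k * (b i / r))) ^ 2) ^ N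
      ≤ ∑ k ∈ Finset.range r, (1 - δ) ^ N := by
    refine Finset.sum_le_sum fun k hk => ?_
    obtain ⟨i, hi⟩ := hcon k (Finset.mem_range.1 hk)
    rw [← Finset.mul_prod_erase _ _ (Finset.mem_univ i)]
    refine le_trans (mul_le_of_le_one_right (by positivity) ?_)
      (pow_le_pow_left₀ (by positivity) hi N)
    refine Finset.prod_le_one (fun _ _ => by positivity) fun j _ => ?_
    exact pow_le_one₀ (by positivity) (Real.cos_sq_le_one _)
  rw [Finset.sum_const, Finset.card_range, nsmul_eq_mul] at hu
  have hr' : (0 : ℝ) < r := by exact_mod_cast hr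
  have := le_of_mul_le_mul_left (hl.trans hu) hr'
  linarith

/-- least positive representative -/
noncomputable def cc (t : ℝ) : ℝ := 1 - Int.fract (-t)

lemma cc_pos (t : ℝ) : 0 < cc t := by
  unfold cc; linarith [Int.fract_lt_one (-t)]

lemma cc_le {t s : ℝ} (hs : 0 < s) (n : ℤ) (h : t = s + n) : cc t ≤ s := by
  unfold cc
  have : Int.fract (-t) = Int.fract (-s) := by
    rw [h, Int.fract_eq_fract]; exact ⟨-n, by push_cast; ring⟩
  rw [this]
  by_contra hc
  push Not at hc
  have h1 : ⌊-s⌋ < 0 := by rw [Int.floor_lt]; push_cast; linarith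
  have h2 : ⌊-s⌋ ≤ -1 := by omega
  have h3 : (⌊-s⌋ : ℝ) ≤ -1 := by exact_mod_cast h2
  have := Int.self_sub_floor (-s)
  linarith

lemma cc_congr (t : ℝ) : ∃ n : ℤ, t = cc t + n := by
  refine ⟨-⌊-t⌋ - 1, ?_⟩
  unfold cc
  have := Int.self_sub_floor (-t)
  push_cast; linarith

lemma cc_res (r : ℤ) (hr : 0 < r) (a : ℤ) :
    (if res r a ≠ 0 then ((res r a : ℤ) : ℝ) / (r : ℝ) else 1) = cc (a / r) := by
  have hr' : (0 : ℝ) < r := by exact_mod_cast hr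
  have hdiv : (a : ℝ) = r * (a / r : ℤ) + (res r a : ℤ) := by
    unfold res; exact_mod_cast (Int.mul_ediv_add_emod a r).symm
  have h0 : 0 ≤ res r a := Int.emod_nonneg _ hr.ne'
  have h1 : res r a < r := Int.emod_lt_of_pos _ hr
  obtain ⟨n, hn⟩ := cc_congr ((a : ℝ) / r)
  have hlow := cc_pos ((a : ℝ) / r)
  have hhi : cc ((a : ℝ) / r) ≤ 1 := by unfold cc; linarith [Int.fract_nonneg (-((a : ℝ) / r))]
  have hq : (a : ℝ) / r = (a / r : ℤ) + (res r a : ℤ) / (r : ℝ) := by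
    rw [hdiv]; field_simp
  have h1' : ((res r a : ℤ) : ℝ) / r < 1 := by
    rw [div_lt_one hr']; exact_mod_cast h1
  split_ifs with h
  · have hp : 0 < ((res r a : ℤ) : ℝ) / r := by
      apply div_pos _ hr'; exact_mod_cast lt_of_le_of_ne h0 (Ne.symm h)
    rw [hq] at hn hlow hhi ⊢
    set z := ((res r a : ℤ) : ℝ) / r
    have e : (((a / r - n : ℤ)) : ℝ) = cc (((a / r : ℤ) : ℝ) + z) - z := by push_cast; linarith
    have l1 : (-1 : ℝ) < ((a / r - n : ℤ) : ℝ) := by rw [e]; linarith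
    have l2 : ((a / r - n : ℤ) : ℝ) < 1 := by rw [e]; linarith
    have : a / r - n = 0 := by
      have : -1 < a / r - n := by exact_mod_cast l1
      have : a / r - n < 1 := by exact_mod_cast l2
      omega
    rw [this] at e
    push_cast at e; linarith
  · push Not at h
    rw [hq, h]
    have e : Int.fract (-(((a / r : ℤ)) : ℝ)) = 0 := by
      rw [← Int.cast_neg, Int.fract_intCast]
    simp [cc, e]

lemma usc (s ε : ℝ) (t : ℝ) (hε : 0 < ε) (hc : ε < cc s)
    (h : 1 - 4 * ε ^ 2 < Real.cos (π * (s - t)) ^ 2) : cc t ≤ cc s + ε := by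
  obtain ⟨n, hn⟩ := cc_congr s
  set d := s - t with hd
  set d' := d - round d with hd'
  have hab : |d'| ≤ 1 / 2 := abs_sub_round d
  have hc2 : Real.cos (π * d) ^ 2 = 1 - Real.sin (π * |d'|) ^ 2 := by
    rw [← Real.cos_sq']
    have e : Real.cos (π * |d'|) = Real.cos (π * d') := by
      rw [← Real.cos_abs (π * d'), abs_mul, abs_of_pos Real.pi_pos]
    rw [e]
    have e2 : π * d' = π * d - (round d : ℤ) * π := by rw [hd']; ring
    rw [e2, Real.cos_sub_int_mul_pi, mul_pow]
    rw [← abs_sq ((-1 : ℝ) ^ round d)]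
    simp
  have hsin : 2 / π * (π * |d'|) ≤ Real.sin (π * |d'|) :=
    Real.mul_le_sin (by positivity) (by nlinarith [Real.pi_pos])
  have e3 : 2 / π * (π * |d'|) = 2 * |d'| := by field_simp
  rw [e3] at hsin
  have hs2 : (2 * |d'|) ^ 2 < (2 * ε) ^ 2 := by
    have := pow_le_pow_left₀ (by positivity) hsin 2
    rw [hc2] at h
    nlinarith
  have hlt : |d'| < ε := by
    have := lt_of_pow_lt_pow_left₀ 2 (by positivity) hs2
    linarith
  rw [abs_lt] at hlt
  have := cc_le (t := t) (s := cc s - d') (by linarith) (n - round d) (by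
    push_cast; rw [hd']; linarith)
  linarith

lemma core_s3 (r : ℕ → ℕ) (hr : ∀ n, 0 < r n) (b : ℕ → Fin 5 → ℤ) (M : ℕ → ℝ) (j : ℕ → ℤ)
    (hM1 : ∀ n : ℕ, 2 - 1 / ((n : ℝ) + 1) < M n) (hM2 : ∀ n, M n < 2)
    (hM : ∀ n, M n = ∑ i, cc (((b n i * j n : ℤ) : ℝ) / r n))
    (hmin : ∀ n, ∀ k : ℕ, k < r n → M n ≤ ∑ i, cc (k * ((b n i : ℝ) / r n))) : False := by
  set U : Ultrafilter ℕ := Filter.hyperfilter ℕ with hU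
  let H : Submodule ℤ (Fin 5 → ℤ) :=
    { carrier := {m | ∀ᶠ n in U, (r n : ℤ) ∣ ∑ i, m i * b n i}
      add_mem' := by
        intro x y hx hy
        filter_upwards [hx, hy] with n h1 h2
        have := dvd_add h1 h2
        rw [← Finset.sum_add_distrib] at this
        simpa [add_mul] using this
      zero_mem' := by simp
      smul_mem' := by
        intro c x hx
        filter_upwards [hx] with n h1
        have := Dvd.dvd.mul_left h1 c
        rw [Finset.mul_sum] at this
        simpa [mul_assoc] using this }
  have hfg : H.FG := IsNoetherian.noetherian H
  obtain ⟨F, hF⟩ := hfg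
  have hA : ∀ᶠ n in U, ∀ m ∈ F, (r n : ℤ) ∣ ∑ i, m i * b n i := by
    rw [Filter.eventually_all_finset]
    intro m hm
    have : m ∈ H := by rw [← hF]; exact Submodule.subset_span hm
    exact this
  obtain ⟨n0, hn0⟩ := hA.exists
  have hH : ∀ m ∈ H, (r n0 : ℤ) ∣ ∑ i, m i * b n0 i := by
    intro m hm
    rw [← hF] at hm
    induction hm using Submodule.span_induction with
    | mem x hx => exact hn0 x hx
    | zero => simp
    | add x y _ _ h1 h2 =>
      have := dvd_add h1 h2
      rw [← Finset.sum_add_distrib] at this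
      simpa [add_mul] using this
    | smul c x _ h1 =>
      have := Dvd.dvd.mul_left h1 c
      rw [Finset.mul_sum] at this
      simpa [mul_assoc] using this
  set y : Fin 5 → ℝ := fun i => ((b n0 i * j n0 : ℤ) : ℝ) / r n0 with hy
  have hMy : M n0 = ∑ i, cc (y i) := hM n0
  -- choose ε
  obtain ⟨ε, hε, hε1, hε2, hε3⟩ : ∃ ε : ℝ, 0 < ε ∧ 4 * ε ^ 2 ≤ 1 ∧ M n0 + 5 * ε < 2 ∧
      ∀ i, ε < cc (y i) := by
    have h1 : ∀ᶠ ε in nhdsWithin (0 : ℝ) (Set.Ioi 0), ∀ i, ε < cc (y i) := by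
      rw [Filter.eventually_all]
      intro i
      exact nhdsWithin_le_nhds (gt_mem_nhds (cc_pos _))
    have h2 : ∀ᶠ ε in nhdsWithin (0 : ℝ) (Set.Ioi 0), ε < 1 / 2 :=
      nhdsWithin_le_nhds (gt_mem_nhds (by norm_num))
    have h3 : ∀ᶠ ε in nhdsWithin (0 : ℝ) (Set.Ioi 0), ε < (2 - M n0) / 5 :=
      nhdsWithin_le_nhds (gt_mem_nhds (by linarith [hM2 n0]))
    have h4 : ∀ᶠ ε in nhdsWithin (0 : ℝ) (Set.Ioi 0), 0 < ε := self_mem_nhdsWithin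
    obtain ⟨ε, a1, a2, a3, a4⟩ := (h1.and (h2.and (h3.and h4))).exists
    exact ⟨ε, a4, by nlinarith, by linarith, a1⟩
  obtain ⟨N, hN⟩ := kron (4 * ε ^ 2) (by positivity) hε1
  set B : Set (Fin 5 → ℤ) := Set.Icc (fun _ => -(N : ℤ)) (fun _ => (N : ℤ)) with hB
  have hBfin : B.Finite := Set.finite_Icc _ _
  have ev1 : ∀ᶠ n in U, ∀ m ∈ B, (r n : ℤ) ∣ ∑ i, m i * b n i → m ∈ H := by
    refine (Filter.eventually_all_finite hBfin).2 ?_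
    intro m _
    by_cases hm : m ∈ H
    · exact Filter.Eventually.of_forall fun _ _ => hm
    · have : ∀ᶠ n in U, ¬ (r n : ℤ) ∣ ∑ i, m i * b n i := by
        rw [Ultrafilter.eventually_not]; exact hm
      filter_upwards [this] with n h1 h2 using absurd h2 h1
  have ev2 : ∀ᶠ n in U, M n0 + 5 * ε < M n := by
    have hat : ∀ᶠ n : ℕ in Filter.atTop, 1 / ((n : ℝ) + 1) < 2 - (M n0 + 5 * ε) :=
      (tendsto_one_div_add_atTop_nhds_zero_nat (𝕜 := ℝ)).eventually
        (gt_mem_nhds (by linarith))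
    have := Nat.hyperfilter_le_atTop hat
    filter_upwards [this] with n h1
    linarith [hM1 n]
  obtain ⟨n, h1, h2⟩ := (ev1.and ev2).exists
  obtain ⟨k, hk, hk2⟩ := hN (r n) (hr n) (b n) y (by
    intro m hm hd
    have hmB : m ∈ B := ⟨fun i => (abs_le.1 (hm i)).1, fun i => (abs_le.1 (hm i)).2⟩
    obtain ⟨q, hq⟩ := hH m (h1 m hmB hd)
    refine ⟨q * j n0, ?_⟩
    have hr0 : (r n0 : ℝ) ≠ 0 := by exact_mod_cast (hr n0).ne'
    have hq' : ∑ i, (m i : ℝ) * b n0 i = r n0 * q := by exact_mod_cast hq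
    have : ∑ i, (m i : ℝ) * y i = (∑ i, (m i : ℝ) * b n0 i) * (j n0 / r n0) := by
      rw [Finset.sum_mul]
      refine Finset.sum_congr rfl fun i _ => ?_
      rw [hy]; push_cast; ring
    rw [this, hq']; push_cast; field_simp)
  have h3 := hmin n k hk
  have h4 : ∑ i, cc (k * ((b n i : ℝ) / r n)) ≤ ∑ i : Fin 5, (cc (y i) + ε) :=
    Finset.sum_le_sum fun i _ => usc _ ε _ hε (hε3 i) (hk2 i)
  rw [Finset.sum_add_distrib, ← hMy] at h4
  simp at h4
  linarith

/-- Gap below `2` for minimal log discrepancies of (not necessarily isolated)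
five-dimensional cyclic quotient singularities of type `(1/r)(b1, …, b5)`. -/
theorem gap_dim5_cyclic_quotient :
    ∃ δ5 : ℝ, 0 < δ5 ∧
      ∀ r : ℤ, 0 < r → ∀ b : Fin 5 → ℤ,
        Int.gcd (Finset.univ.gcd b) r = 1 →
        (∀ j : ℤ, 1 ≤ j → j ≤ r - 1 →
          ∃ i i' : Fin 5, i ≠ i' ∧ res r (b i * j) ≠ 0 ∧ res r (b i' * j) ≠ 0) →
        ∀ M : ℝ,
          IsLeast {x : ℝ | ∃ j : ℤ, 0 ≤ j ∧ j ≤ r - 1 ∧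
            x = ∑ i : Fin 5,
              (if res r (b i * j) ≠ 0 then ((res r (b i * j) : ℤ) : ℝ) / (r : ℝ) else 1)} M →
          M < 2 → M ≤ 2 - δ5 := by
  by_contra hcon
  push Not at hcon
  have h : ∀ n : ℕ, ∃ (r : ℕ) (b : Fin 5 → ℤ) (M : ℝ) (j : ℤ), 0 < r ∧
      2 - 1 / ((n : ℝ) + 1) < M ∧ M < 2 ∧ M = ∑ i, cc (((b i * j : ℤ) : ℝ) / r) ∧
      ∀ k : ℕ, k < r → M ≤ ∑ i, cc (k * ((b i : ℝ) / r)) := by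
    intro n
    obtain ⟨r, hr, b, -, -, M, hM, hM2, hM1⟩ := hcon (1 / ((n : ℝ) + 1)) (by positivity)
    obtain ⟨⟨j, -, -, hj⟩, hle⟩ := hM
    lift r to ℕ using hr.le
    simp only [cc_res _ hr] at hj
    refine ⟨r, b, M, j, by exact_mod_cast hr, hM1, hM2, by simpa using hj, ?_⟩
    intro k hk
    apply hle
    refine ⟨k, by positivity, by omega, ?_⟩
    simp only [cc_res _ hr]
    refine Finset.sum_congr rfl fun i _ => ?_
    congr 1
    push_cast; ring
  choose r b M j h1 h2 h3 h4 h5 using h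
  exact core_s3 r h1 b M j h2 h3 h4 h5
end

section
/- There exists a real constant $\delta_0$ with $0<\delta_0<1$ with the following property. Let $r$ be a positive integer and $a_1,a_2,a_3,a_4,e$ integers such that $q:=\gcd(e,r)=\gcd(a_4,r)$ and $a_1,a_2,a_3$ are each coprime to $r$. Assume one of the following holds: (☆1) $a_1+a_2\equiv e \pmod r$; (☆2) $2a_4\equiv e \pmod r$; (☆3) $2a_1\equiv e \pmod r$ and $q\leq 2$. Assume moreover that (1) there exists an integer $k_0$ with $1\leq k_0\leq r-1$ and $\sum_{i=1}^{4}\overline{a_ik_0}=\overline{ek_0}+k_0$, and (2) for every integer $k$ with $1\leq k\leq r-1$ and $k\neq k_0$ one has $\sum_{i=1}^{4}\overline{a_ik}\geq \overline{ek}+r$. Then $\frac{k_0}{r}\leq 1-\delta_0$. -/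
open Filter Topology

lemma ncl_char_add {d : Type*} [Fintype d] (m : d → ℤ) (x y : UnitAddTorus d) :
    UnitAddTorus.mFourier m (x + y) = UnitAddTorus.mFourier m x * UnitAddTorus.mFourier m y := by
  simp [UnitAddTorus.mFourier, fourier_apply, smul_add, AddCircle.toCircle_add,
    Finset.prod_mul_distrib]

lemma ncl_sum_char {d : Type*} [Fintype d] (m : d → ℤ) (G : AddSubgroup (UnitAddTorus d))
    [Fintype G] (x : UnitAddTorus d)
    (hx : (∀ y ∈ G, UnitAddTorus.mFourier m y = 1) → UnitAddTorus.mFourier m x = 1) :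
    ∑ y : G, UnitAddTorus.mFourier m ((y : UnitAddTorus d) + x)
      = ∑ y : G, UnitAddTorus.mFourier m (y : UnitAddTorus d) := by
  simp_rw [ncl_char_add]
  rw [← Finset.sum_mul]
  by_cases h : ∀ y ∈ G, UnitAddTorus.mFourier m y = 1
  · rw [hx h, mul_one]
  · push Not at h
    obtain ⟨y0, hy0, hne⟩ := h
    have key : ∑ y : G, UnitAddTorus.mFourier m (y : UnitAddTorus d) = 0 := by
      have h1 : ∑ y : G, UnitAddTorus.mFourier m ((y : UnitAddTorus d) + y0)
          = ∑ y : G, UnitAddTorus.mFourier m (y : UnitAddTorus d) :=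
        Equiv.sum_comp (Equiv.addRight (⟨y0, hy0⟩ : G))
          (fun y : G => UnitAddTorus.mFourier m (y : UnitAddTorus d))
      simp_rw [ncl_char_add] at h1
      rw [← Finset.sum_mul] at h1
      by_contra h0
      exact hne (mul_left_cancel₀ h0 (by rw [h1, mul_one]))
    rw [key, zero_mul]

lemma ncl_pigeon {d : Type*} [Fintype d] (ε : ℝ) (hε : 0 < ε) :
    ∃ c : ℝ, 0 < c ∧ ∀ (G : AddSubgroup (UnitAddTorus d)) [Fintype G],
      c * (Fintype.card G : ℝ) ≤ ∑ y : G, max 0 (ε - ‖(y : UnitAddTorus d)‖) := by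
  classical
  obtain ⟨t0, -, ht0, hcov⟩ := finite_cover_balls_of_compact
    (isCompact_univ : IsCompact (Set.univ : Set (UnitAddTorus d))) (e := ε / 4) (by positivity)
  lift t0 to Finset (UnitAddTorus d) using ht0
  have hp : ∀ y : UnitAddTorus d, ∃ b ∈ t0, dist y b < ε / 4 := by
    intro y
    have := hcov (Set.mem_univ y)
    simpa using this
  choose p hpt hpd using hp
  have htne : t0.Nonempty := ⟨p 0, hpt 0⟩
  have hcard : (0 : ℝ) < t0.card := by exact_mod_cast htne.card_pos
  refine ⟨(ε / 2) / t0.card, by positivity, ?_⟩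
  intro G _
  obtain ⟨b, hb, hle⟩ := Finset.exists_le_card_fiber_of_nsmul_le_card_of_maps_to
    (s := (Finset.univ : Finset G)) (t := t0) (f := fun y : G => p y)
    (b := (Fintype.card G : ℝ) / t0.card) (fun y _ => hpt y) htne (by
      rw [nsmul_eq_mul, Finset.card_univ]; exact le_of_eq (by field_simp))
  have hGpos : (0 : ℝ) < Fintype.card G := by exact_mod_cast Fintype.card_pos
  set A := Finset.univ.filter (fun y : G => p y = b) with hA
  have hAne : A.Nonempty := by
    rw [← Finset.card_pos]
    have : (0 : ℝ) < A.card := lt_of_lt_of_le (by positivity) hle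
    exact_mod_cast this
  obtain ⟨y0, hy0⟩ := hAne
  have hb0 : p y0 = b := by simpa [hA] using hy0
  have hnear : ∀ y ∈ A, ‖((y - y0 : G) : UnitAddTorus d)‖ ≤ ε / 2 := by
    intro y hy
    have hyb : p y = b := by simpa [hA] using hy
    have h1 := hpd (y : UnitAddTorus d)
    have h2 := hpd (y0 : UnitAddTorus d)
    rw [hyb] at h1
    rw [hb0] at h2
    rw [AddSubgroup.coe_sub, ← dist_eq_norm]
    have := dist_triangle_right (y : UnitAddTorus d) y0 b
    linarith
  calc (ε / 2) / t0.card * (Fintype.card G : ℝ)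
      = ((Fintype.card G : ℝ) / t0.card) * (ε / 2) := by ring
    _ ≤ A.card * (ε / 2) := by gcongr
    _ = ∑ y ∈ A, ε / 2 := by simp
    _ ≤ ∑ y ∈ A, max 0 (ε - ‖((y - y0 : G) : UnitAddTorus d)‖) := by
        refine Finset.sum_le_sum fun y hy => ?_
        have := hnear y hy
        exact le_max_of_le_right (by linarith)
    _ ≤ ∑ y : G, max 0 (ε - ‖((y - y0 : G) : UnitAddTorus d)‖) :=
        Finset.sum_le_sum_of_subset_of_nonneg (Finset.subset_univ _)
          (fun _ _ _ => le_max_left _ _)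
    _ = ∑ y : G, max 0 (ε - ‖(y : UnitAddTorus d)‖) :=
        Equiv.sum_comp (Equiv.subRight y0)
          (fun y : G => max 0 (ε - ‖(y : UnitAddTorus d)‖))

/-- characters eventually trivial on the groups -/
def nclAnn {d : Type*} [Fintype d] (F : Filter ℕ) (G : ℕ → AddSubgroup (UnitAddTorus d)) :
    AddSubgroup (d → ℤ) where
  carrier := {m | ∀ᶠ j in F, ∀ y ∈ G j, UnitAddTorus.mFourier m y = 1}
  zero_mem' := by
    refine Eventually.of_forall fun j y _ => ?_
    simp [UnitAddTorus.mFourier_zero]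
  add_mem' := by
    intro a b ha hb
    filter_upwards [ha, hb] with j h1 h2 y hy
    rw [UnitAddTorus.mFourier_add, h1 y hy, h2 y hy, one_mul]
  neg_mem' := by
    intro a ha
    filter_upwards [ha] with j h1 y hy
    rw [UnitAddTorus.mFourier_neg, h1 y hy, map_one]

lemma ncl_ann_eventually {d : Type*} [Fintype d] (F : Filter ℕ)
    (G : ℕ → AddSubgroup (UnitAddTorus d)) :
    ∀ᶠ j in F, ∀ m ∈ nclAnn F G, ∀ y ∈ G j, UnitAddTorus.mFourier m y = 1 := by
  have hfg : (AddSubgroup.toIntSubmodule (nclAnn F G)).FG := IsNoetherian.noetherian _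
  obtain ⟨S, hS⟩ := hfg
  have h1 : ∀ᶠ j in F, ∀ m ∈ S, ∀ y ∈ G j, UnitAddTorus.mFourier m y = 1 := by
    rw [Filter.eventually_all_finset]
    intro m hm
    have : m ∈ AddSubgroup.toIntSubmodule (nclAnn F G) := by
      rw [← hS]; exact Submodule.subset_span hm
    exact this
  filter_upwards [h1] with j hj m hm y hy
  have hm' : m ∈ Submodule.span ℤ (S : Set (d → ℤ)) := by rw [hS]; exact hm
  clear hm
  rw [← Submodule.mem_toAddSubgroup, Submodule.span_int_eq_addSubgroupClosure] at hm'
  induction hm' using AddSubgroup.closure_induction with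
  | mem m hm => exact hj m hm y hy
  | zero => simp [UnitAddTorus.mFourier_zero]
  | add a b _ _ ha hb => rw [UnitAddTorus.mFourier_add, ha, hb, one_mul]
  | neg a _ ha => rw [UnitAddTorus.mFourier_neg, ha, map_one]

lemma ncl_dense {d : Type*} [Fintype d] (F : Ultrafilter ℕ)
    (G : ℕ → AddSubgroup (UnitAddTorus d)) (hG : ∀ j, Finite (G j)) (x : UnitAddTorus d)
    (hx : ∀ m ∈ nclAnn (F : Filter ℕ) G, UnitAddTorus.mFourier m x = 1) (ε : ℝ) (hε : 0 < ε) :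
    ∀ᶠ i in (F : Filter ℕ), ∃ y ∈ G i, dist y x < ε := by
  classical
  have : ∀ j, Fintype (G j) := fun j => Fintype.ofFinite _
  have hxn : ∀ m ∈ nclAnn (F : Filter ℕ) G, UnitAddTorus.mFourier m (-x) = 1 := by
    intro m hm
    have h := ncl_char_add m x (-x)
    rw [hx m hm, one_mul, add_neg_cancel] at h
    rw [← h]
    simp [UnitAddTorus.mFourier]
  obtain ⟨c, hc, hpig⟩ := ncl_pigeon (d := d) ε hε
  let f : C(UnitAddTorus d, ℂ) := ⟨fun y => ((max 0 (ε - ‖y‖) : ℝ) : ℂ), by fun_prop⟩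
  have hf : ∀ y, f y = ((max 0 (ε - ‖y‖) : ℝ) : ℂ) := fun y => rfl
  have hmem : f ∈ closure ((Submodule.span ℂ (Set.range (UnitAddTorus.mFourier (d := d))) :
      Submodule ℂ C(UnitAddTorus d, ℂ)) : Set C(UnitAddTorus d, ℂ)) := by
    rw [← Submodule.topologicalClosure_coe, UnitAddTorus.span_mFourier_closure_eq_top]
    trivial
  obtain ⟨p, hp, hfp⟩ := Metric.mem_closure_iff.1 hmem (c / 4) (by positivity)
  have happ : ∀ y, ‖f y - p y‖ ≤ c / 4 := by
    intro y
    rw [← dist_eq_norm]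
    exact (ContinuousMap.dist_apply_le_dist y).trans hfp.le
  have hinv : ∀ᶠ i in (F : Filter ℕ),
      ∑ y : G i, p ((y : UnitAddTorus d) + (-x)) = ∑ y : G i, p (y : UnitAddTorus d) := by
    clear happ hfp
    induction hp using Submodule.span_induction with
    | mem q hq =>
      obtain ⟨m, rfl⟩ := hq
      by_cases hm : m ∈ nclAnn (F : Filter ℕ) G
      · exact Eventually.of_forall fun i => ncl_sum_char m (G i) (-x) (fun _ => hxn m hm)
      · have : ∀ᶠ i in (F : Filter ℕ), ¬ ∀ y ∈ G i, UnitAddTorus.mFourier m y = 1 :=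
          Ultrafilter.eventually_not.2 hm
        filter_upwards [this] with i hi
        exact ncl_sum_char m (G i) (-x) (fun h => absurd h hi)
    | zero => simp
    | add a b _ _ ha hb =>
      filter_upwards [ha, hb] with i h1 h2
      simp only [ContinuousMap.add_apply, Finset.sum_add_distrib, h1, h2]
    | smul k a _ ha =>
      filter_upwards [ha] with i h1
      simp only [ContinuousMap.smul_apply, ← Finset.smul_sum, h1]
  filter_upwards [hinv] with i hi
  by_contra hno
  push Not at hno
  have hzero : ∑ y : G i, f ((y : UnitAddTorus d) + (-x)) = 0 := by
    refine Finset.sum_eq_zero fun y _ => ?_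
    have h := hno y y.2
    rw [dist_eq_norm] at h
    rw [hf, ← sub_eq_add_neg, max_eq_left (by linarith)]
    simp
  have hGpos : (0 : ℝ) < Fintype.card (G i) := by exact_mod_cast Fintype.card_pos
  have hb : ∀ z : UnitAddTorus d,
      ‖∑ y : G i, f ((y : UnitAddTorus d) + z) - ∑ y : G i, p ((y : UnitAddTorus d) + z)‖
        ≤ Fintype.card (G i) * (c / 4) := by
    intro z
    rw [← Finset.sum_sub_distrib]
    refine (norm_sum_le _ _).trans ?_
    refine (Finset.sum_le_card_nsmul _ _ (c / 4) (fun y _ => happ _)).trans ?_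
    simp
  have h1 := hb (-x)
  have h2 := hb 0
  simp only [add_zero] at h2
  rw [hzero, hi, zero_sub, norm_neg] at h1
  have h3 : ‖∑ y : G i, f (y : UnitAddTorus d)‖ ≤ Fintype.card (G i) * (c / 2) := by
    have := norm_sub_norm_le (∑ y : G i, f (y : UnitAddTorus d)) (∑ y : G i, p (y : UnitAddTorus d))
    linarith
  have h4 := hpig (G i)
  have h5 : ∑ y : G i, f (y : UnitAddTorus d)
      = ((∑ y : G i, max 0 (ε - ‖(y : UnitAddTorus d)‖) : ℝ) : ℂ) := by
    simp only [hf, Complex.ofReal_sum]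
  rw [h5, Complex.norm_real] at h3
  have h6 := (le_abs_self _).trans h3
  nlinarith

/-- sum of fractional parts -/
noncomputable def nclPhi {d : Type*} [Fintype d] (x : UnitAddTorus d) : ℝ :=
  ∑ i, ((AddCircle.equivIco (1 : ℝ) 0 (x i) : Set.Ico (0 : ℝ) (0 + 1)) : ℝ)

lemma nclPhi_cont {d : Type*} [Fintype d] (x : UnitAddTorus d) (hx : ∀ i, x i ≠ 0) :
    ContinuousAt nclPhi x := by
  unfold nclPhi
  refine tendsto_finsetSum _ fun i _ => ?_
  have h : ContinuousAt (AddCircle.equivIco (1 : ℝ) 0) (x i) :=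
    AddCircle.continuousAt_equivIco 1 0 (by simpa using hx i)
  have h2 : ContinuousAt (fun y : UnitAddTorus d => y i) x := continuousAt_apply i x
  exact (continuous_subtype_val.continuousAt.comp (ContinuousAt.comp (f := fun y : UnitAddTorus d => y i) h h2))

theorem ncl_gap (d : Type*) [Fintype d] (c : ℝ) :
    ∃ δ : ℝ, 0 < δ ∧ ∀ (G : AddSubgroup (UnitAddTorus d)), Finite G → ∀ x ∈ G,
      (∀ i, x i ≠ 0) → nclPhi x < c →
      (∀ y ∈ G, (∀ i, y i ≠ 0) → nclPhi x ≤ nclPhi y) → nclPhi x ≤ c - δ := by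
  by_contra hcon
  push Not at hcon
  have hseq : ∀ n : ℕ, (0 : ℝ) < 1 / ((n : ℝ) + 1) := fun n => by positivity
  choose G hfin x hxG hx0 hxc hmin hxd using fun n : ℕ => hcon _ (hseq n)
  let F : Ultrafilter ℕ := hyperfilter ℕ
  obtain ⟨j, hj⟩ := (ncl_ann_eventually (F : Filter ℕ) G).exists
  have hopen : ∀ᶠ y in 𝓝 (x j), (∀ i, y i ≠ 0) ∧ nclPhi y < (c + nclPhi (x j)) / 2 := by
    refine Eventually.and ?_ ?_
    · rw [Filter.eventually_all]
      intro i
      exact (continuousAt_apply i (x j)).eventually_ne (hx0 j i)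
    · exact (nclPhi_cont _ (hx0 j)).eventually_lt_const (by have := hxc j; linarith)
  obtain ⟨ε, hε, hball⟩ := Metric.eventually_nhds_iff.1 hopen
  have hd := ncl_dense F G hfin (x j) (fun m hm => hj m hm _ (hxG j)) ε hε
  have hlim : ∀ᶠ n : ℕ in (F : Filter ℕ), 1 / ((n : ℝ) + 1) < (c - nclPhi (x j)) / 2 := by
    have h0 : Tendsto (fun n : ℕ => 1 / ((n : ℝ) + 1)) atTop (𝓝 0) :=
      tendsto_one_div_add_atTop_nhds_zero_nat
    have h1 := h0.eventually_lt_const (u := (c - nclPhi (x j)) / 2)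
      (by have := hxc j; linarith)
    exact (Nat.hyperfilter_le_atTop) h1
  obtain ⟨i, ⟨y, hy, hyd⟩, hi⟩ := (hd.and hlim).exists
  obtain ⟨hy0, hylt⟩ := hball hyd
  have h1 := hmin i y hy hy0
  have h2 := hxd i
  linarith

/-- the homomorphism `k ↦ (a_i k / r)` -/
noncomputable def nclHom {d : Type*} [Fintype d] (r : ℤ) (a : d → ℤ) : ℤ →+ UnitAddTorus d where
  toFun k := fun i => (((a i * k : ℤ) : ℝ) / (r : ℝ) : ℝ)
  map_zero' := by ext i; simp
  map_add' := by
    intro k l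
    ext i
    rw [Pi.add_apply, ← AddCircle.coe_add]
    congr 1
    push_cast
    ring

lemma ncl_equiv (r : ℤ) (hr : 0 < r) (n : ℤ) :
    ((AddCircle.equivIco (1 : ℝ) 0 (((n : ℝ) / (r : ℝ) : ℝ) : UnitAddCircle) :
      Set.Ico (0 : ℝ) (0 + 1)) : ℝ) = (res r n : ℝ) / r := by
  have hr' : (0 : ℝ) < r := by exact_mod_cast hr
  have h1 : (((n : ℝ) / (r : ℝ) : ℝ) : UnitAddCircle) = (((res r n : ℝ) / r : ℝ) : UnitAddCircle) := by
    rw [← sub_eq_zero, ← AddCircle.coe_sub, AddCircle.coe_eq_zero_iff]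
    refine ⟨n / r, ?_⟩
    have := Int.emod_add_mul_ediv n r
    have h2 : (n : ℝ) = (res r n : ℝ) + r * ((n / r : ℤ) : ℝ) := by
      unfold res; exact_mod_cast this.symm
    rw [zsmul_eq_mul, mul_one]
    field_simp
    linarith
  rw [h1]
  have h0 : (0 : ℝ) ≤ res r n := by exact_mod_cast Int.emod_nonneg n hr.ne'
  have h2 : (res r n : ℝ) < r := by exact_mod_cast Int.emod_lt_of_pos n hr
  refine AddCircle.equivIco_coe_of_mem (p := (1 : ℝ)) (a := 0) ⟨by positivity, ?_⟩
  rw [zero_add, div_lt_one hr']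
  exact h2

lemma ncl_eq_zero (r : ℤ) (hr : 0 < r) (n : ℤ) :
    (((n : ℝ) / (r : ℝ) : ℝ) : UnitAddCircle) = 0 ↔ r ∣ n := by
  have hr' : (0 : ℝ) < r := by exact_mod_cast hr
  rw [AddCircle.coe_eq_zero_iff]
  constructor
  · rintro ⟨k, hk⟩
    rw [zsmul_eq_mul, mul_one, eq_div_iff hr'.ne'] at hk
    exact ⟨k, by have : k * r = n := by exact_mod_cast hk
                 rw [← this]; ring⟩
  · rintro ⟨k, rfl⟩
    refine ⟨k, ?_⟩
    push_cast
    field_simp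
    simp

lemma nclPhi_hom {d : Type*} [Fintype d] (r : ℤ) (hr : 0 < r) (a : d → ℤ) (k : ℤ) :
    nclPhi (nclHom r a k) = ((∑ i, res r (a i * k) : ℤ) : ℝ) / r := by
  unfold nclPhi
  push_cast
  rw [Finset.sum_div]
  exact Finset.sum_congr rfl fun i _ => ncl_equiv r hr (a i * k)

lemma ncl_hom_ne {d : Type*} [Fintype d] (r : ℤ) (hr : 0 < r) (a : d → ℤ) (k : ℤ) (i : d) :
    nclHom r a k i ≠ 0 ↔ ¬ r ∣ a i * k :=
  (ncl_eq_zero r hr (a i * k)).not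

lemma ncl_hom_mod {d : Type*} [Fintype d] (r : ℤ) (hr : 0 < r) (a : d → ℤ) (k : ℤ) :
    nclHom r a (k % r) = nclHom r a k := by
  rw [eq_comm, ← sub_eq_zero, ← map_sub]
  ext i
  refine (ncl_eq_zero r hr _).2 (Dvd.dvd.mul_left ?_ _)
  exact Int.dvd_self_sub_emod

/-- arithmetic form of the gap -/
theorem ncl_gap' (d : Type*) [Fintype d] [Nonempty d] (c : ℤ) :
    ∃ δ : ℝ, 0 < δ ∧ ∀ (r : ℤ), 0 < r → ∀ (a : d → ℤ) (K : AddSubgroup ℤ), r ∈ K → ∀ k0 ∈ K,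
      (∀ i, ¬ r ∣ a i * k0) → ∑ i, res r (a i * k0) < c * r →
      (∀ k ∈ K, 1 ≤ k → k ≤ r - 1 → k ≠ k0 → (∀ i, ¬ r ∣ a i * k) →
        c * r ≤ ∑ i, res r (a i * k)) →
      ((∑ i, res r (a i * k0) : ℤ) : ℝ) / r ≤ c - δ := by
  obtain ⟨δ, hδ, h⟩ := ncl_gap d (c : ℝ)
  refine ⟨δ, hδ, ?_⟩
  intro r hr a K hrK k0 hk0 hne hlt hmin
  have hr' : (0 : ℝ) < r := by exact_mod_cast hr
  have hltR : ((∑ i, res r (a i * k0) : ℤ) : ℝ) < c * r := by exact_mod_cast hlt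
  rw [← nclPhi_hom r hr]
  refine h (K.map (nclHom r a)) ?_ _ ⟨k0, hk0, rfl⟩ (fun i => (ncl_hom_ne r hr a k0 i).2 (hne i)) ?_ ?_
  · have hs : ((K.map (nclHom r a) : AddSubgroup _) : Set (UnitAddTorus d))
        ⊆ (nclHom r a) '' (Set.Ico 0 r) := by
      rintro _ ⟨k, hk, rfl⟩
      exact ⟨k % r, ⟨Int.emod_nonneg _ hr.ne', Int.emod_lt_of_pos _ hr⟩, ncl_hom_mod r hr a k⟩
    exact (((Set.finite_Ico 0 r).image _).subset hs).to_subtype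
  · rw [nclPhi_hom r hr, div_lt_iff₀ hr']
    exact hltR
  · rintro _ ⟨k, hk, rfl⟩ hy
    rw [← ncl_hom_mod r hr a k] at hy ⊢
    have hkK : k % r ∈ K := by
      rw [Int.emod_def, mul_comm]
      exact K.sub_mem hk (by simpa using K.zsmul_mem hrK (k / r))
    generalize hl : k % r = l at *
    have hl0 : 0 ≤ l := hl ▸ Int.emod_nonneg _ hr.ne'
    have hl1 : l < r := hl ▸ Int.emod_lt_of_pos _ hr
    have hy' := fun i => (ncl_hom_ne r hr a l i).1 (hy i)
    by_cases hlk : l = k0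
    · rw [hlk]
    · have hlne : l ≠ 0 := by
        rintro rfl
        exact hy' (Classical.arbitrary d) (by simp)
      have h1 := hmin l hkK (by omega) (by omega) hlk hy'
      rw [nclPhi_hom r hr, nclPhi_hom r hr]
      have h2 := (hlt.trans_le h1).le
      exact div_le_div_of_nonneg_right (by exact_mod_cast h2) hr'.le

lemma ncl_dvd_of_gcd (r a e k : ℤ) (h : Int.gcd e r = Int.gcd a r) (hd : r ∣ e * k) :
    r ∣ a * k := by
  have h1 : r ∣ (Int.gcd e r : ℤ) * k := by
    rw [Int.gcd_eq_gcd_ab, add_mul]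
    refine dvd_add ?_ ⟨Int.gcdB e r * k, by ring⟩
    have : e * Int.gcdA e r * k = (e * k) * Int.gcdA e r := by ring
    rw [this]
    exact hd.mul_right _
  rw [h] at h1
  exact h1.trans (mul_dvd_mul_right (Int.gcd_dvd_left ..) k)

lemma ncl_ndvd (r a k : ℤ) (h : Int.gcd a r = 1) (h1 : 1 ≤ k) (h2 : k ≤ r - 1) : ¬ r ∣ a * k := by
  intro hd
  have hc : IsCoprime r a := (Int.isCoprime_iff_gcd_eq_one.2 h).symm
  have := Int.le_of_dvd (by omega) (hc.dvd_of_dvd_mul_left hd)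
  omega

lemma ncl_res_neg (r n : ℤ) (hr : 0 < r) (h : ¬ r ∣ n) : res r (-n) = r - res r n := by
  unfold res
  have h3 : -n = (r - n % r) + r * (-(n / r) - 1) := by
    have := Int.emod_add_mul_ediv n r
    linarith
  have h4 : n % r ≠ 0 := fun h0 => h (Int.dvd_of_emod_eq_zero h0)
  have h5 := Int.emod_nonneg n hr.ne'
  have h6 := Int.emod_lt_of_pos n hr
  rw [h3, Int.add_mul_emod_self_left]
  exact Int.emod_eq_of_lt (by omega) (by omega)

/-- The "non-canonical lemma" for 5-tuples `(1/r)(a1, a2, a3, a4; e)`. -/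
theorem non_canonical_lemma :
    ∃ δ0 : ℝ, 0 < δ0 ∧ δ0 < 1 ∧
      ∀ r a1 a2 a3 a4 e k0 : ℤ, 0 < r →
        Int.gcd e r = Int.gcd a4 r →
        Int.gcd a1 r = 1 → Int.gcd a2 r = 1 → Int.gcd a3 r = 1 →
        (Int.ModEq r (a1 + a2) e ∨ Int.ModEq r (2 * a4) e ∨
          (Int.ModEq r (2 * a1) e ∧ Int.gcd e r ≤ 2)) →
        1 ≤ k0 → k0 ≤ r - 1 →
        res r (a1 * k0) + res r (a2 * k0) + res r (a3 * k0) + res r (a4 * k0)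
          = res r (e * k0) + k0 →
        (∀ k : ℤ, 1 ≤ k → k ≤ r - 1 → k ≠ k0 →
          res r (e * k) + r ≤
            res r (a1 * k) + res r (a2 * k) + res r (a3 * k) + res r (a4 * k)) →
        (k0 : ℝ) / (r : ℝ) ≤ 1 - δ0 := by
  obtain ⟨δ5, h5pos, h5⟩ := ncl_gap' (Fin 5) 2
  obtain ⟨δ3, h3pos, h3⟩ := ncl_gap' (Fin 3) 1
  refine ⟨min (1 / 2) (min δ5 δ3), by positivity,
    lt_of_le_of_lt (min_le_left _ _) (by norm_num), ?_⟩
  intro r a1 a2 a3 a4 e k0 hr hq h1 h2 h3' _ hk1 hk2 heq hmin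
  have hr' : (0 : ℝ) < r := by exact_mod_cast hr
  have hle5 : min (1 / 2) (min δ5 δ3) ≤ δ5 := (min_le_right _ _).trans (min_le_left _ _)
  have hle3 : min (1 / 2) (min δ5 δ3) ≤ δ3 := (min_le_right _ _).trans (min_le_right _ _)
  have hres0 : ∀ n, r ∣ n → res r n = 0 := fun n hn => Int.emod_eq_zero_of_dvd hn
  by_cases hd : r ∣ e * k0
  · let K : AddSubgroup ℤ := (AddSubgroup.zmultiples r).comap (AddMonoidHom.mulLeft e)
    have hK : ∀ k, k ∈ K ↔ r ∣ e * k := fun k => by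
      simp [K, AddSubgroup.mem_comap, Int.mem_zmultiples_iff]
    have hs : ∀ k, ∑ i, res r ((![a1, a2, a3] : Fin 3 → ℤ) i * k)
        = res r (a1 * k) + res r (a2 * k) + res r (a3 * k) := fun k => by
      simp [Fin.sum_univ_three]
    have hk0s : res r (a1 * k0) + res r (a2 * k0) + res r (a3 * k0) = k0 := by
      have e1 := hres0 _ hd
      have e2 := hres0 _ (ncl_dvd_of_gcd r a4 e k0 hq hd)
      omega
    have key := h3 r hr ![a1, a2, a3] K ((hK r).2 (dvd_mul_left _ _)) k0 ((hK k0).2 hd)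
      (by
        intro i
        fin_cases i
        · exact ncl_ndvd r a1 k0 h1 hk1 hk2
        · exact ncl_ndvd r a2 k0 h2 hk1 hk2
        · exact ncl_ndvd r a3 k0 h3' hk1 hk2)
      (by rw [hs]; omega)
      (by
        intro k hk hk1' hk2' hne _
        rw [hs]
        have hd' := (hK k).1 hk
        have e1 := hres0 _ hd'
        have e2 := hres0 _ (ncl_dvd_of_gcd r a4 e k hq hd')
        have := hmin k hk1' hk2' hne
        omega)
    rw [hs, hk0s] at key
    push_cast at key
    linarith
  · have hs : ∀ k, ∑ i, res r ((![a1, a2, a3, a4, -e] : Fin 5 → ℤ) i * k)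
        = res r (a1 * k) + res r (a2 * k) + res r (a3 * k) + res r (a4 * k) + res r (-(e * k)) :=
      fun k => by
        simp [Fin.sum_univ_five]
    have hk0s : res r (a1 * k0) + res r (a2 * k0) + res r (a3 * k0) + res r (a4 * k0)
        + res r (-(e * k0)) = r + k0 := by
      have := ncl_res_neg r _ hr hd
      omega
    have key := h5 r hr ![a1, a2, a3, a4, -e] ⊤ trivial k0 trivial
      (by
        intro i
        fin_cases i
        · exact ncl_ndvd r a1 k0 h1 hk1 hk2
        · exact ncl_ndvd r a2 k0 h2 hk1 hk2
        · exact ncl_ndvd r a3 k0 h3' hk1 hk2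
        · exact fun h => hd (ncl_dvd_of_gcd r e a4 k0 hq.symm h)
        · intro h
          apply hd
          have h' : r ∣ -e * k0 := h
          rwa [neg_mul, dvd_neg] at h')
      (by rw [hs]; omega)
      (by
        intro k _ hk1' hk2' hne hnd
        rw [hs]
        have hd' : ¬ r ∣ e * k := by
          have h : ¬ r ∣ -e * k := hnd 4
          rwa [neg_mul, dvd_neg] at h
        have e1 := ncl_res_neg r _ hr hd'
        have := hmin k hk1' hk2' hne
        omega)
    rw [hs, hk0s] at key
    push_cast at key
    rw [add_div, div_self hr'.ne'] at key
    linarith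
end

section
/- Let $r\geq 2$ be an integer and $a_1,a_2,a_3,a_4,e$ integers with $a_1,a_2,a_3$ each coprime to $r$. Let $k_0$ be an integer with $1\leq k_0\leq r-1$ such that $\overline{a_4k_0}\neq 0$ and $\overline{ek_0}\neq 0$, and assume that (1) $\sum_{i=1}^{4}\overline{a_ik_0}=\overline{ek_0}+k_0$, and (2) for every integer $k$ with $1\leq k\leq r-1$ and $k\neq k_0$ one has $\sum_{i=1}^{4}\overline{a_ik}\geq \overline{ek}+r$. Then the infimum of $b_1+b_2+b_3+b_4+b_5$ over all vectors $(b_1,\ldots,b_5)\in\mathbb{Q}^5$ with $b_i>0$ for all $i$ and such that there exists an integer $j$ with $(b_1,\ldots,b_5)\equiv \frac{j}{r}(a_1,a_2,a_3,a_4,-e) \pmod{\mathbb{Z}^5}$, is attained and equals $1+\frac{k_0}{r}$; in particular this infimum is strictly less than $2$. -/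
open scoped BigOperators

theorem aux_ge (r n m : ℤ) (hr : 0 < r) (h : 0 < n + m * r) : n % r ≤ n + m * r := by
  have h1 : (n + m * r) % r = n % r := Int.add_mul_emod_self_right n m r
  rw [← h1]
  have h2 := Int.emod_add_mul_ediv (n + m * r) r
  have h3 := mul_nonneg hr.le (Int.ediv_nonneg h.le hr.le)
  linarith

theorem aux_neg (r n m : ℤ) (hr : 0 < r) (h : 0 < -n + m * r) : r - n % r ≤ -n + m * r := by
  have h1 := Int.emod_add_mul_ediv n r
  have h2 := Int.emod_nonneg n hr.ne'
  have h3 : 0 < (m - n / r) * r := by nlinarith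
  have h4 : 0 < m - n / r := pos_of_mul_pos_left h3 hr.le
  nlinarith

theorem aux_pos (r a k : ℤ) (hr : 0 < r) (ha : Int.gcd a r = 1) (hk : 1 ≤ k) (hk' : k ≤ r - 1) :
    0 < (a * k) % r := by
  have h2 := Int.emod_nonneg (a * k) hr.ne'
  rcases h2.lt_or_eq with h | h
  · exact h
  · exfalso
    have h3 : r ∣ a * k := Int.dvd_of_emod_eq_zero h.symm
    have h4 : IsCoprime r a := (Int.isCoprime_iff_gcd_eq_one.mpr ha).symm
    have h5 := Int.le_of_dvd (by omega) (h4.dvd_of_dvd_mul_left h3)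
    omega

theorem aux_pos_int (r n m : ℤ) (hr : 0 < r) (h : (0 : ℚ) < (n : ℚ) / (r : ℚ) + (m : ℚ)) :
    0 < n + m * r := by
  have hq : (0 : ℚ) < r := by exact_mod_cast hr
  have h1 : (0 : ℚ) < ((n : ℚ) / r + m) * r := mul_pos h hq
  have h2 : ((n : ℚ) / r + m) * r = n + m * r := by field_simp
  rw [h2] at h1
  exact_mod_cast h1

theorem aux_div (r n : ℤ) (hr : 0 < r) :
    ((n % r : ℤ) : ℚ) / (r : ℚ) = (n : ℚ) / (r : ℚ) + ((-(n / r) : ℤ) : ℚ) := by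
  have hq : (r : ℚ) ≠ 0 := by exact_mod_cast hr.ne'
  have h1 : ((n % r : ℤ) : ℚ) + r * ((n / r : ℤ) : ℚ) = n := by
    exact_mod_cast Int.emod_add_mul_ediv n r
  rw [← h1]
  push_cast
  field_simp
  ring

theorem aux_low (r : ℤ) (hr : 0 < r) (a1 a2 a3 a4 e k0 j m1 m2 m3 m4 m5 : ℤ)
    (hk0' : k0 ≤ r - 1)
    (hsum : (a1 * k0) % r + (a2 * k0) % r + (a3 * k0) % r + (a4 * k0) % r
      = (e * k0) % r + k0)
    (hge : ∀ k : ℤ, 1 ≤ k → k ≤ r - 1 → k ≠ k0 →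
      (e * k) % r + r ≤
        (a1 * k) % r + (a2 * k) % r + (a3 * k) % r + (a4 * k) % r)
    (p1 : 0 < j * a1 + m1 * r) (p2 : 0 < j * a2 + m2 * r) (p3 : 0 < j * a3 + m3 * r)
    (p4 : 0 < j * a4 + m4 * r) (p5 : 0 < -(j * e) + m5 * r) :
    r + k0 ≤ (j * a1 + m1 * r) + (j * a2 + m2 * r) + (j * a3 + m3 * r) + (j * a4 + m4 * r)
      + (-(j * e) + m5 * r) := by
  have hk : ∀ a : ℤ, (a * (j % r)) % r = (j * a) % r := fun a => by
    rw [Int.mul_emod, Int.emod_emod_of_dvd _ dvd_rfl, ← Int.mul_emod, mul_comm]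
  have b1 := aux_ge r _ _ hr p1
  have b2 := aux_ge r _ _ hr p2
  have b3 := aux_ge r _ _ hr p3
  have b4 := aux_ge r _ _ hr p4
  have b5 := aux_neg r _ _ hr p5
  have n0 := Int.emod_nonneg j hr.ne'
  have n1 := Int.emod_lt_of_pos j hr
  by_cases c : j % r = k0
  · rw [← c] at hsum
    simp only [hk] at hsum
    omega
  · by_cases c0 : j % r = 0
    · have d : r ∣ j := Int.dvd_of_emod_eq_zero c0
      have q1 := Int.le_of_dvd p1 (dvd_add (d.mul_right a1) (dvd_mul_left r m1))
      have q5 : (j * e) % r = 0 := Int.emod_eq_zero_of_dvd (d.mul_right e)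
      omega
    · have := hge (j % r) (by omega) (by omega) c
      simp only [hk] at this
      omega

/-- The minimal log discrepancy at the origin of the five-dimensional cyclic
quotient singularity of type `(1/r)(a1, a2, a3, a4, -e)`, computed by Ambro's
toric formula, is attained and equals `1 + k0/r < 2`. -/
theorem mld_dim5_computation
    (r : ℤ) (hr : 0 < r) (a1 a2 a3 a4 e k0 : ℤ)
    (h1 : Int.gcd a1 r = 1) (h2 : Int.gcd a2 r = 1) (h3 : Int.gcd a3 r = 1)
    (hk0 : 1 ≤ k0) (hk0' : k0 ≤ r - 1)
    (ha4k0 : res r (a4 * k0) ≠ 0) (hek0 : res r (e * k0) ≠ 0)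
    (hsum : res r (a1 * k0) + res r (a2 * k0) + res r (a3 * k0) + res r (a4 * k0)
      = res r (e * k0) + k0)
    (hge : ∀ k : ℤ, 1 ≤ k → k ≤ r - 1 → k ≠ k0 →
      res r (e * k) + r ≤
        res r (a1 * k) + res r (a2 * k) + res r (a3 * k) + res r (a4 * k)) :
    IsLeast {x : ℚ | ∃ bb : Fin 5 → ℚ, (∀ i, 0 < bb i) ∧
        (∃ j : ℤ, ∀ i, ∃ m : ℤ,
          bb i = ((j * ![a1, a2, a3, a4, -e] i : ℤ) : ℚ) / (r : ℚ) + (m : ℚ)) ∧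
        x = ∑ i, bb i}
      (1 + (k0 : ℚ) / (r : ℚ)) ∧
    1 + (k0 : ℚ) / (r : ℚ) < 2 := by
  unfold res at *
  have hq : (0 : ℚ) < r := by exact_mod_cast hr
  refine ⟨⟨?_, ?_⟩, ?_⟩
  · refine ⟨![((a1 * k0 % r : ℤ) : ℚ) / r, ((a2 * k0 % r : ℤ) : ℚ) / r, ((a3 * k0 % r : ℤ) : ℚ) / r,
      ((a4 * k0 % r : ℤ) : ℚ) / r, 1 - ((e * k0 % r : ℤ) : ℚ) / r], ?_, ⟨k0, ?_⟩, ?_⟩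
    · have g1 := aux_pos r a1 k0 hr h1 hk0 hk0'
      have g2 := aux_pos r a2 k0 hr h2 hk0 hk0'
      have g3 := aux_pos r a3 k0 hr h3 hk0 hk0'
      have g4 : 0 < a4 * k0 % r := lt_of_le_of_ne (Int.emod_nonneg _ hr.ne') (Ne.symm ha4k0)
      have g5 := Int.emod_lt_of_pos (e * k0) hr
      intro i
      fin_cases i
      · exact div_pos (Int.cast_pos.mpr g1) hq
      · exact div_pos (Int.cast_pos.mpr g2) hq
      · exact div_pos (Int.cast_pos.mpr g3) hq
      · exact div_pos (Int.cast_pos.mpr g4) hq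
      · exact sub_pos.mpr ((div_lt_one hq).mpr (Int.cast_lt.mpr g5))
    · intro i
      fin_cases i
      · exact ⟨_, (aux_div r (a1 * k0) hr).trans (by rw [mul_comm a1 k0]; rfl)⟩
      · exact ⟨_, (aux_div r (a2 * k0) hr).trans (by rw [mul_comm a2 k0]; rfl)⟩
      · exact ⟨_, (aux_div r (a3 * k0) hr).trans (by rw [mul_comm a3 k0]; rfl)⟩
      · exact ⟨_, (aux_div r (a4 * k0) hr).trans (by rw [mul_comm a4 k0]; rfl)⟩
      · refine ⟨1 + e * k0 / r, ?_⟩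
        change 1 - ((e * k0 % r : ℤ) : ℚ) / r = ((k0 * -e : ℤ) : ℚ) / r + ((1 + e * k0 / r : ℤ) : ℚ)
        rw [aux_div r (e * k0) hr]
        push_cast
        ring
    · have hs : ((a1 * k0 % r : ℤ) : ℚ) + ((a2 * k0 % r : ℤ) : ℚ) + ((a3 * k0 % r : ℤ) : ℚ)
          + ((a4 * k0 % r : ℤ) : ℚ) = ((e * k0 % r : ℤ) : ℚ) + k0 := by exact_mod_cast hsum
      have hk : (k0 : ℚ) = ((a1 * k0 % r : ℤ) : ℚ) + ((a2 * k0 % r : ℤ) : ℚ)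
          + ((a3 * k0 % r : ℤ) : ℚ) + ((a4 * k0 % r : ℤ) : ℚ) - ((e * k0 % r : ℤ) : ℚ) := by
        linarith
      rw [Fin.sum_univ_five]
      change 1 + (k0 : ℚ) / r = ((a1 * k0 % r : ℤ) : ℚ) / r + ((a2 * k0 % r : ℤ) : ℚ) / r
        + ((a3 * k0 % r : ℤ) : ℚ) / r + ((a4 * k0 % r : ℤ) : ℚ) / r
        + (1 - ((e * k0 % r : ℤ) : ℚ) / r)
      have hk2 := congrArg (fun x : ℚ => x / r) hk
      simp only [add_div, sub_div] at hk2
      linarith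
  · rintro x ⟨bb, hpos, ⟨j, hj⟩, rfl⟩
    choose m hm using hj
    have p : ∀ i, 0 < j * ![a1, a2, a3, a4, -e] i + m i * r := fun i =>
      aux_pos_int r _ _ hr (hm i ▸ hpos i)
    have p5 : 0 < j * -e + m 4 * r := p 4
    rw [mul_neg] at p5
    have key := aux_low r hr a1 a2 a3 a4 e k0 j (m 0) (m 1) (m 2) (m 3) (m 4) hk0' hsum hge
      (p 0) (p 1) (p 2) (p 3) p5
    have e0 : bb 0 = ((j * a1 : ℤ) : ℚ) / r + m 0 := hm 0
    have e1 : bb 1 = ((j * a2 : ℤ) : ℚ) / r + m 1 := hm 1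
    have e2 : bb 2 = ((j * a3 : ℤ) : ℚ) / r + m 2 := hm 2
    have e3 : bb 3 = ((j * a4 : ℤ) : ℚ) / r + m 3 := hm 3
    have e4 : bb 4 = ((j * -e : ℤ) : ℚ) / r + m 4 := hm 4
    rw [Fin.sum_univ_five, e0, e1, e2, e3, e4]
    have keyq : (r : ℚ) + k0 ≤ (j * a1 + m 0 * r) + (j * a2 + m 1 * r) + (j * a3 + m 2 * r)
      + (j * a4 + m 3 * r) + (-(j * e) + m 4 * r) := by exact_mod_cast key
    have l : 1 + (k0 : ℚ) / r = (r + k0) / r := by field_simp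
    rw [l, div_le_iff₀ hq]
    refine keyq.trans (le_of_eq ?_)
    push_cast
    field_simp
  · have : (k0 : ℚ) / r < 1 := (div_lt_one hq).mpr (by exact_mod_cast (by omega : k0 < r))
    linarith
end

section
/- Let $r$ be a positive integer and $a_1,a_2,a_3,a_4,e$ integers with $q:=\gcd(e,r)=\gcd(a_4,r)$, with $a_1,a_2,a_3$ each coprime to $r$, and write $r=pq$. Let $k_0$ be an integer with $1\leq k_0\leq r-1$ such that $\overline{a_4k_0}=0$, and assume that (1) $\sum_{i=1}^{4}\overline{a_ik_0}=\overline{ek_0}+k_0$, and (2) for every integer $k$ with $1\leq k\leq r-1$ and $k\neq k_0$ one has $\sum_{i=1}^{4}\overline{a_ik}\geq \overline{ek}+r$. Then $p$ divides $k_0$, and writing $k_0=pk_0'$ one has: $\sum_{i=1}^{3}(\overline{a_ik_0'})_q=k_0'$; for every integer $k'$ with $1\leq k'\leq q-1$ and $k'\neq k_0'$, $\sum_{i=1}^{3}(\overline{a_ik'})_q\geq q$; and consequently $\min_{1\leq j\leq q-1}\frac{1}{q}\sum_{i=1}^{3}(\overline{a_ij})_q=\frac{k_0'}{q}=\frac{k_0}{r}<1$.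 -/
/-- The reduction modulo `q` in the second case of the proof of the
non-canonical lemma. -/
theorem non_canonical_lemma_reduction
    (r : ℤ) (hr : 0 < r) (a1 a2 a3 a4 e p q k0 : ℤ)
    (hq : q = (Int.gcd e r : ℤ)) (hq' : Int.gcd e r = Int.gcd a4 r)
    (h1 : Int.gcd a1 r = 1) (h2 : Int.gcd a2 r = 1) (h3 : Int.gcd a3 r = 1)
    (hp : r = p * q)
    (hk0 : 1 ≤ k0) (hk0' : k0 ≤ r - 1)
    (ha4k0 : res r (a4 * k0) = 0)
    (hsum : res r (a1 * k0) + res r (a2 * k0) + res r (a3 * k0) + res r (a4 * k0)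
      = res r (e * k0) + k0)
    (hge : ∀ k : ℤ, 1 ≤ k → k ≤ r - 1 → k ≠ k0 →
      res r (e * k) + r ≤
        res r (a1 * k) + res r (a2 * k) + res r (a3 * k) + res r (a4 * k)) :
    p ∣ k0 ∧
    ∀ k0' : ℤ, k0 = p * k0' →
      (res q (a1 * k0') + res q (a2 * k0') + res q (a3 * k0') = k0') ∧
      (∀ k' : ℤ, 1 ≤ k' → k' ≤ q - 1 → k' ≠ k0' →
        q ≤ res q (a1 * k') + res q (a2 * k') + res q (a3 * k')) ∧
      IsLeast {x : ℚ | ∃ j : ℤ, 1 ≤ j ∧ j ≤ q - 1 ∧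
          x = ((res q (a1 * j) + res q (a2 * j) + res q (a3 * j) : ℤ) : ℚ) / (q : ℚ)}
        ((k0' : ℚ) / (q : ℚ)) ∧
      (k0' : ℚ) / (q : ℚ) = (k0 : ℚ) / (r : ℚ) ∧
      (k0 : ℚ) / (r : ℚ) < 1 := by
  have hq0 : 0 < q := by
    rw [hq]
    exact_mod_cast Int.gcd_pos_of_ne_zero_right e hr.ne'
  have hp0 : 0 < p := by
    by_contra h
    have : p * q ≤ 0 := mul_nonpos_of_nonpos_of_nonneg (not_lt.mp h) hq0.le
    linarith
  have key : ∀ a k : ℤ, res r (a * (p * k)) = p * res q (a * k) := by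
    intro a k
    unfold res
    rw [hp, show a * (p * k) = p * (a * k) by ring, Int.mul_emod_mul_of_pos _ _ hp0]
  have zero : ∀ a k : ℤ, q ∣ a → res q (a * k) = 0 := by
    intro a k h
    exact Int.emod_eq_zero_of_dvd (Dvd.dvd.mul_right h k)
  have he : q ∣ e := by rw [hq]; exact Int.gcd_dvd_left ..
  have ha : q ∣ a4 := by rw [hq, hq']; exact Int.gcd_dvd_left ..
  refine ⟨?_, ?_⟩
  · have hd : r ∣ a4 * k0 := Int.dvd_of_emod_eq_zero ha4k0
    have h4 : q = (Int.gcd a4 r : ℤ) := by rw [hq, hq']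
    have hd2 : r ∣ k0 * q := by
      rw [h4, Int.gcd_eq_gcd_ab]
      have : k0 * (a4 * Int.gcdA a4 r + r * Int.gcdB a4 r)
          = a4 * k0 * Int.gcdA a4 r + r * (k0 * Int.gcdB a4 r) := by ring
      rw [this]
      exact dvd_add (hd.mul_right _) (dvd_mul_right _ _)
    rw [hp] at hd2
    exact Int.dvd_of_mul_dvd_mul_right hq0.ne' hd2
  · intro m hm
    have hm1 : 1 ≤ m := by
      by_contra h
      have : p * m ≤ 0 := mul_nonpos_of_nonneg_of_nonpos hp0.le (by omega)
      omega
    have hm2 : m < q := by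
      have : p * m < p * q := by omega
      exact lt_of_mul_lt_mul_left this hp0.le
    have hS : res q (a1 * m) + res q (a2 * m) + res q (a3 * m) = m := by
      rw [hm] at hsum
      simp only [key, zero e _ he, zero a4 _ ha] at hsum
      apply mul_left_cancel₀ hp0.ne'
      linarith
    have hO : ∀ k' : ℤ, 1 ≤ k' → k' ≤ q - 1 → k' ≠ m →
        q ≤ res q (a1 * k') + res q (a2 * k') + res q (a3 * k') := by
      intro k hk1 hk2 hne
      have := hge (p * k) (by nlinarith) (by rw [hp]; nlinarith)
        (by rw [hm]; exact fun h => hne (mul_left_cancel₀ hp0.ne' h))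
      simp only [key, zero e _ he, zero a4 _ ha] at this
      refine le_of_mul_le_mul_left ?_ hp0
      linarith
    have hqQ : (0 : ℚ) < q := by exact_mod_cast hq0
    have hpQ : (0 : ℚ) < p := by exact_mod_cast hp0
    have hrQ : (0 : ℚ) < r := by exact_mod_cast hr
    refine ⟨hS, hO, ⟨⟨m, hm1, by omega, by rw [hS]⟩, ?_⟩, ?_, ?_⟩
    · rintro x ⟨j, hj1, hj2, rfl⟩
      apply div_le_div_of_nonneg_right _ hqQ.le
      rw [Int.cast_le]
      by_cases h : j = m
      · subst h; exact hS.ge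
      · exact hm2.le.trans (hO j hj1 hj2 h)
    · rw [hm, hp]
      push_cast
      rw [mul_div_mul_left _ _ hpQ.ne']
    · rw [div_lt_one hrQ]
      exact_mod_cast (by omega : k0 < r)
end

section
/- In the hyperquotient setup with the cA form and Rules I and II, the following holds. (1) For every $\alpha\in N\cap\square$ such that $\alpha$ is different from $\beta$ and from $\beta'$ (these conditions being vacuous when $B=\emptyset$), exactly one of the following two alternatives holds: (i) $\alpha(f)=\alpha_1+\alpha_2\leq 1$ and $\alpha_3+\alpha_4>1$, and moreover if $\alpha_1+\alpha_2=1$ then $\alpha_3=1$ or $\alpha_4=1$; (ii) $\alpha(f)=\alpha_1+\alpha_2-1$ and $\alpha_3+\alpha_4<1$, and moreover if $\alpha_1+\alpha_2=1$ then $\alpha_3=0$ or $\alpha_4=0$. In particular, for every $k\in\{1,\ldots,r-1\}$ with $\alpha_k\notin\{\beta,\beta'\}$, either ($\overline{ak}+\overline{bk}=\overline{ek}$ and $\overline{ck}+\overline{dk}=k+r$) or ($\overline{ak}+\overline{bk}=\overline{ek}+r$ and $\overline{ck}+\overline{dk}=k$). -/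
open scoped BigOperators

namespace GapPaper

/-- Least non-negative residue of `n` modulo `r` (for `r > 0`). -/
def res (r n : ℤ) : ℤ := n % r

/-- The lattice `N = ℤ⁴ + ℤ·(1/r)(a,b,c,d)` inside `ℚ⁴`. -/
def latN (r a b c d : ℤ) : Set (Fin 4 → ℚ) :=
  {v | ∃ (j : ℤ) (m : Fin 4 → ℤ), ∀ i,
    v i = ((j * ![a, b, c, d] i : ℤ) : ℚ) / (r : ℚ) + (m i : ℚ)}

/-- The positive orthant `σ`. -/
def orth : Set (Fin 4 → ℚ) := {v | ∀ i, 0 ≤ v i}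

/-- The weight `w(v) = v₁ + v₂ + v₃ + v₄`. -/
def w (v : Fin 4 → ℚ) : ℚ := ∑ i, v i

/-- `v(f)`: the infimum over the monomials `m ∈ S` of their `v`-weights. -/
noncomputable def vf (S : Set (Fin 4 → ℕ)) (v : Fin 4 → ℚ) : ℝ :=
  sInf {x : ℝ | ∃ m ∈ S, x = ∑ i : Fin 4, (m i : ℝ) * ((v i : ℚ) : ℝ)}

/-- `v` is primitive in the lattice `N`. -/
def IsPrim (r a b c d : ℤ) (v : Fin 4 → ℚ) : Prop :=
  ¬ ∃ (n : ℤ) (u : Fin 4 → ℚ), 2 ≤ n ∧ u ∈ latN r a b c d ∧ v = fun i => (n : ℚ) * u i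

/-- The excluded set `{0, e₁, e₂, e₃, e₄}`. -/
def corners : Set (Fin 4 → ℚ) :=
  {v | v = 0 ∨ ∃ i₀ : Fin 4, v = fun i => if i = i₀ then 1 else 0}

/-- Every monomial of `S` has weight `e` for the `μ_r`-action with weights
`(a, b, c, d)`. -/
def WeightCond (r a b c d e : ℤ) (S : Set (Fin 4 → ℕ)) : Prop :=
  ∀ m ∈ S, Int.ModEq r ((m 0 : ℤ) * a + (m 1 : ℤ) * b + (m 2 : ℤ) * c + (m 3 : ℤ) * d) e

/-- Rule I: `B` is a set with at most one element, whose element `β` (if any) is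
primitive and satisfies `1 - δ < w(β) - β(f) < 1`, and every lattice vector in the
orthant other than `β`, `0`, `e₁`, ..., `e₄` satisfies `w(v) - v(f) > 1`. -/
def RuleI (r a b c d : ℤ) (δ : ℝ) (S : Set (Fin 4 → ℕ)) (B : Set (Fin 4 → ℚ)) : Prop :=
  B.Subsingleton ∧ B ⊆ latN r a b c d ∩ orth ∧
    (∀ β ∈ B, IsPrim r a b c d β ∧
      1 - δ < ((w β : ℚ) : ℝ) - vf S β ∧ ((w β : ℚ) : ℝ) - vf S β < 1) ∧
    ∀ v ∈ latN r a b c d ∩ orth, v ∉ B → v ∉ corners → 1 < ((w v : ℚ) : ℝ) - vf S v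

/-- Rule II. -/
def RuleII (r a b c d e : ℤ) : Prop :=
  (Int.gcd a r ∣ Int.gcd e r) ∧ (Int.gcd b r ∣ Int.gcd e r) ∧
  (Int.gcd c r ∣ Int.gcd e r) ∧ (Int.gcd d r ∣ Int.gcd e r) ∧
  Int.gcd a (Int.gcd b r) = 1 ∧ Int.gcd a (Int.gcd c r) = 1 ∧
  Int.gcd a (Int.gcd d r) = 1 ∧ Int.gcd b (Int.gcd c r) = 1 ∧
  Int.gcd b (Int.gcd d r) = 1 ∧ Int.gcd c (Int.gcd d r) = 1 ∧
  Int.ModEq r (a + b + c + d - e) 1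

/-- The vector `α_k = (1/r)(res(ak), res(bk), res(ck), res(dk))`. -/
def alphaK (r a b c d k : ℤ) : Fin 4 → ℚ :=
  fun i => ((res r (![a, b, c, d] i * k) : ℤ) : ℚ) / (r : ℚ)

/-- The unit cube `[0,1]⁴` minus its 16 vertices. -/
def cube : Set (Fin 4 → ℚ) :=
  {v | (∀ i, 0 ≤ v i ∧ v i ≤ 1) ∧ ¬ ∀ i, v i = 0 ∨ v i = 1}

/-- The cA form: `f = xy + g(z,t)` with `g ∈ 𝔪²`. -/
def FormCA (S : Set (Fin 4 → ℕ)) : Prop :=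
  ![1, 1, 0, 0] ∈ S ∧
    ∀ m ∈ S, m ≠ ![1, 1, 0, 0] → m 0 = 0 ∧ m 1 = 0 ∧ 2 ≤ m 2 + m 3

/-- The square form: `f = x² + (terms of order ≥ 2)`. -/
def FormSq (S : Set (Fin 4 → ℕ)) : Prop :=
  ![2, 0, 0, 0] ∈ S ∧ ∀ m ∈ S, 2 ≤ m 0 + m 1 + m 2 + m 3

/-- The odd form: `f = x² + y² + g(z,t)` with `g ∈ 𝔪³`. -/
def FormOdd (S : Set (Fin 4 → ℕ)) : Prop :=
  ![2, 0, 0, 0] ∈ S ∧ ![0, 2, 0, 0] ∈ S ∧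
    ∀ m ∈ S, m ≠ ![2, 0, 0, 0] → m ≠ ![0, 2, 0, 0] →
      m 0 = 0 ∧ m 1 = 0 ∧ 3 ≤ m 2 + m 3

/-- The cD–E form: `f = x² + g(y,z,t)` with `g ∈ 𝔪³`. -/
def FormCDE (S : Set (Fin 4 → ℕ)) : Prop :=
  ![2, 0, 0, 0] ∈ S ∧ ∀ m ∈ S, m ≠ ![2, 0, 0, 0] → m 0 = 0 ∧ 3 ≤ m 1 + m 2 + m 3

theorem latN_int {r a b c d : ℤ} (hr : 0 < r) {v : Fin 4 → ℚ}
    (hv : v ∈ latN r a b c d) (ho : v ∈ orth) :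
    ∃ (j : ℤ) (n : Fin 4 → ℕ), (∀ i, v i = (n i : ℚ) / (r : ℚ)) ∧
      ∀ i, (r : ℤ) ∣ (n i : ℤ) - j * ![a, b, c, d] i := by
  obtain ⟨j, m, h⟩ := hv
  have hrQ : (0 : ℚ) < r := by exact_mod_cast hr
  have key : ∀ i, ∃ n : ℕ, (n : ℤ) = j * ![a, b, c, d] i + m i * r := by
    intro i
    have h0 := ho i
    rw [h i] at h0
    have h1 : (0 : ℚ) ≤ ((j * ![a, b, c, d] i : ℤ) : ℚ) + m i * r := by
      have := mul_nonneg h0 hrQ.le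
      rw [add_mul, div_mul_cancel₀ _ hrQ.ne'] at this
      exact this
    have h2 : 0 ≤ j * ![a, b, c, d] i + m i * r := by exact_mod_cast h1
    exact ⟨(j * ![a, b, c, d] i + m i * r).toNat, Int.toNat_of_nonneg h2⟩
  choose n hn using key
  refine ⟨j, n, fun i => ?_, fun i => ⟨m i, ?_⟩⟩
  · rw [h i, eq_div_iff hrQ.ne', add_mul, div_mul_cancel₀ _ hrQ.ne']
    have := hn i
    exact_mod_cast this.symm
  · rw [hn i]; ring

theorem lemA {r a b c d e : ℤ} {S : Set (Fin 4 → ℕ)} (hr : 0 < r) {v : Fin 4 → ℚ}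
    (hwt : WeightCond r a b c d e S) (hform : FormCA S)
    (hv : v ∈ latN r a b c d) (ho : v ∈ orth) :
    ∃ (j n0 n1 n2 n3 F : ℤ), v 0 = n0 / r ∧ v 1 = n1 / r ∧ v 2 = n2 / r ∧ v 3 = n3 / r ∧
      0 ≤ n0 ∧ 0 ≤ n1 ∧ 0 ≤ n2 ∧ 0 ≤ n3 ∧
      r ∣ n0 - j * a ∧ r ∣ n1 - j * b ∧ r ∣ n2 - j * c ∧ r ∣ n3 - j * d ∧
      vf S v = (F : ℝ) / r ∧ 0 ≤ F ∧ F ≤ n0 + n1 ∧ r ∣ n0 + n1 - F ∧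
      (F = 0 → n0 + n1 = 0 ∨ n2 = 0 ∨ n3 = 0) := by
  obtain ⟨j, n, hvn, hd⟩ := latN_int hr hv ho
  have hrR : (0 : ℝ) < r := by exact_mod_cast hr
  obtain ⟨hxy, hS⟩ := hform
  obtain ⟨m, hmS, hmin⟩ : ∃ m ∈ S, ∀ m' ∈ S, ∑ i, m i * n i ≤ ∑ i, m' i * n i := by
    obtain ⟨m, hm, h⟩ := exists_minimalFor_of_wellFoundedLT (· ∈ S)
      (fun m : Fin 4 → ℕ => ∑ i, m i * n i) ⟨_, hxy⟩
    exact ⟨m, hm, fun m' hm' => (le_total _ _).elim id (fun h' => h hm' h')⟩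
  have hval : ∀ m' : Fin 4 → ℕ, ∑ i : Fin 4, (m' i : ℝ) * ((v i : ℚ) : ℝ)
      = ((∑ i, m' i * n i : ℕ) : ℝ) / r := by
    intro m'
    push_cast
    rw [Finset.sum_div]
    refine Finset.sum_congr rfl fun i _ => ?_
    rw [hvn i]; push_cast; ring
  have hvf : vf S v = ((∑ i, m i * n i : ℕ) : ℝ) / r := by
    apply IsLeast.csInf_eq
    refine ⟨⟨m, hmS, (hval m).symm⟩, ?_⟩
    rintro x ⟨m', hm', rfl⟩
    rw [hval]
    have := hmin m' hm'
    gcongr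
  have d0 := hd 0
  have d1 := hd 1
  have d2 := hd 2
  have d3 := hd 3
  simp at d0 d1 d2 d3
  have hle := hmin _ hxy
  simp [Fin.sum_univ_four] at hle
  have w1 := (hwt _ hmS).dvd
  have w2 := (hwt _ hxy).dvd
  simp at w2
  refine ⟨j, n 0, n 1, n 2, n 3, ((∑ i, m i * n i : ℕ) : ℤ), by simpa using hvn 0,
    by simpa using hvn 1, by simpa using hvn 2, by simpa using hvn 3, by positivity, by positivity,
    by positivity, by positivity, d0, d1, d2, d3, by rw [hvf]; norm_cast, by positivity, ?_, ?_, ?_⟩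
  · rw [Fin.sum_univ_four]; exact_mod_cast hle
  · rw [Fin.sum_univ_four]; push_cast
    obtain ⟨x0, h0⟩ := d0
    obtain ⟨x1, h1⟩ := d1
    obtain ⟨x2, h2⟩ := d2
    obtain ⟨x3, h3⟩ := d3
    obtain ⟨y, hy⟩ := w1
    obtain ⟨z, hz⟩ := w2
    refine ⟨x0 + x1 - (m 0 * x0 + m 1 * x1 + m 2 * x2 + m 3 * x3) + j * (y - z), ?_⟩
    linear_combination h0 + h1 - m 0 * h0 - m 1 * h1 - m 2 * h2 - m 3 * h3 + j * hy - j * hz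
  · intro hF
    have hF' : ∑ i, m i * n i = 0 := by exact_mod_cast hF
    rw [Fin.sum_univ_four] at hF'
    by_cases hm : m = ![1, 1, 0, 0]
    · subst hm; left; simp at hF'; simp [hF']
    · obtain ⟨_, _, h⟩ := hS m hmS hm
      right
      simp only [Nat.add_eq_zero_iff, Nat.mul_eq_zero] at hF'
      omega

theorem dvd_of_pair {r j c d : ℤ} (h : Int.gcd c (Int.gcd d r) = 1)
    (hc : r ∣ j * c) (hd : r ∣ j * d) : r ∣ j := by
  have h2 : (r : ℤ) ∣ j * (Int.gcd d r : ℤ) := by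
    rw [Int.gcd_eq_gcd_ab, mul_add, ← mul_assoc, ← mul_assoc]
    exact dvd_add (hd.mul_right _) (Dvd.intro_left (j * 1) (by ring) |>.mul_right _)
  have h3 : (r : ℤ) ∣ j * (Int.gcd c (Int.gcd d r : ℤ) : ℤ) := by
    rw [Int.gcd_eq_gcd_ab c, mul_add, ← mul_assoc, ← mul_assoc]
    exact dvd_add (hc.mul_right _) (h2.mul_right _)
  rw [h] at h3
  simpa using h3

set_option maxHeartbeats 1000000 in
theorem part1 {r a b c d e : ℤ} {δ : ℝ} {S : Set (Fin 4 → ℕ)} {B : Set (Fin 4 → ℚ)}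
    (hr : 0 < r) (hwt : WeightCond r a b c d e S)
    (hI : RuleI r a b c d δ S B) (hII : RuleII r a b c d e) (hform : FormCA S)
    {α : Fin 4 → ℚ} (hα : α ∈ latN r a b c d ∩ cube)
    (hB : ∀ β ∈ B, α ≠ β ∧ α ≠ fun i => 1 - β i) :
    ∃ (n0 n1 n2 n3 F : ℤ), α 0 = n0 / r ∧ α 1 = n1 / r ∧ α 2 = n2 / r ∧ α 3 = n3 / r ∧
      vf S α = (F : ℝ) / r ∧ 0 ≤ F ∧
      ((F = n0 + n1 ∧ n0 + n1 ≤ r ∧ r < n2 + n3 ∧ (n0 + n1 = r → n2 = r ∨ n3 = r)) ∨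
       (F = n0 + n1 - r ∧ n2 + n3 < r ∧ (n0 + n1 = r → n2 = 0 ∨ n3 = 0))) := by
  obtain ⟨hN, hc01, hnv⟩ := hα
  obtain ⟨-, -, -, hI⟩ := hI
  obtain ⟨-, -, -, -, gab, -, -, -, -, gcd', -⟩ := hII
  have hrR : (0 : ℝ) < r := by exact_mod_cast hr
  have hrQ : (0 : ℚ) < r := by exact_mod_cast hr
  have hcor : ∀ u ∈ corners, ∀ i, u i = 0 ∨ u i = 1 := by
    rintro u (rfl | ⟨i0, rfl⟩) i
    · simp
    · by_cases h : i = i0 <;> simp [h]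
  have ho : α ∈ orth := fun i => (hc01 i).1
  have ho' : (fun i => 1 - α i) ∈ orth := fun i => sub_nonneg.2 (hc01 i).2
  have hN' : (fun i => 1 - α i) ∈ latN r a b c d := by
    obtain ⟨j, m, h⟩ := hN
    refine ⟨-j, fun i => 1 - m i, fun i => ?_⟩
    simp only [h i]; push_cast; ring
  have i1 := hI α ⟨hN, ho⟩ (fun h => (hB α h).1 rfl) (fun h => hnv (hcor α h))
  have i2 := hI (fun i => 1 - α i) ⟨hN', ho'⟩ (fun h => (hB _ h).2 (by funext i; simp))
    (fun h => hnv (fun i => by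
      rcases hcor _ h i with h | h
      · right; linarith
      · left; linarith))
  obtain ⟨j, n0, n1, n2, n3, F, v0, v1, v2, v3, p0, p1, p2, p3, d0, d1, d2, d3, hF, F0, Fle, Fd, Fz⟩ :=
    lemA hr hwt hform hN ho
  obtain ⟨j', k0, k1, k2, k3, G, u0, u1, u2, u3, q0, q1, q2, q3, -, -, -, -, hG, G0, Gle, Gd, Gz⟩ :=
    lemA hr hwt hform hN' ho'
  have conv : ∀ {x : ℚ} {n k : ℤ}, x = n / r → 1 - x = k / r → k = r - n := by
    intro x n k h1 h2
    rw [h1, eq_div_iff hrQ.ne', sub_mul, div_mul_cancel₀ _ hrQ.ne'] at h2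
    have : ((k : ℤ) : ℚ) = ((r - n : ℤ) : ℚ) := by push_cast; linarith
    exact_mod_cast this
  have e0 := conv v0 u0
  have e1 := conv v1 u1
  have e2 := conv v2 u2
  have e3 := conv v3 u3
  have I1 : r < n0 + n1 + n2 + n3 - F := by
    rw [hF, w, Fin.sum_univ_four, v0, v1, v2, v3] at i1
    push_cast at i1
    rw [← add_div, ← add_div, ← add_div, ← sub_div, lt_div_iff₀ hrR, one_mul] at i1
    exact_mod_cast i1
  have I2 : r < k0 + k1 + k2 + k3 - G := by
    rw [hG, w, Fin.sum_univ_four, u0, u1, u2, u3] at i2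
    push_cast at i2
    rw [← add_div, ← add_div, ← add_div, ← sub_div, lt_div_iff₀ hrR, one_mul] at i2
    exact_mod_cast i2
  have noj : ¬ r ∣ j := by
    rintro ⟨t, ht⟩
    apply hnv
    have : ∀ (x : ℚ) (n y : ℤ), 0 ≤ n → n ≤ r → r ∣ n - j * y → x = n / r → x = 0 ∨ x = 1 := by
      intro x n y h1 h2 h3 h4
      have h5 : r ∣ n := by
        have := dvd_add h3 (Dvd.intro _ ht.symm |>.mul_right y : r ∣ j * y)
        simpa using this
      obtain ⟨s, hs⟩ := h5
      have : 0 ≤ s := by by_contra hh; nlinarith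
      have : s ≤ 1 := by by_contra hh; nlinarith
      obtain rfl | rfl : s = 0 ∨ s = 1 := by omega
      · left; rw [h4, hs]; simp
      · right; rw [h4, hs]; simp [hrQ.ne']
    intro i
    fin_cases i
    · exact this _ n0 a p0 (by omega) d0 v0
    · exact this _ n1 b p1 (by omega) d1 v1
    · exact this _ n2 c p2 (by omega) d2 v2
    · exact this _ n3 d p3 (by omega) d3 v3
  have dz : ∀ (n y : ℤ), r ∣ n - j * y → (n = 0 ∨ n = r) → r ∣ j * y := by
    rintro n y h (rfl | rfl)
    · simpa using h
    · simpa using h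
  have hab : ¬ ((n0 = 0 ∨ n0 = r) ∧ (n1 = 0 ∨ n1 = r)) := fun ⟨h1, h2⟩ =>
    noj (dvd_of_pair gab (dz _ _ d0 h1) (dz _ _ d1 h2))
  have hcd : ¬ ((n2 = 0 ∨ n2 = r) ∧ (n3 = 0 ∨ n3 = r)) := fun ⟨h1, h2⟩ =>
    noj (dvd_of_pair gcd' (dz _ _ d2 h1) (dz _ _ d3 h2))
  obtain ⟨s, hs⟩ := Fd
  obtain ⟨t, ht⟩ := Gd
  have s0 : 0 ≤ s := by by_contra hh; nlinarith
  have t0 : 0 ≤ t := by by_contra hh; nlinarith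
  have s1 : s < 2 := by
    by_contra hh
    have : r * 2 ≤ r * s := by nlinarith
    omega
  have t1 : t < 2 := by
    by_contra hh
    have : r * 2 ≤ r * t := by nlinarith
    omega
  refine ⟨n0, n1, n2, n3, F, v0, v1, v2, v3, hF, F0, ?_⟩
  obtain rfl | rfl : s = 0 ∨ s = 1 := by omega
  all_goals obtain rfl | rfl : t = 0 ∨ t = 1 := by omega
  all_goals simp only [mul_zero, mul_one] at hs ht
  all_goals clear i1 i2 hI hwt hB noj dz conv hcor
  · exfalso; omega
  · left
    refine ⟨by omega, by omega, by omega, fun h => ?_⟩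
    have := Gz (by omega)
    omega
  · right
    refine ⟨by omega, by omega, fun h => ?_⟩
    have := Fz (by omega)
    omega
  · exfalso
    have h1 := Gz (by omega)
    have h2 := Fz (by omega)
    have h3 : n2 = 0 ∨ n3 = 0 := by omega
    have h4 : n2 = r ∨ n3 = r := by omega
    apply hcd
    clear hcd hab Gz Fz
    omega

/-- Proposition (xy), parts (1) and its consequence, in the cA case. -/
theorem statement7 (r : ℤ) (δ : ℝ) (a b c d e : ℤ) (S : Set (Fin 4 → ℕ))
    (B : Set (Fin 4 → ℚ))
    (hr : 13 < r) (hδ0 : 0 < δ) (hδ1 : δ ≤ 1 / 13)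
    (hwt : WeightCond r a b c d e S)
    (hI : RuleI r a b c d δ S B) (hII : RuleII r a b c d e)
    (hform : FormCA S) :
    (∀ α ∈ latN r a b c d ∩ cube,
      (∀ β ∈ B, α ≠ β ∧ α ≠ fun i => 1 - β i) →
      Xor'
        (vf S α = ((α 0 + α 1 : ℚ) : ℝ) ∧ α 0 + α 1 ≤ 1 ∧ 1 < α 2 + α 3 ∧
          (α 0 + α 1 = 1 → α 2 = 1 ∨ α 3 = 1))
        (vf S α = ((α 0 + α 1 : ℚ) : ℝ) - 1 ∧ α 2 + α 3 < 1 ∧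
          (α 0 + α 1 = 1 → α 2 = 0 ∨ α 3 = 0))) ∧
    ∀ k : ℤ, 1 ≤ k → k ≤ r - 1 →
      (∀ β ∈ B, alphaK r a b c d k ≠ β ∧ alphaK r a b c d k ≠ fun i => 1 - β i) →
      (res r (a * k) + res r (b * k) = res r (e * k) ∧
        res r (c * k) + res r (d * k) = k + r) ∨
      (res r (a * k) + res r (b * k) = res r (e * k) + r ∧
        res r (c * k) + res r (d * k) = k) := by
  have hr0 : 0 < r := by omega
  have hrR : (0 : ℝ) < r := by exact_mod_cast hr0
  have hrQ : (0 : ℚ) < r := by exact_mod_cast hr0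
  constructor
  · intro α hα hB
    obtain ⟨n0, n1, n2, n3, F, v0, v1, v2, v3, hF, F0, h⟩ := part1 hr0 hwt hI hII hform hα hB
    have sum : ∀ x y : ℤ, (x : ℚ) / r + (y : ℚ) / r = ((x + y : ℤ) : ℚ) / r := by
      intro x y; push_cast; ring
    have e1 : ∀ x : ℤ, (x : ℚ) / r = 1 ↔ x = r := by
      intro x; rw [div_eq_one_iff_eq hrQ.ne']; norm_cast
    have e0 : ∀ x : ℤ, (x : ℚ) / r = 0 ↔ x = 0 := by
      intro x; rw [div_eq_zero_iff]; simp [hrQ.ne']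
    rw [v0, v1, v2, v3, sum, sum, hF, div_le_one hrQ, one_lt_div hrQ, div_lt_one hrQ,
      e1, e1, e1, e0, e0]
    have c1 : ((F : ℝ) / r = (((((n0 + n1 : ℤ) : ℚ) / r : ℚ)) : ℝ)) ↔ F = n0 + n1 := by
      push_cast
      rw [div_left_inj' hrR.ne']; norm_cast
    have c2 : ((F : ℝ) / r = (((((n0 + n1 : ℤ) : ℚ) / r : ℚ)) : ℝ) - 1) ↔ F = n0 + n1 - r := by
      push_cast
      rw [← div_self hrR.ne', ← sub_div, div_left_inj' hrR.ne']; norm_cast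
    rw [c1, c2]
    have c3 : (((n0 + n1 : ℤ) : ℚ) ≤ r) ↔ n0 + n1 ≤ r := by norm_cast
    have c4 : ((r : ℚ) < ((n2 + n3 : ℤ) : ℚ)) ↔ r < n2 + n3 := by norm_cast
    have c5 : (((n2 + n3 : ℤ) : ℚ) < r) ↔ n2 + n3 < r := by norm_cast
    rw [c3, c4, c5]
    rcases h with h | h
    · exact Or.inl ⟨h, fun h' => by have := h.2.2.1; have := h'.2.1; omega⟩
    · exact Or.inr ⟨h, fun h' => by have := h.2.1; have := h'.2.2.1; omega⟩
  · intro k hk1 hk2 hB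
    have gab := hII.2.2.2.2.1
    have hmod := hII.2.2.2.2.2.2.2.2.2.2
    have hxy := (hwt _ hform.1)
    simp at hxy
    have hlat : alphaK r a b c d k ∈ latN r a b c d := by
      refine ⟨k, fun i => -(![a, b, c, d] i * k / r), fun i => ?_⟩
      unfold alphaK res
      have := Int.emod_add_mul_ediv (![a, b, c, d] i * k) r
      rw [div_add' _ _ _ hrQ.ne', div_left_inj' hrQ.ne']
      have h2 : (![a, b, c, d] i * k) % r
        = k * ![a, b, c, d] i + -(![a, b, c, d] i * k / r) * r := by linarith
      rw [h2]; push_cast; ring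
    have hres : ∀ x : ℤ, 0 ≤ res r x ∧ res r x < r := fun x =>
      ⟨Int.emod_nonneg _ hr0.ne', Int.emod_lt_of_pos _ hr0⟩
    have hlt : ∀ i, 0 ≤ alphaK r a b c d k i ∧ alphaK r a b c d k i < 1 := by
      intro i
      unfold alphaK
      have h1 := hres (![a, b, c, d] i * k)
      constructor
      · have : (0 : ℚ) ≤ (res r (![a, b, c, d] i * k) : ℤ) := by exact_mod_cast h1.1
        positivity
      · rw [div_lt_one hrQ]; exact_mod_cast h1.2
    have hcube : alphaK r a b c d k ∈ cube := by
      refine ⟨fun i => ⟨(hlt i).1, (hlt i).2.le⟩, fun h => ?_⟩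
      have hz : ∀ i, r ∣ k * ![a, b, c, d] i := by
        intro i
        have h1 : alphaK r a b c d k i = 0 := (h i).resolve_right (hlt i).2.ne
        unfold alphaK res at h1
        rw [div_eq_zero_iff] at h1
        have h2 := h1.resolve_right hrQ.ne'
        rw [mul_comm]
        exact Int.dvd_of_emod_eq_zero (by exact_mod_cast h2)
      have := Int.le_of_dvd (by omega) (dvd_of_pair gab (hz 0) (hz 1))
      omega
    obtain ⟨n0, n1, n2, n3, F, v0, v1, v2, v3, hF, F0, h⟩ :=
      part1 hr0 hwt hI hII hform ⟨hlat, hcube⟩ hB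
    have conv : ∀ x n : ℤ, ((res r x : ℤ) : ℚ) / r = n / r → res r x = n := by
      intro x n hh
      rw [div_left_inj' hrQ.ne'] at hh
      exact_mod_cast hh
    have r0 := conv (a * k) n0 v0
    have r1 := conv (b * k) n1 v1
    have r2 := conv (c * k) n2 v2
    have r3 := conv (d * k) n3 v3
    have b0 := hres (a * k)
    have b1 := hres (b * k)
    have b2 := hres (c * k)
    have b3 := hres (d * k)
    have be := hres (e * k)
    have m0 := Int.emod_add_mul_ediv (a * k) r
    have m1 := Int.emod_add_mul_ediv (b * k) r
    have m2 := Int.emod_add_mul_ediv (c * k) r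
    have m3 := Int.emod_add_mul_ediv (d * k) r
    have me := Int.emod_add_mul_ediv (e * k) r
    obtain ⟨y, hy⟩ := hxy.dvd
    obtain ⟨z, hz⟩ := hmod.dvd
    have E1 : r ∣ res r (a * k) + res r (b * k) - res r (e * k) := by
      unfold res
      exact ⟨-(y * k) - a * k / r - b * k / r + e * k / r, by linear_combination m0 + m1 - me - k * hy⟩
    have E2 : r ∣ res r (c * k) + res r (d * k) - k := by
      unfold res
      exact ⟨(y - z) * k - c * k / r - d * k / r, by linear_combination m2 + m3 + k * hy - k * hz⟩
    obtain ⟨s, hs⟩ := E1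
    obtain ⟨t, ht⟩ := E2
    have s0 : -1 < s := by by_contra hh; nlinarith
    have t0 : -1 < t := by by_contra hh; nlinarith
    have s1 : s < 2 := by by_contra hh; nlinarith
    have t1 : t < 2 := by by_contra hh; nlinarith
    obtain rfl | rfl : s = 0 ∨ s = 1 := by omega
    all_goals obtain rfl | rfl : t = 0 ∨ t = 1 := by omega
    all_goals simp only [mul_zero, mul_one] at hs ht
    all_goals omega

end GapPaper
end
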